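/- CQ-conservativity and hom-conservativity for frontier-one TGDs are decidable: both the set of (encodings of) tuples (T1, T2, ΣD, ΣQ) with T2 ΣD,ΣQ-CQ-conservative over T1 and the set of such tuples with T2 ΣD,ΣQ-hom-conservative over T1, where T1, T2 are finite sets of frontier-one TGDs and ΣD, ΣQ are finite schemas, are computable. -/

import Mathlib

set_option autoImplicit false

/-! ### Terms: constants from 𝐂 (coded `Term.const n`) and nulls from 𝐍 (coded `Term.null n`) -/

inductive Term : Type
  | const : ℕ → Term
  | null  : ℕ → Term
deriving DecidableEq

def Term.isConst : Term → Prop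
  | .const _ => True
  | .null _  => False

def termEquiv : Term ≃ ℕ ⊕ ℕ where
  toFun t := match t with
    | .const n => Sum.inl n
    | .null n  => Sum.inr n
  invFun x := match x with
    | Sum.inl n => .const n
    | Sum.inr n => .null n
  left_inv t := by cases t <;> rfl
  right_inv x := by cases x <;> rfl

instance : Primcodable Term := Primcodable.ofEquiv _ termEquiv

/-! ### Relation symbols (with arity) and schemas -/

structure RelSym : Type where
  name : ℕ
  arity : ℕ
deriving DecidableEq

def relSymEquiv : RelSym ≃ ℕ × ℕ where
  toFun r := (r.name, r.arity)
  invFun p := ⟨p.1, p.2⟩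
  left_inv r := rfl
  right_inv p := rfl

instance : Primcodable RelSym := Primcodable.ofEquiv _ relSymEquiv

/-- A schema is a set of relation symbols. -/
abbrev Schema := Set RelSym

/-! ### Facts, instances, databases -/

structure Fct : Type where
  rel : RelSym
  args : List Term
deriving DecidableEq

def fctEquiv : Fct ≃ RelSym × List Term where
  toFun f := (f.rel, f.args)
  invFun p := ⟨p.1, p.2⟩
  left_inv f := rfl
  right_inv p := rfl

instance : Primcodable Fct := Primcodable.ofEquiv _ fctEquiv

/-- A fact is well-formed if its argument tuple matches the arity of its relation symbol
(arities are ≥ 1). -/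
def Fct.wf (f : Fct) : Prop := f.args.length = f.rel.arity ∧ 1 ≤ f.rel.arity

/-- An instance is a (possibly infinite) set of facts. -/
abbrev Inst := Set Fct

/-- The active domain of an instance. -/
def adom (I : Inst) : Set Term := { t | ∃ f ∈ I, t ∈ f.args }

/-- A database: a finite instance of well-formed facts using only constants from 𝐂. -/
def IsDB (I : Inst) : Prop :=
  I.Finite ∧ ∀ f ∈ I, f.wf ∧ ∀ t ∈ f.args, t.isConst

/-- `I` is a Σ-instance. -/
def InstOver (I : Inst) (S : Schema) : Prop := ∀ f ∈ I, f.rel ∈ S ∧ f.wf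

/-- `I` is a Σ-database. -/
def IsDatabase (I : Inst) (S : Schema) : Prop := IsDB I ∧ ∀ f ∈ I, f.rel ∈ S

/-! ### Homomorphisms -/

def Fct.map (h : Term → Term) (f : Fct) : Fct := ⟨f.rel, f.args.map h⟩

/-- `h` is a Σ-homomorphism from `I` to `J`. -/
def IsHomOn (S : Schema) (h : Term → Term) (I J : Inst) : Prop :=
  ∀ f ∈ I, f.rel ∈ S → f.map h ∈ J

/-- `h` is a homomorphism from `I` to `J` (all relation symbols). -/
def IsFullHom (h : Term → Term) (I J : Inst) : Prop := ∀ f ∈ I, f.map h ∈ J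

/-- `h` is database-preserving: it is the identity on all constants from 𝐂. -/
def DBPres (h : Term → Term) : Prop := ∀ n : ℕ, h (Term.const n) = Term.const n

/-- `I →_Σ J`: there is a database-preserving Σ-homomorphism from `I` to `J`. -/
def HomTo (S : Schema) (I J : Inst) : Prop := ∃ h, DBPres h ∧ IsHomOn S h I J

/-- The induced subinstance of `I` on a set `A` of terms. -/
def restrict (I : Inst) (A : Set Term) : Inst := { f | f ∈ I ∧ ∀ t ∈ f.args, t ∈ A }

/-- `I →ⁿ_Σ J`: every induced subinstance of `I` with at most `n` active-domain elements
admits a database-preserving Σ-homomorphism to `J`. -/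
def HomN (S : Schema) (n : ℕ) (I J : Inst) : Prop :=
  ∀ A : Set Term, A ⊆ adom I → A.Finite → A.ncard ≤ n → HomTo S (restrict I A) J

/-- `I →^lim_Σ J`. -/
def HomLim (S : Schema) (I J : Inst) : Prop := ∀ n : ℕ, 1 ≤ n → HomN S n I J

/-- Homomorphic equivalence of instances. -/
def HomEquiv (I J : Inst) : Prop := (∃ h, IsFullHom h I J) ∧ (∃ h, IsFullHom h J I)

/-! ### Gaifman graph and connectedness -/

def coOccur (I : Inst) (a b : Term) : Prop := ∃ f ∈ I, a ∈ f.args ∧ b ∈ f.args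

/-- The Gaifman graph of `I` is connected. -/
def Connected (I : Inst) : Prop :=
  ∀ a ∈ adom I, ∀ b ∈ adom I, Relation.ReflTransGen (coOccur I) a b

/-- Restriction `I|_Σ` of `I` to the facts using a relation symbol from Σ. -/
def restrS (I : Inst) (S : Schema) : Inst := { f | f ∈ I ∧ f.rel ∈ S }

/-- `I` is Σ-connected. -/
def SConnected (S : Schema) (I : Inst) : Prop := Connected (restrS I S)

/-- `C` is a maximally Σ-connected component of `I`. -/
def MaxConnComp (S : Schema) (I C : Inst) : Prop :=
  C ⊆ restrS I S ∧ Connected C ∧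
    ∀ C', C ⊆ C' → C' ⊆ restrS I S → Connected C' → C' = C

/-! ### Conjunctive queries -/

structure Atom : Type where
  rel : RelSym
  args : List ℕ
deriving DecidableEq

def atomEquiv : Atom ≃ RelSym × List ℕ where
  toFun a := (a.rel, a.args)
  invFun p := ⟨p.1, p.2⟩
  left_inv a := rfl
  right_inv p := rfl

instance : Primcodable Atom := Primcodable.ofEquiv _ atomEquiv

def Atom.wf (a : Atom) : Prop := a.args.length = a.rel.arity ∧ 1 ≤ a.rel.arity

/-- Instantiate an atom by an assignment of terms to variables. -/
def Atom.inst (h : ℕ → Term) (a : Atom) : Fct := ⟨a.rel, a.args.map h⟩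

/-- A conjunctive query: a finite set of relational atoms (as a list) together with a
tuple of answer variables. -/
structure CQ : Type where
  atoms : List Atom
  ans : List ℕ
deriving DecidableEq

def cqEquiv : CQ ≃ List Atom × List ℕ where
  toFun q := (q.atoms, q.ans)
  invFun p := ⟨p.1, p.2⟩
  left_inv q := rfl
  right_inv p := rfl

instance : Primcodable CQ := Primcodable.ofEquiv _ cqEquiv

/-- `q` is a CQ over schema Σ. -/
def CQ.Over (q : CQ) (S : Schema) : Prop := ∀ a ∈ q.atoms, a.rel ∈ S ∧ a.wf

/-- A homomorphism from `q` to `I`. -/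
def CQHom (q : CQ) (I : Inst) (h : ℕ → Term) : Prop := ∀ a ∈ q.atoms, a.inst h ∈ I

/-- `c̄` is an answer to `q` on `I`. -/
def IsAnswer (q : CQ) (I : Inst) (c : List Term) : Prop :=
  (∀ x ∈ c, x ∈ adom I) ∧ ∃ h, CQHom q I h ∧ q.ans.map h = c

/-- The canonical database of a CQ (variables viewed as constants/nulls). -/
def canonDB (q : CQ) : Inst := { f | ∃ a ∈ q.atoms, f = a.inst Term.null }

/-! ### Tuple-generating dependencies -/

/-- A TGD `∀x̄∀ȳ (φ(x̄,ȳ) → ∃z̄ ψ(x̄,z̄))`, with `frontier` the tuple `x̄` of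
frontier variables. -/
structure TGD : Type where
  body : List Atom
  head : List Atom
  frontier : List ℕ
deriving DecidableEq

def tgdEquiv : TGD ≃ List Atom × List Atom × List ℕ where
  toFun t := (t.body, t.head, t.frontier)
  invFun p := ⟨p.1, p.2.1, p.2.2⟩
  left_inv t := rfl
  right_inv p := rfl

instance : Primcodable TGD := Primcodable.ofEquiv _ tgdEquiv

def TGD.bodyVars (t : TGD) : Set ℕ := { x | ∃ a ∈ t.body, x ∈ a.args }
def TGD.headVars (t : TGD) : Set ℕ := { x | ∃ a ∈ t.head, x ∈ a.args }

/-- Well-formedness of a TGD: atoms are well-formed, the frontier variables are distinct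
body variables, and every variable shared by body and head is a frontier variable. -/
def TGD.wf (t : TGD) : Prop :=
  (∀ a ∈ t.body, a.wf) ∧ (∀ a ∈ t.head, a.wf) ∧ t.frontier.Nodup ∧
  (∀ x ∈ t.frontier, x ∈ t.bodyVars) ∧
  (∀ x, x ∈ t.bodyVars → x ∈ t.headVars → x ∈ t.frontier)

/-- A TGD is linear if its body contains at most one atom. -/
def TGD.Linear (t : TGD) : Prop := t.body.length ≤ 1

/-- A TGD is guarded if some body atom contains all body variables. -/
def TGD.Guarded (t : TGD) : Prop := ∃ a ∈ t.body, ∀ x, x ∈ t.bodyVars → x ∈ a.args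

/-- A TGD is frontier-one if it has exactly one frontier variable. -/
def TGD.FrontierOne (t : TGD) : Prop := t.frontier.length = 1

/-- `I ⊨ ϑ`. -/
def TGD.Satisfies (I : Inst) (t : TGD) : Prop :=
  ∀ g : ℕ → Term, (∀ a ∈ t.body, a.inst g ∈ I) →
    ∃ h : ℕ → Term, (∀ a ∈ t.head, a.inst h ∈ I) ∧ ∀ x ∈ t.frontier, h x = g x

/-- `I` is a model of the set `T` of TGDs. -/
def IsModel (I : Inst) (T : List TGD) : Prop := ∀ t ∈ T, TGD.Satisfies I t

/-- Number of (distinct) variables in the body of a TGD. -/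
def TGD.bodyVarList (t : TGD) : List ℕ := ((t.body.map Atom.args).flatten).dedup

/-- The body width of a set of TGDs. -/
def bodyWidth (T : List TGD) : ℕ := (T.map (fun t => t.bodyVarList.length)).foldr max 0

/-! ### The chase -/

/-- `ϑ` is applicable at tuple `c̄` in `I`. -/
def TGD.Applicable (t : TGD) (I : Inst) (c : List Term) : Prop :=
  (∃ g : ℕ → Term, (∀ a ∈ t.body, a.inst g ∈ I) ∧ t.frontier.map g = c) ∧
  ¬ (∃ h : ℕ → Term, (∀ a ∈ t.head, a.inst h ∈ I) ∧ t.frontier.map h = c)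

/-- `J` is the result of applying `ϑ` in `I` at `c̄`: the head is added, with the
existential variables replaced by distinct fresh nulls. -/
def TGD.StepResult (t : TGD) (I : Inst) (c : List Term) (J : Inst) : Prop :=
  ∃ h : ℕ → Term,
    t.frontier.map h = c ∧
    (∀ x, x ∈ t.headVars → x ∉ t.frontier → (¬ (h x).isConst ∧ h x ∉ adom I)) ∧
    (∀ x y, x ∈ t.headVars → y ∈ t.headVars → x ∉ t.frontier → y ∉ t.frontier →
      h x = h y → x = y) ∧
    J = I ∪ { f | ∃ a ∈ t.head, f = a.inst h }

/-- A chase step from `I` to `J` with some TGD of `T`. -/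
def ChaseStep (T : List TGD) (I J : Inst) : Prop :=
  ∃ t ∈ T, ∃ c, t.Applicable I c ∧ t.StepResult I c J

/-- A chase sequence for `I` with `T` (stalling when no TGD is applicable). -/
def IsChaseSeq (T : List TGD) (I : Inst) (f : ℕ → Inst) : Prop :=
  f 0 = I ∧ ∀ i, ChaseStep T (f i) (f (i+1)) ∨ ((¬ ∃ J, ChaseStep T (f i) J) ∧ f (i+1) = f i)

/-- Fairness: every applicable TGD application is eventually performed or becomes
non-applicable. -/
def IsFair (T : List TGD) (f : ℕ → Inst) : Prop :=
  ∀ i, ∀ t ∈ T, ∀ c, TGD.Applicable t (f i) c →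
    ∃ j, i ≤ j ∧
      ((TGD.Applicable t (f j) c ∧ TGD.StepResult t (f j) c (f (j+1))) ∨
        ¬ TGD.Applicable t (f j) c)

/-- `J` is the result of some fair chase sequence for `I` with `T`. -/
def IsChaseResult (T : List TGD) (I J : Inst) : Prop :=
  ∃ f : ℕ → Inst, IsChaseSeq T I f ∧ IsFair T f ∧ J = ⋃ i, f i

/-- `chase T I`: the result of an arbitrary but fixed fair chase sequence for `I` with `T`. -/
noncomputable def chase (T : List TGD) (I : Inst) : Inst :=
  @dite _ (∃ J, IsChaseResult T I J) (Classical.dec _) (fun h => h.choose) (fun _ => I)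

/-! ### Query answering w.r.t. TGDs and conservativity notions -/

/-- `c̄ ∈ q_T(D)`: `c̄` is a tuple over `adom D` and an answer to `q` on `chase T D`. -/
def AnswerWrt (q : CQ) (T : List TGD) (D : Inst) (c : List Term) : Prop :=
  (∀ x ∈ c, x ∈ adom D) ∧ ∃ h, CQHom q (chase T D) h ∧ q.ans.map h = c

/-- `T2` is `ΣD,ΣQ`-hom-conservative over `T1`. -/
def HomConservative (T1 T2 : List TGD) (SD SQ : Schema) : Prop :=
  ∀ D, IsDatabase D SD → HomTo SQ (chase T2 D) (chase T1 D)

/-- `T2` is `ΣD,ΣQ`-CQ-conservative over `T1`. -/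
def CQConservative (T1 T2 : List TGD) (SD SQ : Schema) : Prop :=
  ∀ D, IsDatabase D SD → ∀ q : CQ, CQ.Over q SQ →
    ∀ c, AnswerWrt q T2 D c → AnswerWrt q T1 D c

/-- `T` is `ΣD,ΣQ`-hom-trivial. -/
def HomTrivial (T : List TGD) (SD SQ : Schema) : Prop :=
  ∀ D, IsDatabase D SD → HomTo SQ (chase T D) D

/-- `T` is `ΣD,ΣQ`-CQ-trivial. -/
def CQTrivial (T : List TGD) (SD SQ : Schema) : Prop :=
  ∀ D, IsDatabase D SD → ∀ q : CQ, CQ.Over q SQ →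
    ∀ c, AnswerWrt q T D c → IsAnswer q D c

namespace FrontierOne

section

/-! ### Structures, patterns and their combination -/

/-- An atom over numbered variables. -/
abbrev At (ρ : Type) := ρ × List ℕ

/-- A pattern: a finite set of atoms, with variable `0` as its root. -/
abbrev Pat (ρ : Type) := List (At ρ)

/-- A relational structure with elements from `X`. -/
abbrev Str (ρ X : Type) := Set (ρ × List X)

variable {ρ X Y Z : Type}

def mapA (f : X → Y) (a : ρ × List X) : ρ × List Y := (a.1, a.2.map f)

theorem mapA_mapA (g : Y → Z) (f : X → Y) (a : ρ × List X) :
    mapA g (mapA f a) = mapA (fun x => g (f x)) a := by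
  simp [mapA, Function.comp_def]

theorem mapA_congr {f g : X → Y} {a : ρ × List X} (h : ∀ x ∈ a.2, f x = g x) :
    mapA f a = mapA g a := by
  simp only [mapA, Prod.mk.injEq, true_and]
  exact List.map_congr_left h

theorem mapA_id (a : ρ × List X) : mapA (fun x => x) a = a := by simp [mapA]

theorem mapA_eq_self {f : X → X} {a : ρ × List X} (h : ∀ x ∈ a.2, f x = x) : mapA f a = a := by
  rw [mapA_congr h, mapA_id]

theorem mem_mapA {f : X → Y} {a : ρ × List X} {y : Y} :
    y ∈ (mapA f a).2 ↔ ∃ x ∈ a.2, f x = y := by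
  simp [mapA]

/-- The pattern `p` holds at `e` in `M`. -/
def Tr (M : Str ρ X) (p : Pat ρ) (e : X) : Prop :=
  ∃ f : ℕ → X, f 0 = e ∧ ∀ a ∈ p, mapA f a ∈ M

theorem Tr.mono {M N : Str ρ X} (h : M ⊆ N) {p : Pat ρ} {e : X} : Tr M p e → Tr N p e :=
  fun ⟨f, h0, hf⟩ => ⟨f, h0, fun a ha => h (hf a ha)⟩

theorem Tr.map {M : Str ρ X} {N : Str ρ Y} {h : X → Y} (hh : ∀ φ ∈ M, mapA h φ ∈ N) {p : Pat ρ}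
    {e : X} : Tr M p e → Tr N p (h e) := by
  rintro ⟨f, rfl, hf⟩
  refine ⟨fun i => h (f i), rfl, fun a ha => ?_⟩
  rw [← mapA_mapA]
  exact hh _ (hf a ha)

/-- Image of a structure. -/
def img (h : X → Y) (M : Str ρ X) : Str ρ Y := mapA h '' M

theorem Tr.of_img {M : Str ρ X} {h : X → Y} (hh : Function.Injective h) {p : Pat ρ} {e : X}
    (ht : Tr (img h M) p (h e)) : Tr M p e := by
  have : Nonempty X := ⟨e⟩
  obtain ⟨f, h0, hf⟩ := ht
  have hl := Function.leftInverse_invFun hh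
  refine ⟨fun i => Function.invFun h (f i), by simp only [h0]; exact hl e, fun a ha => ?_⟩
  obtain ⟨ψ, hψ, hm⟩ := hf a ha
  rw [← mapA_mapA, ← hm, mapA_mapA, mapA_eq_self (fun x _ => hl x)]
  exact hψ

/-- Root the variables flagged by `ex`. -/
def rx (ex : ℕ → Bool) (i : ℕ) : ℕ := if ex i then 0 else i

/-- `q` follows at the element `b0` of a bag `B` from patterns `θ b` at the elements `b`. -/
def comb (w : ℕ) (B : Pat ρ) (θ : ℕ → Pat ρ → Prop) (b0 : ℕ) (q : Pat ρ) : Prop :=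
  ∃ (loc : ℕ → ℕ) (ex : ℕ → Bool) (P : ℕ → Pat ρ),
    (∀ i, loc i < w) ∧ loc 0 = b0 ∧ ex 0 = true ∧
    (∀ b, ∀ a' ∈ P b, ∃ a ∈ q, (∀ i ∈ a.2, loc i = b) ∧ a' = mapA (rx ex) a) ∧
    ∀ a ∈ q, ((∀ i ∈ a.2, ex i = true) ∧ mapA loc a ∈ B) ∨
      ∃ b < w, (∀ i ∈ a.2, loc i = b) ∧ θ b (P b) ∧ mapA (rx ex) a ∈ P b

theorem comb_mono {w : ℕ} {B B' : Pat ρ} {θ θ' : ℕ → Pat ρ → Prop} {b0 : ℕ} {q : Pat ρ}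
    (hB : ∀ a ∈ B, a ∈ B') (hθ : ∀ b < w, ∀ p, θ b p → θ' b p) (h : comb w B θ b0 q) :
    comb w B' θ' b0 q := by
  obtain ⟨loc, ex, P, h1, h2, h3, h4, h5⟩ := h
  refine ⟨loc, ex, P, h1, h2, h3, h4, fun a ha => ?_⟩
  rcases h5 a ha with ⟨h6, h7⟩ | ⟨b, hb, h6, h7, h8⟩
  · exact Or.inl ⟨h6, hB _ h7⟩
  · exact Or.inr ⟨b, hb, h6, hθ b hb _ h7, h8⟩

theorem comb_self {w : ℕ} {B : Pat ρ} {θ : ℕ → Pat ρ → Prop} {b0 : ℕ} {q : Pat ρ} (hw : b0 < w)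
    (h : θ b0 q) : comb w B θ b0 q := by
  have hr : ∀ i, rx (fun i => decide (i = 0)) i = i := fun i => by
    by_cases hi : i = 0 <;> simp [rx, hi]
  refine ⟨fun _ => b0, fun i => decide (i = 0), fun b => if b = b0 then q else [], fun _ => hw, rfl,
    rfl, fun b a' ha' => ?_, fun a ha => Or.inr ⟨b0, hw, fun _ _ => rfl, by simpa using h, ?_⟩⟩
  · by_cases hb : b = b0
    · simp only [if_pos hb] at ha'
      exact ⟨a', ha', fun _ _ => hb.symm, (mapA_eq_self fun x _ => hr x).symm⟩
    · simp [if_neg hb] at ha'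
  · simpa [mapA_eq_self fun x _ => hr x] using ha

/-- Soundness of combination, with a bound on the size of the patterns used. -/
theorem comb_sound {w : ℕ} {B : Pat ρ} {θ : ℕ → Pat ρ → Prop} {b0 : ℕ} {q : Pat ρ}
    {M : Str ρ X} {e : ℕ → X} (hB : ∀ a ∈ B, mapA e a ∈ M)
    (hθ : ∀ b < w, ∀ p, θ b p → Tr M p (e b)) (h : comb w B θ b0 q) : Tr M q (e b0) := by
  classical
  obtain ⟨loc, ex, P, h1, h2, h3, h4, h5⟩ := h
  have hf : ∀ b, ∃ f : ℕ → X, b < w → θ b (P b) → f 0 = e b ∧ ∀ a ∈ P b, mapA f a ∈ M := by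
    intro b
    by_cases hb : b < w ∧ θ b (P b)
    · obtain ⟨f, hf⟩ := hθ b hb.1 _ hb.2
      exact ⟨f, fun _ _ => hf⟩
    · exact ⟨e, fun h h' => (hb ⟨h, h'⟩).elim⟩
  choose f hf using hf
  refine ⟨fun i => if ex i then e (loc i) else f (loc i) i, by simp [h2, h3], fun a ha => ?_⟩
  rcases h5 a ha with ⟨h6, h7⟩ | ⟨b, hb, h6, h7, h8⟩
  · have := hB _ h7
    rw [mapA_mapA] at this
    rwa [mapA_congr (g := fun i => e (loc i)) (fun i hi => by simp [h6 i hi])]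
  · have := (hf b hb h7).2 _ h8
    rw [mapA_mapA] at this
    rwa [mapA_congr (g := fun i => f b (rx ex i))]
    intro i hi
    by_cases hx : ex i <;> simp [hx, rx, h6 i hi, (hf b hb h7).1]

/-- Every atom of the pattern is connected to the root. -/
def Conn (p : Pat ρ) : Prop :=
  ∀ V : Set ℕ, 0 ∈ V → (∀ a ∈ p, (∃ i ∈ a.2, i ∈ V) → ∀ i ∈ a.2, i ∈ V) →
    ∀ a ∈ p, ∀ i ∈ a.2, i ∈ V

/-- A universe of atoms with variables below `w`, closed under renaming. -/
structure Uni (w : ℕ) (U : Pat ρ) : Prop where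
  pos : 0 < w
  lt : ∀ a ∈ U, ∀ i ∈ a.2, i < w
  ne : ∀ a ∈ U, a.2 ≠ []
  ren : ∀ a ∈ U, ∀ g : ℕ → ℕ, (∀ i ∈ a.2, g i < w) → mapA g a ∈ U

open Classical in
/-- Completeness of combination for a structure which decomposes around a bag. -/
theorem comb_complete {w : ℕ} {U : Pat ρ} (hU : Uni w U) {N : Str ρ X} {Nb : ℕ → Str ρ X}
    {B : Pat ρ} (lo : X → ℕ) (e : ℕ → X) (hlo : ∀ x, lo x < w)
    (hN : ∀ φ ∈ N, ((∀ x ∈ φ.2, e (lo x) = x) ∧ mapA lo φ ∈ B) ∨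
      ∃ b < w, (∀ x ∈ φ.2, lo x = b) ∧ φ ∈ Nb b)
    {b0 : ℕ} (hb : lo (e b0) = b0) {q : Pat ρ} (hq : ∀ a ∈ q, a ∈ U) (h : Tr N q (e b0)) :
    comb w B (fun b P => P ∈ U.sublists ∧ (Conn q → Conn P) ∧ Tr (Nb b) P (e b)) b0 q := by
  obtain ⟨f, h0, hf⟩ := h
  set ex : ℕ → Bool := fun i => decide (e (lo (f i)) = f i) with hex
  have hrx : ∀ i, rx ex i ≤ i := fun i => by unfold rx; split <;> omega
  set P : ℕ → Pat ρ := fun b => U.filter fun a' => ∃ a ∈ q, (∀ i ∈ a.2, lo (f i) = b) ∧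
    mapA f a ∈ Nb b ∧ a' = mapA (rx ex) a with hP
  have hex0 : ex 0 = true := by simp [hex, h0, hb]
  have hmemP : ∀ b a, a ∈ q → (∀ i ∈ a.2, lo (f i) = b) → mapA f a ∈ Nb b →
      mapA (rx ex) a ∈ P b := fun b a ha h1 h2 => by
    simp only [hP, List.mem_filter, decide_eq_true_eq]
    exact ⟨hU.ren a (hq a ha) _ fun i hi => (hrx i).trans_lt (hU.lt a (hq a ha) i hi),
      a, ha, h1, h2, rfl⟩
  have hPmem : ∀ b a', a' ∈ P b → ∃ a ∈ q, (∀ i ∈ a.2, lo (f i) = b) ∧ mapA f a ∈ Nb b ∧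
      a' = mapA (rx ex) a := fun b a' h => by
    simp only [hP, List.mem_filter, decide_eq_true_eq] at h
    exact h.2
  refine ⟨fun i => lo (f i), ex, P, fun i => hlo _, by simp [h0, hb], hex0,
    fun b a' ha' => ?_, fun a ha => ?_⟩
  · obtain ⟨a, ha, h1, -, h2⟩ := hPmem b a' ha'
    exact ⟨a, ha, h1, h2⟩
  · rcases hN _ (hf a ha) with ⟨h1, h2⟩ | ⟨b, hbw, h1, h2⟩
    · refine Or.inl ⟨fun i hi => ?_, by rwa [mapA_mapA] at h2⟩
      simp only [hex, decide_eq_true_eq]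
      exact h1 _ (mem_mapA.2 ⟨i, hi, rfl⟩)
    · have h1' : ∀ i ∈ a.2, lo (f i) = b := fun i hi => h1 _ (mem_mapA.2 ⟨i, hi, rfl⟩)
      refine Or.inr ⟨b, hbw, h1', ⟨?_, ?_, ?_⟩, hmemP b a ha h1' h2⟩
      · exact List.mem_sublists.2 List.filter_sublist
      · intro hc V hV0 hV
        have key := hc {i | ¬ (lo (f i) = b ∧ ex i = false) ∨ i ∈ V} (Or.inr hV0) ?_
        · intro a' ha' j hj
          obtain ⟨c, hcq, hc1, hc2, rfl⟩ := hPmem b a' ha'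
          obtain ⟨i, hi, rfl⟩ := mem_mapA.1 hj
          rcases key c hcq i hi with h | h
          · have : ex i = true := by
              by_contra hne
              exact h ⟨hc1 i hi, by simpa using hne⟩
            simpa [rx, this] using hV0
          · by_cases hxi : ex i <;> simp [rx, hxi, h, hV0]
        · rintro c hcq ⟨i, hi, hiV⟩ j hj
          by_cases hj' : lo (f j) = b ∧ ex j = false
          · rcases hN _ (hf c hcq) with ⟨h3, -⟩ | ⟨b', hb', h3, h4⟩
            · have h5 := h3 (f j) (mem_mapA.2 ⟨j, hj, rfl⟩)
              simp only [hex, decide_eq_false_iff_not] at hj'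
              exact (hj'.2 h5).elim
            · have h3' : ∀ i ∈ c.2, lo (f i) = b' := fun i hi => h3 _ (mem_mapA.2 ⟨i, hi, rfl⟩)
              have hbb : b' = b := (h3' j hj).symm.trans hj'.1
              subst hbb
              right
              have := hV _ (hmemP _ c hcq h3' h4) ⟨rx ex i, mem_mapA.2 ⟨i, hi, rfl⟩, ?_⟩ (rx ex j)
                (mem_mapA.2 ⟨j, hj, rfl⟩)
              · simpa [rx, hj'.2] using this
              · rcases hiV with h | h
                · have : ex i = true := by
                    by_contra hne
                    exact h ⟨h3' i hi, by simpa using hne⟩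
                  simpa [rx, this] using hV0
                · by_cases hxi : ex i <;> simp [rx, hxi, h, hV0]
          · exact Or.inl hj'
      · refine ⟨fun i => if i = 0 then e b else f i, by simp, fun a' ha' => ?_⟩
        obtain ⟨c, hcq, hc1, hc2, rfl⟩ := hPmem b a' ha'
        rw [mapA_mapA, mapA_congr (g := f)]
        · exact hc2
        · intro i hi
          by_cases hxi : ex i
          · simp only [rx, hxi, if_true]
            simp only [hex, decide_eq_true_eq] at hxi
            rw [← hc1 i hi, hxi]
          · have : i ≠ 0 := fun h => hxi (h ▸ hex0)
            simp [rx, hxi, this]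

end

/-! ### Properties of the chase -/

section Chase

theorem adom_mono {I J : Inst} (h : I ⊆ J) : adom I ⊆ adom J :=
  fun _ ⟨f, hf, ht⟩ => ⟨f, h hf, ht⟩

theorem adom_finite {I : Inst} (h : I.Finite) : (adom I).Finite := by
  have : adom I = ⋃ f ∈ I, {t | t ∈ f.args} := by ext; simp [adom]
  rw [this]
  exact h.biUnion fun f _ => List.finite_toSet f.args

theorem exists_fresh {S : Set Term} (h : S.Finite) : ∃ m, ∀ k, m ≤ k → Term.null k ∉ S := by
  have : {k | Term.null k ∈ S}.Finite :=
    Set.Finite.preimage (fun a _ b _ hab => by simpa using hab) h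
  obtain ⟨m, hm⟩ := this.bddAbove
  exact ⟨m + 1, fun k hk hkS => by have := hm hkS; omega⟩

theorem exists_stepResult {t : TGD} {I : Inst} (hI : I.Finite) {c : List Term}
    (h : t.Applicable I c) : ∃ J, t.StepResult I c J := by
  classical
  obtain ⟨⟨g, -, hg⟩, -⟩ := h
  obtain ⟨m, hm⟩ := exists_fresh (adom_finite hI)
  refine ⟨_, fun x => if x ∈ t.frontier then g x else Term.null (m + x), ?_, ?_, ?_, rfl⟩
  · rw [← hg]
    exact List.map_congr_left fun x hx => by simp [hx]
  · intro x _ hx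
    simp only [if_neg hx, Term.isConst, not_false_eq_true, true_and]
    exact hm _ (by omega)
  · intro x y _ _ hx hy hxy
    simpa [hx, hy] using hxy

theorem stepResult_finite {t : TGD} {I J : Inst} {c : List Term} (hI : I.Finite)
    (h : t.StepResult I c J) : J.Finite := by
  obtain ⟨h, -, -, -, rfl⟩ := h
  refine hI.union ((t.head.finite_toSet.image (Atom.inst h)).subset ?_)
  rintro f ⟨a, ha, rfl⟩
  exact ⟨a, ha, rfl⟩

theorem stepResult_subset {t : TGD} {I J : Inst} {c : List Term} (h : t.StepResult I c J) :
    I ⊆ J := by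
  obtain ⟨h, -, -, -, rfl⟩ := h
  exact Set.subset_union_left

theorem stepResult_not_applicable {t : TGD} {I J K : Inst} {c : List Term}
    (h : t.StepResult I c J) (hJ : J ⊆ K) : ¬ t.Applicable K c := by
  obtain ⟨h, hc, -, -, rfl⟩ := h
  exact fun ha => ha.2 ⟨h, fun a ha => hJ (Or.inr ⟨a, ha, rfl⟩), hc⟩

/-- Some trigger with code `k` is applicable. -/
def TrigAt (T : List TGD) (I : Inst) (k : ℕ) : Prop :=
  ∃ t ∈ T, ∃ c, Encodable.encode (t, c) = k ∧ t.Applicable I c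

/-- `J` results from `I` by applying the first applicable trigger, if any. -/
def FirstStep (T : List TGD) (I J : Inst) : Prop :=
  (∃ t ∈ T, ∃ c, t.Applicable I c ∧ t.StepResult I c J ∧
    ∀ k, TrigAt T I k → Encodable.encode (t, c) ≤ k) ∨ ((∀ k, ¬ TrigAt T I k) ∧ J = I)

theorem exists_firstStep (T : List TGD) {I : Inst} (hI : I.Finite) :
    ∃ J, J.Finite ∧ FirstStep T I J := by
  classical
  by_cases h : ∃ k, TrigAt T I k
  · obtain ⟨t, ht, c, hk, ha⟩ := Nat.find_spec h
    obtain ⟨J, hJ⟩ := exists_stepResult hI ha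
    exact ⟨J, stepResult_finite hI hJ, Or.inl ⟨t, ht, c, ha, hJ, fun k hk' =>
      hk ▸ Nat.find_min' h hk'⟩⟩
  · exact ⟨I, hI, Or.inr ⟨not_exists.1 h, rfl⟩⟩

theorem exists_chaseResult (T : List TGD) {I : Inst} (hI : I.Finite) :
    ∃ J, IsChaseResult T I J := by
  classical
  choose nxt hfin hnxt using fun K : {K : Inst // K.Finite} => exists_firstStep T K.2
  set f : ℕ → {K : Inst // K.Finite} := fun n => Nat.rec ⟨I, hI⟩ (fun _ K => ⟨nxt K, hfin K⟩) n
    with hf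
  have hs : ∀ n, FirstStep T (f n).1 (f (n + 1)).1 := fun n => hnxt (f n)
  have hmono : Monotone fun n => (f n).1 := monotone_nat_of_le_succ fun n => by
    rcases hs n with ⟨t, -, c, -, h, -⟩ | ⟨-, h⟩
    · exact stepResult_subset h
    · exact h.ge
  refine ⟨_, fun n => (f n).1, ⟨rfl, fun n => ?_⟩, ?_, rfl⟩
  · rcases hs n with ⟨t, ht, c, ha, h, -⟩ | ⟨h, h'⟩
    · exact Or.inl ⟨t, ht, c, ha, h⟩
    · exact Or.inr ⟨fun ⟨J, t, ht, c, ha, _⟩ => h _ ⟨t, ht, c, rfl, ha⟩, h'⟩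
  · intro i t ht c ha
    by_contra hcon
    push Not at hcon
    have key : ∀ j, ∃ t' ∈ T, ∃ c', t'.Applicable (f (i + j)).1 c' ∧
        t'.StepResult (f (i + j)).1 c' (f (i + j + 1)).1 ∧
        Encodable.encode (t', c') ≤ Encodable.encode (t, c) := by
      intro j
      have ha' := (hcon (i + j) (by omega)).2
      rcases hs (i + j) with ⟨t', ht', c', h1, h2, h3⟩ | ⟨h, -⟩
      · exact ⟨t', ht', c', h1, h2, h3 _ ⟨t, ht, c, rfl, ha'⟩⟩
      · exact (h _ ⟨t, ht, c, rfl, ha'⟩).elim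
    choose t' _ c' h1 h2 h3 using key
    have hinj : Function.Injective fun j => Encodable.encode (t' j, c' j) := by
      have : ∀ j j', j < j' → Encodable.encode (t' j, c' j) ≠ Encodable.encode (t' j', c' j') := by
        intro j j' hjj he
        have he := Encodable.encode_injective he
        simp only [Prod.mk.injEq] at he
        have := stepResult_not_applicable (h2 j) (hmono (show i + j + 1 ≤ i + j' by omega))
        rw [he.1, he.2] at this
        exact this (h1 j')
      intro j j' hjj
      rcases lt_trichotomy j j' with h | h | h
      · exact (this _ _ h hjj).elim
      · exact h
      · exact (this _ _ h hjj.symm).elim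
    have hfin' : (Set.range fun j => Encodable.encode (t' j, c' j)).Finite :=
      (Set.finite_Iic (Encodable.encode (t, c))).subset (by rintro _ ⟨j, rfl⟩; exact h3 j)
    exact Set.infinite_range_of_injective hinj hfin'

theorem chase_spec (T : List TGD) {I : Inst} (hI : I.Finite) : IsChaseResult T I (chase T I) := by
  have h := exists_chaseResult T hI
  unfold chase
  rw [dif_pos h]
  exact h.choose_spec

variable {X : Type}

/-- Facts as elements of a structure. -/
def toStr (I : Inst) : Str RelSym Term := {φ | (⟨φ.1, φ.2⟩ : Fct) ∈ I}

def Atom.at (a : Atom) : At RelSym := (a.rel, a.args)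

/-- Satisfaction of a TGD in an arbitrary structure. -/
def Sat (M : Str RelSym X) (t : TGD) : Prop :=
  ∀ g : ℕ → X, (∀ a ∈ t.body, mapA g (Atom.at a) ∈ M) →
    ∃ h : ℕ → X, (∀ a ∈ t.head, mapA h (Atom.at a) ∈ M) ∧ ∀ x ∈ t.frontier, h x = g x

theorem chaseSeq_mono {T : List TGD} {I : Inst} {f : ℕ → Inst} (h : IsChaseSeq T I f) :
    Monotone f := monotone_nat_of_le_succ fun n => by
  rcases h.2 n with ⟨t, -, c, -, h⟩ | ⟨-, h⟩
  · exact stepResult_subset h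
  · exact h.ge

theorem subset_chase (T : List TGD) {I : Inst} (hI : I.Finite) : I ⊆ chase T I := by
  obtain ⟨f, hf, -, h⟩ := chase_spec T hI
  rw [h, ← hf.1]
  exact Set.subset_iUnion f 0

theorem chase_sat {T : List TGD} {I : Inst} (hI : I.Finite) {t : TGD} (ht : t ∈ T) :
    Sat (toStr (chase T I)) t := by
  classical
  obtain ⟨f, hf, hfair, h⟩ := chase_spec T hI
  have hm := chaseSeq_mono hf
  have hsub : ∀ i, f i ⊆ chase T I := fun i => h ▸ Set.subset_iUnion f i
  intro g hg
  have : ∃ i, ∀ a ∈ t.body, a.inst g ∈ f i := by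
    have hg' : ∀ a ∈ t.body, ∃ i, a.inst g ∈ f i := fun a ha => by
      have := hg a ha
      rw [h] at this
      exact Set.mem_iUnion.1 this
    generalize t.body = l at hg'
    induction l with
    | nil => exact ⟨0, by simp⟩
    | cons a l ih =>
      obtain ⟨i, hi⟩ := hg' a (by simp)
      obtain ⟨j, hj⟩ := ih fun b hb => hg' b (by simp [hb])
      refine ⟨max i j, fun b hb => ?_⟩
      rcases List.mem_cons.1 hb with rfl | hb
      · exact hm (le_max_left i j) hi
      · exact hm (le_max_right i j) (hj b hb)
  obtain ⟨i, hi⟩ := this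
  by_contra hcon
  have hn : ∀ j, ¬ ∃ h : ℕ → Term, (∀ a ∈ t.head, a.inst h ∈ f j) ∧
      t.frontier.map h = t.frontier.map g := by
    rintro j ⟨h, h1, h2⟩
    exact hcon ⟨h, fun a ha => hsub j (h1 a ha), fun x hx => List.map_inj_left.1 h2 x hx⟩
  have ha : ∀ j, i ≤ j → t.Applicable (f j) (t.frontier.map g) := fun j hj =>
    ⟨⟨g, fun a ha => hm hj (hi a ha), rfl⟩, hn j⟩
  obtain ⟨j, hij, ⟨-, hj⟩ | hj⟩ := hfair i t ht _ (ha i le_rfl)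
  · exact stepResult_not_applicable hj (le_refl (f (j + 1))) (ha (j + 1) (by omega))
  · exact hj (ha j hij)

theorem chase_universal {T : List TGD} {I : Inst} (hI : I.Finite) {M : Str RelSym X}
    (hwf : ∀ t ∈ T, t.wf) (hM : ∀ t ∈ T, Sat M t) (h0 : Term → X)
    (hD : ∀ φ ∈ toStr I, mapA h0 φ ∈ M) :
    ∃ h : Term → X, (∀ n, h (Term.const n) = h0 (Term.const n)) ∧
      ∀ φ ∈ toStr (chase T I), mapA h φ ∈ M := by
  classical
  obtain ⟨f, hf, -, hch⟩ := chase_spec T hI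
  have hm := chaseSeq_mono hf
  let Good : ℕ → (Term → X) → Prop := fun n h => ∀ φ ∈ toStr (f n), mapA h φ ∈ M
  have step : ∀ n (h : Term → X), Good n h → ∃ h' : Term → X, Good (n + 1) h' ∧
      (∀ k, h' (Term.const k) = h (Term.const k)) ∧ ∀ t ∈ adom (f n), h' t = h t := by
    intro n h hh
    rcases hf.2 n with ⟨t, ht, c, ⟨⟨g, hg, hgc⟩, -⟩, u, huc, hu1, hu2, hu⟩ | ⟨-, hs⟩
    · obtain ⟨v, hv1, hv2⟩ := hM t ht (fun i => h (g i)) fun a ha => by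
        have := hh (Atom.at (a := a).1, (Atom.at a).2.map g) (hg a ha)
        simpa [mapA, Function.comp_def] using this
      let new : Term → ℕ → Prop := fun y x => x ∈ t.headVars ∧ x ∉ t.frontier ∧ u x = y
      have hnew : ∀ y x, new y x → ¬ y.isConst ∧ y ∉ adom (f n) := by
        rintro y x ⟨h1, h2, rfl⟩
        exact hu1 x h1 h2
      have hval : ∀ x ∈ t.headVars, (if h' : ∃ z, new (u x) z then v h'.choose else h (u x)) = v x := by
        intro x hx
        by_cases hxf : x ∈ t.frontier
        · have hux : u x = g x := List.map_inj_left.1 (huc.trans hgc.symm) x hxf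
          have hno : ¬ ∃ z, new (u x) z := by
            rintro ⟨z, hz⟩
            refine (hnew _ _ hz).2 ?_
            obtain ⟨a, ha, hxa⟩ := (hwf t ht).2.2.2.1 x hxf
            exact ⟨_, hg a ha, by rw [hux]; exact List.mem_map_of_mem hxa⟩
          rw [dif_neg hno, hv2 x hxf, hux]
        · have hex : ∃ z, new (u x) z := ⟨x, hx, hxf, rfl⟩
          rw [dif_pos hex]
          obtain ⟨h1, h2, h3⟩ := hex.choose_spec
          rw [hu2 _ _ h1 hx h2 hxf h3]
      refine ⟨fun y => if h' : ∃ x, new y x then v h'.choose else h y, ?_, ?_, ?_⟩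
      · intro φ hφ
        have hφ' : (⟨φ.1, φ.2⟩ : Fct) ∈ f (n + 1) := hφ
        rw [hu] at hφ'
        rcases hφ' with hφ' | ⟨a, ha, he⟩
        · rw [mapA_congr (g := h)]
          · exact hh φ hφ'
          · intro y hy
            rw [dif_neg]
            rintro ⟨x, hx⟩
            exact (hnew _ _ hx).2 ⟨_, hφ', hy⟩
        · have h3 := hv1 a ha
          have h4 : φ = (a.rel, a.args.map u) := by
            simp only [Atom.inst, Fct.mk.injEq] at he
            exact Prod.ext he.1 he.2
          rw [h4]
          convert h3 using 1
          simp only [mapA, Atom.at, List.map_map, Prod.mk.injEq, true_and]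
          exact List.map_congr_left fun x hx => hval x ⟨a, ha, hx⟩
      · intro k
        dsimp only
        rw [dif_neg]
        rintro ⟨x, hx⟩
        exact (hnew _ _ hx).1 trivial
      · intro y hy
        dsimp only
        rw [dif_neg]
        rintro ⟨x, hx⟩
        exact (hnew _ _ hx).2 hy
    · exact ⟨h, by simpa only [Good, hs] using hh, fun _ => rfl, fun _ _ => rfl⟩
  have hbase : Good 0 h0 := by
    simpa only [Good, hf.1] using hD
  choose! nxt hn1 hn2 hn3 using step
  let H : ℕ → Term → X := fun n => Nat.rec h0 (fun n h => nxt n h) n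
  have hG : ∀ n, Good n (H n) := fun n => by
    induction n with
    | zero => exact hbase
    | succ n ih => exact hn1 n _ ih
  have hC : ∀ n k, H n (Term.const k) = h0 (Term.const k) := fun n k => by
    induction n with
    | zero => rfl
    | succ n ih => exact (hn2 n _ (hG n) k).trans ih
  have hA : ∀ n m, n ≤ m → ∀ t ∈ adom (f n), H m t = H n t := by
    intro n m hnm
    induction m, hnm using Nat.le_induction with
    | base => exact fun _ _ => rfl
    | succ m hnm ih =>
      intro t ht
      exact (hn3 m _ (hG m) t (adom_mono (hm hnm) ht)).trans (ih t ht)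
  refine ⟨fun t => if h : ∃ n, t ∈ adom (f n) then H (Nat.find h) t else h0 t, fun k => ?_, ?_⟩
  · dsimp only
    split
    · exact hC _ k
    · rfl
  · intro φ hφ
    have hφ' : (⟨φ.1, φ.2⟩ : Fct) ∈ chase T I := hφ
    rw [hch] at hφ'
    obtain ⟨n, hn⟩ := Set.mem_iUnion.1 hφ'
    rw [mapA_congr (g := H n)]
    · exact hG n φ hn
    · intro t ht
      have hex : ∃ n, t ∈ adom (f n) := ⟨n, _, hn, ht⟩
      rw [dif_pos hex]
      exact (hA _ _ (Nat.find_min' hex ⟨_, hn, ht⟩) t (Nat.find_spec hex)).symm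

/-- Facts of the chase are well-formed, use only known symbols and constants. -/
theorem chase_fact {T : List TGD} {I : Inst} (hI : I.Finite) (hwf : ∀ t ∈ T, t.wf)
    (hIw : ∀ f ∈ I, f.wf) : ∀ f ∈ chase T I, f.wf ∧
      ((∃ f' ∈ I, f'.rel = f.rel) ∨ ∃ t ∈ T, ∃ a ∈ t.head, a.rel = f.rel) ∧
      ∀ n, Term.const n ∈ f.args → Term.const n ∈ adom I := by
  obtain ⟨f, hf, -, hch⟩ := chase_spec T hI
  rw [hch]
  intro φ hφ
  obtain ⟨n, hn⟩ := Set.mem_iUnion.1 hφ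
  clear hφ
  induction n generalizing φ with
  | zero =>
    rw [hf.1] at hn
    exact ⟨hIw _ hn, Or.inl ⟨φ, hn, rfl⟩, fun n hn' => ⟨φ, hn, hn'⟩⟩
  | succ n ih =>
    rcases hf.2 n with ⟨t, ht, c, ⟨⟨g, hg, hgc⟩, -⟩, u, huc, hu1, hu2, hu⟩ | ⟨-, hs⟩
    · rw [hu] at hn
      rcases hn with hn | ⟨a, ha, rfl⟩
      · exact ih φ hn
      · refine ⟨?_, Or.inr ⟨t, ht, a, ha, rfl⟩, fun k hk => ?_⟩
        · have := (hwf t ht).2.1 a ha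
          exact ⟨by simpa [Atom.inst] using this.1, this.2⟩
        · obtain ⟨x, hx, hxk⟩ := List.mem_map.1 hk
          by_cases hxf : x ∈ t.frontier
          · obtain ⟨b, hb, hxb⟩ := (hwf t ht).2.2.2.1 x hxf
            refine (ih _ (hg b hb)).2.2 k ?_
            rw [← hxk, List.map_inj_left.1 (huc.trans hgc.symm) x hxf]
            exact List.mem_map_of_mem hxb
          · have := (hu1 x ⟨a, ha, hx⟩ hxf).1
            rw [hxk] at this
            exact (this trivial).elim
    · rw [hs] at hn
      exact ih φ hn

end Chase

section

variable {ρ X Y S : Type}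

/-! ### Unfoldings of coalgebras of patterns -/

/-- States carrying a pattern and one successor state for each variable. -/
structure Coalg (ρ S : Type) where
  bag : S → Pat ρ
  ch : S → ℕ → S

/-- The element `x` of the subtree at variable `b`; the root of subtree `0` is the root. -/
def sh (b : ℕ) (x : List ℕ) : List ℕ := if b = 0 ∧ x = [] then [] else b :: x

theorem sh_zero_nil : sh 0 [] = [] := by simp [sh]

theorem headI_sh (b : ℕ) (x : List ℕ) : (sh b x).headI = b := by
  unfold sh
  split
  · rename_i h
    simp [h.1]
  · rfl

theorem sh_injective (b : ℕ) : Function.Injective (sh b) := by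
  intro x y h
  unfold sh at h
  split at h <;> split at h <;> simp_all

theorem sh_eq_sh {b c : ℕ} {x y : List ℕ} (h : sh b x = sh c y) : b = c ∧ x = y := by
  have hb : b = c := by rw [← headI_sh b x, h, headI_sh]
  subst hb
  exact ⟨rfl, sh_injective _ h⟩

/-- The element denoted by a path. -/
def norm (x : List ℕ) : List ℕ := x.foldr sh []

theorem norm_cons (b : ℕ) (x : List ℕ) : norm (b :: x) = sh b (norm x) := rfl

namespace Coalg

variable (K : Coalg ρ S) (w : ℕ)

/-- The facts of the unfolding down to depth `n`. -/
def UnfN : ℕ → S → Str ρ (List ℕ)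
  | 0, _ => ∅
  | n + 1, s => {φ | (∃ a ∈ K.bag s, mapA (fun i => sh i []) a = φ) ∨
      ∃ b < w, ∃ ψ ∈ UnfN n (K.ch s b), mapA (sh b) ψ = φ}

def Unf (s : S) : Str ρ (List ℕ) := {φ | ∃ n, φ ∈ K.UnfN w n s}

def sub (s : S) (x : List ℕ) : S := x.foldl K.ch s

variable {K w}

theorem UnfN_mono {n m : ℕ} (h : n ≤ m) (s : S) : K.UnfN w n s ⊆ K.UnfN w m s := by
  induction n generalizing m s with
  | zero => exact Set.empty_subset _
  | succ n ih =>
    obtain ⟨m, rfl⟩ : ∃ k, m = k + 1 := ⟨m - 1, by omega⟩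
    rintro φ (h' | ⟨b, hb, ψ, hψ, rfl⟩)
    · exact Or.inl h'
    · exact Or.inr ⟨b, hb, ψ, ih (by omega) _ hψ, rfl⟩

theorem mem_Unf {s : S} {φ : ρ × List (List ℕ)} : φ ∈ K.Unf w s ↔
    (∃ a ∈ K.bag s, mapA (fun i => sh i []) a = φ) ∨
      ∃ b < w, ∃ ψ ∈ K.Unf w (K.ch s b), mapA (sh b) ψ = φ := by
  constructor
  · rintro ⟨_ | n, hn⟩
    · exact hn.elim
    · rcases hn with h | ⟨b, hb, ψ, hψ, h⟩
      · exact Or.inl h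
      · exact Or.inr ⟨b, hb, ψ, ⟨n, hψ⟩, h⟩
  · rintro (h | ⟨b, hb, ψ, ⟨n, hψ⟩, h⟩)
    · exact ⟨1, Or.inl h⟩
    · exact ⟨n + 1, Or.inr ⟨b, hb, ψ, hψ, h⟩⟩

theorem bag_mem_Unf {s : S} {a : At ρ} (h : a ∈ K.bag s) :
    mapA (fun i => sh i []) a ∈ K.Unf w s := mem_Unf.2 (Or.inl ⟨a, h, rfl⟩)

theorem ch_mem_Unf {s : S} {b : ℕ} (hb : b < w) {ψ} (h : ψ ∈ K.Unf w (K.ch s b)) :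
    mapA (sh b) ψ ∈ K.Unf w s := mem_Unf.2 (Or.inr ⟨b, hb, ψ, h, rfl⟩)

theorem exists_UnfN {s : S} (l : List (ρ × List (List ℕ))) (h : ∀ φ ∈ l, φ ∈ K.Unf w s) :
    ∃ n, ∀ φ ∈ l, φ ∈ K.UnfN w n s := by
  induction l with
  | nil => exact ⟨0, by simp⟩
  | cons a l ih =>
    obtain ⟨i, hi⟩ := h a (by simp)
    obtain ⟨j, hj⟩ := ih fun b hb => h b (by simp [hb])
    refine ⟨max i j, fun b hb => ?_⟩
    rcases List.mem_cons.1 hb with rfl | hb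
    · exact UnfN_mono (le_max_left i j) _ hi
    · exact UnfN_mono (le_max_right i j) _ (hj b hb)

theorem Tr_Unf {s : S} {p : Pat ρ} {e : List ℕ} (h : Tr (K.Unf w s) p e) :
    ∃ n, Tr (K.UnfN w n s) p e := by
  obtain ⟨f, h0, hf⟩ := h
  obtain ⟨n, hn⟩ := exists_UnfN (K := K) (w := w) (s := s) (p.map (mapA f))
    (fun φ hφ => by obtain ⟨a, ha, rfl⟩ := List.mem_map.1 hφ; exact hf a ha)
  exact ⟨n, f, h0, fun a ha => hn _ (List.mem_map_of_mem ha)⟩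

theorem mem_args (Inv : S → Prop) (hI : ∀ s, Inv s → ∀ b < w, Inv (K.ch s b))
    (hw : ∀ s, Inv s → ∀ a ∈ K.bag s, ∀ i ∈ a.2, i < w) {s : S} (hs : Inv s) {φ}
    (hφ : φ ∈ K.Unf w s) : ∀ y ∈ φ.2, ∃ x : List ℕ, (∀ i ∈ x, i < w) ∧ norm x = y := by
  obtain ⟨n, hn⟩ := hφ
  induction n generalizing s φ with
  | zero => exact hn.elim
  | succ n ih =>
    intro y hy
    rcases hn with ⟨a, ha, rfl⟩ | ⟨b, hb, ψ, hψ, rfl⟩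
    · obtain ⟨i, hi, rfl⟩ := mem_mapA.1 hy
      exact ⟨[i], by simpa using hw s hs a ha i hi, rfl⟩
    · obtain ⟨z, hz, rfl⟩ := mem_mapA.1 hy
      obtain ⟨x, hx, rfl⟩ := ih (hI s hs b hb) hψ z hz
      exact ⟨b :: x, by simpa using ⟨hb, hx⟩, rfl⟩

/-- Maps out of an unfolding are built along an invariant. -/
theorem exists_map {M : Str ρ X} (Inv : S → X → Prop)
    (step : ∀ s e, Inv s e → ∃ f : ℕ → X, f 0 = e ∧ (∀ a ∈ K.bag s, mapA f a ∈ M) ∧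
      ∀ b < w, Inv (K.ch s b) (f b)) {s : S} {e : X} (h : Inv s e) :
    ∃ G : List ℕ → X, G [] = e ∧ (∀ φ ∈ K.Unf w s, mapA G φ ∈ M) ∧
      ∀ x : List ℕ, (∀ i ∈ x, i < w) → Inv (K.sub s x) (G (norm x)) := by
  have step' : ∀ s e, ∃ f : ℕ → X, f 0 = e ∧ (Inv s e → (∀ a ∈ K.bag s, mapA f a ∈ M) ∧
      ∀ b < w, Inv (K.ch s b) (f b)) := fun s e => by
    by_cases hs : Inv s e
    · obtain ⟨f, h0, hf⟩ := step s e hs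
      exact ⟨f, h0, fun _ => hf⟩
    · exact ⟨fun _ => e, rfl, fun h => (hs h).elim⟩
  choose f hf0 hf using step'
  let G : List ℕ → S → X → X := fun x => List.rec (fun _ e => e)
    (fun b _ ih s e => ih (K.ch s b) (f s e b)) x
  have Gnil : ∀ s e, G [] s e = e := fun _ _ => rfl
  have Gcons : ∀ b x s e, G (b :: x) s e = G x (K.ch s b) (f s e b) := fun _ _ _ _ => rfl
  have Gsh : ∀ b x s e, G (sh b x) s e = G x (K.ch s b) (f s e b) := fun b x s e => by
    unfold sh
    split
    · rename_i h
      rw [h.1, h.2, Gnil s e, Gnil (K.ch s 0), hf0]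
    · rfl
  refine ⟨fun x => G x s e, Gnil s e, ?_, ?_⟩
  · rintro φ ⟨n, hn⟩
    induction n generalizing s e φ with
    | zero => exact hn.elim
    | succ n ih =>
      rcases hn with ⟨a, ha, rfl⟩ | ⟨b, hb, ψ, hψ, rfl⟩
      · rw [mapA_mapA, mapA_congr (g := f s e) fun i _ => (Gsh i [] s e).trans (Gnil (K.ch s i) _)]
        exact (hf s e h).1 a ha
      · rw [mapA_mapA, mapA_congr (g := fun x => G x (K.ch s b) (f s e b)) fun i _ => Gsh _ _ _ _]
        exact ih ((hf s e h).2 b hb) ψ hψ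
  · intro x hx
    induction x generalizing s e with
    | nil => exact h
    | cons b x ih =>
      rw [norm_cons]
      dsimp only
      rw [Gsh]
      exact ih ((hf s e h).2 b (hx b (by simp))) fun i hi => hx i (by simp [hi])

end Coalg

end

section

variable {X : Type}

/-! ### Types and type systems -/

abbrev Pt := Pat RelSym

/-- A type: a set of patterns. -/
abbrev Ty := List Pt

/-- `M` satisfies the implications `Ts` between patterns. -/
def Mod (Ts : List (Pt × Pt)) (M : Str RelSym X) : Prop :=
  ∀ t ∈ Ts, ∀ e, Tr M t.1 e → Tr M t.2 e

/-- All types over the universe `U` of atoms. -/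
def tys (U : Pt) : List Ty := U.sublists.sublists

/-- Type of the element `b` of a pattern `p` placed at an element of type `σ`. -/
def nx (c : Ty → Ty) (ℓ : Ty → Pt → ℕ → Ty) (σ : Ty) (p : Pt) (b : ℕ) : Ty :=
  if b = 0 then c σ else ℓ σ p b

/-- A consequence operator `c` on types, and a bound `ℓ` for the types of pattern elements. -/
structure Sys (w : ℕ) (U : Pt) (Ts : List (Pt × Pt)) (c : Ty → Ty) (ℓ : Ty → Pt → ℕ → Ty) :
    Prop where
  c_mem : ∀ σ, c σ ∈ tys U
  ℓ_mem : ∀ σ p b, ℓ σ p b ∈ tys U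
  nil : ∀ σ ∈ tys U, [] ∈ c σ
  sub : ∀ σ ∈ tys U, ∀ q ∈ σ, q ∈ c σ
  mod : ∀ σ ∈ tys U, ∀ t ∈ Ts, t.1 ∈ c σ → t.2 ∈ c σ
  c_comb : ∀ σ ∈ tys U, ∀ p ∈ c σ, ∀ q ∈ U.sublists,
    comb w p (fun b P => P ∈ nx c ℓ σ p b) 0 q → q ∈ c σ
  ℓ_comb : ∀ σ ∈ tys U, ∀ p ∈ c σ, ∀ q ∈ U.sublists, ∀ b < w, b ≠ 0 →
    comb w p (fun b P => P ∈ nx c ℓ σ p b) b q → q ∈ ℓ σ p b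
  c_cl : ∀ σ ∈ tys U, ∀ τ ∈ tys U, (∀ q ∈ τ, q ∈ c σ) → ∀ q ∈ c τ, q ∈ c σ
  ℓ_cl : ∀ σ ∈ tys U, ∀ p ∈ c σ, ∀ b < w, b ≠ 0 → ∀ τ ∈ tys U, (∀ q ∈ τ, q ∈ ℓ σ p b) →
    ∀ q ∈ c τ, q ∈ ℓ σ p b
  c_sound : ∀ (X : Type) (M : Str RelSym X), Mod Ts M → ∀ σ ∈ tys U, ∀ e,
    (∀ q ∈ σ, Tr M q e) → ∀ q ∈ c σ, Tr M q e
  ℓ_sound : ∀ (X : Type) (M : Str RelSym X), Mod Ts M → ∀ σ ∈ tys U, ∀ p ∈ c σ, ∀ f : ℕ → X,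
    (∀ q ∈ σ, Tr M q (f 0)) → (∀ a ∈ p, mapA f a ∈ M) → ∀ b < w, b ≠ 0 →
    ∀ q ∈ ℓ σ p b, Tr M q (f b)

theorem mem_tys {U : Pt} {σ : Ty} (h : σ ∈ tys U) {q : Pt} (hq : q ∈ σ) : q ∈ U.sublists :=
  (List.mem_sublists.1 h).subset hq

theorem mem_pats {U p : Pt} (h : p ∈ U.sublists) {a : At RelSym} (ha : a ∈ p) : a ∈ U :=
  (List.mem_sublists.1 h).subset ha

/-! ### Trees -/

/-- Nodes of trees: `st σ ps` is a node at an element of type `σ` with pending patterns `ps`;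
`dn B ch` is a database node with bag `B`. -/
inductive Nd : Type
  | st (σ : Ty) (ps : List Pt) : Nd
  | dn (B : Pt) (ch : ℕ → Nd) : Nd

namespace Nd

def bag : Nd → Pt
  | st _ [] => []
  | st _ (p :: _) => p
  | dn B _ => B

def chd (ℓ : Ty → Pt → ℕ → Ty) : Nd → ℕ → Nd
  | st σ [], _ => st σ []
  | st σ (p :: ps), b => if b = 0 then st σ ps else st (ℓ σ p b) (ℓ σ p b)
  | dn _ ch, b => ch b

def lam : Nd → Ty
  | st σ _ => σ
  | dn _ ch => (ch 0).lam

def coalg (ℓ : Ty → Pt → ℕ → Ty) : Coalg RelSym Nd := ⟨bag, chd ℓ⟩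

def Good (w : ℕ) (U : Pt) (c : Ty → Ty) : Nd → Prop
  | st σ ps => σ ∈ tys U ∧ (∀ q ∈ c σ, q ∈ σ) ∧ ∀ p ∈ ps, p ∈ σ
  | dn B ch => B ∈ U.sublists ∧ (∀ b, Good w U c (ch b)) ∧ ∀ b < w, ∀ q ∈ U.sublists,
      comb w B (fun b P => P ∈ (ch b).lam) b q → q ∈ (ch b).lam

/-- All patterns are pending at the leaves of the database part. -/
def Full : Nd → Prop
  | st σ ps => ps = σ
  | dn _ ch => ∀ b, Full (ch b)

def IsLeaf : Nd → Prop
  | st _ ps => ps = []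
  | dn _ _ => False

end Nd

section Trees

variable {w : ℕ} {U : Pt} {Ts : List (Pt × Pt)} {c : Ty → Ty} {ℓ : Ty → Pt → ℕ → Ty}

theorem UnfN_leaf {t : Nd} (ht : t.IsLeaf) (n : ℕ) : (Nd.coalg ℓ).UnfN w n t = ∅ := by
  induction n with
  | zero => rfl
  | succ n ih =>
    rcases t with ⟨σ, ps⟩ | ⟨B, ch⟩
    · have : ps = [] := ht
      subst this
      ext φ
      constructor
      · rintro (⟨a, ha, -⟩ | ⟨b, -, ψ, hψ, -⟩)
        · cases ha
        · have h2 : (Nd.coalg ℓ).UnfN w n ((Nd.coalg ℓ).ch (Nd.st σ []) b) = ∅ := ih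
          rw [h2] at hψ
          exact hψ.elim
      · exact fun h => h.elim
    · exact ht.elim

theorem Unf_leaf {t : Nd} (ht : t.IsLeaf) : (Nd.coalg ℓ).Unf w t = ∅ := by
  ext φ
  constructor
  · rintro ⟨n, hn⟩
    rw [UnfN_leaf ht] at hn
    exact hn
  · exact fun h => h.elim

variable (hS : Sys w U Ts c ℓ)
include hS

theorem good_lam {t : Nd} (ht : t.Good w U c) : t.lam ∈ tys U ∧ ∀ q ∈ c t.lam, q ∈ t.lam := by
  induction t with
  | st σ ps => exact ⟨ht.1, ht.2.1⟩
  | dn B ch ih => exact ih 0 (ht.2.1 0)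

theorem good_chd {t : Nd} (ht : t.Good w U c) {b : ℕ} (hb : b < w) :
    (t.chd ℓ b).Good w U c := by
  rcases t with ⟨σ, _ | ⟨p, ps⟩⟩ | ⟨B, ch⟩
  · exact ht
  · by_cases h0 : b = 0
    · simp only [Nd.chd, h0, if_true]
      exact ⟨ht.1, ht.2.1, fun q hq => ht.2.2 q (by simp [hq])⟩
    · simp only [Nd.chd, h0, if_false]
      exact ⟨hS.ℓ_mem _ _ _, fun q hq => hS.ℓ_cl σ ht.1 p (hS.sub _ ht.1 _ (ht.2.2 p (by simp)))
        b hb h0 _ (hS.ℓ_mem _ _ _) (fun _ h => h) q hq, fun _ h => h⟩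
  · exact ht.2.1 b

theorem good_bag {t : Nd} (ht : t.Good w U c) : t.bag ∈ U.sublists := by
  rcases t with ⟨σ, _ | ⟨p, ps⟩⟩ | ⟨B, ch⟩
  · exact List.mem_sublists.2 (List.nil_sublist _)
  · exact mem_tys ht.1 (ht.2.2 p (by simp))
  · exact ht.1

theorem good_sub {t : Nd} (ht : t.Good w U c) (x : List ℕ) (hx : ∀ i ∈ x, i < w) :
    ((Nd.coalg ℓ).sub t x).Good w U c := by
  induction x generalizing t with
  | nil => exact ht
  | cons b x ih => exact ih (good_chd hS ht (hx b (by simp))) fun i hi => hx i (by simp [hi])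

omit hS in
theorem lam_chd_zero (t : Nd) : (t.chd ℓ 0).lam = t.lam := by
  rcases t with ⟨σ, _ | ⟨p, ps⟩⟩ | ⟨B, ch⟩ <;> simp [Nd.chd, Nd.lam]

theorem good_comb {t : Nd} (ht : t.Good w U c) (hl : ¬ t.IsLeaf) {b : ℕ} (hb : b < w) {q : Pt}
    (hq : q ∈ U.sublists) (h : comb w t.bag (fun b P => P ∈ (t.chd ℓ b).lam) b q) :
    q ∈ (t.chd ℓ b).lam := by
  rcases t with ⟨σ, _ | ⟨p, ps⟩⟩ | ⟨B, ch⟩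
  · exact (hl rfl).elim
  · have hp := hS.sub _ ht.1 _ (ht.2.2 p (by simp))
    have h' : comb w p (fun b P => P ∈ nx c ℓ σ p b) b q := by
      refine comb_mono (fun _ h => h) (fun b' hb' P hP => ?_) h
      by_cases h0 : b' = 0
      · simp only [Nd.chd, h0, if_true, Nd.lam] at hP
        simpa only [nx, h0, if_true] using hS.sub _ ht.1 _ hP
      · simpa only [Nd.chd, h0, if_false, Nd.lam, nx] using hP
    by_cases h0 : b = 0
    · subst h0
      simp only [Nd.chd, if_true, Nd.lam]
      exact ht.2.1 _ (hS.c_comb σ ht.1 p hp q hq h')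
    · simp only [Nd.chd, h0, if_false, Nd.lam]
      exact hS.ℓ_comb σ ht.1 p hp q hq b hb h0 h'
  · exact ht.2.2 b hb q hq h

theorem good_nil {t : Nd} (ht : t.Good w U c) : [] ∈ t.lam :=
  (good_lam hS ht).2 _ (hS.nil _ (good_lam hS ht).1)

variable (hU : Uni w U)
include hU

theorem good_bag_lt {t : Nd} (ht : t.Good w U c) : ∀ a ∈ t.bag, ∀ i ∈ a.2, i < w :=
  fun a ha => hU.lt a (mem_pats (good_bag hS ht) ha)

/-- Patterns true at the root of a tree belong to its type. -/
theorem lam_of_tr {t : Nd} (ht : t.Good w U c) {q : Pt} (hq : q ∈ U.sublists)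
    (h : Tr ((Nd.coalg ℓ).Unf w t) q []) : q ∈ t.lam := by
  obtain ⟨n, hn⟩ := Coalg.Tr_Unf h
  clear h
  induction n generalizing t q with
  | zero =>
    have : q = [] := by
      rcases q with _ | ⟨a, q⟩
      · rfl
      · obtain ⟨f, -, hf⟩ := hn
        exact (hf a (by simp)).elim
    subst this
    exact good_nil hS ht
  | succ n ih =>
    by_cases hl : t.IsLeaf
    · rw [UnfN_leaf hl] at hn
      have : q = [] := by
        rcases q with _ | ⟨a, q⟩
        · rfl
        · obtain ⟨f, -, hf⟩ := hn
          exact (hf a (by simp)).elim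
      subst this
      exact good_nil hS ht
    · have hlo : ∀ b x, b < w → (if (sh b x).headI < w then (sh b x).headI else 0) = b :=
        fun b x hb => by simp [headI_sh, hb]
      have := comb_complete hU (N := (Nd.coalg ℓ).UnfN w (n + 1) t) (B := t.bag)
        (Nb := fun b => img (sh b) ((Nd.coalg ℓ).UnfN w n (t.chd ℓ b)))
        (fun x => if x.headI < w then x.headI else 0) (fun b => sh b [])
        (fun x => by split <;> [assumption; exact hU.pos]) ?_ (b0 := 0) (hlo 0 [] hU.pos) (q := q)
        (fun a ha => mem_pats hq ha) (by rwa [sh_zero_nil])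
      · have h2 := good_comb hS ht hl hU.pos hq (comb_mono (fun _ h => h) (fun b hb P hP =>
          ih (good_chd hS ht hb) hP.1 (hP.2.2.of_img (sh_injective b))) this)
        rwa [lam_chd_zero] at h2
      · rintro φ (⟨a, ha, rfl⟩ | ⟨b, hb, ψ, hψ, rfl⟩)
        · have hlt := good_bag_lt hS hU ht a ha
          refine Or.inl ⟨fun x hx => ?_, ?_⟩
          · obtain ⟨i, hi, rfl⟩ := mem_mapA.1 hx
            simp only [hlo i [] (hlt i hi)]
          · rw [mapA_mapA, mapA_eq_self fun i hi => hlo i [] (hlt i hi)]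
            exact ha
        · refine Or.inr ⟨b, hb, fun x hx => ?_, ψ, hψ, rfl⟩
          obtain ⟨i, hi, rfl⟩ := mem_mapA.1 hx
          exact hlo b i hb

/-- An element of an unfolding. -/
def Occ (M : Str RelSym X) (x : X) : Prop := ∃ φ ∈ M, x ∈ φ.2

omit hU in
theorem occ_chd {t : Nd} {b : ℕ} {x : List ℕ} (h : sh b x = [] ∨
    Occ ((Nd.coalg ℓ).Unf w t) (sh b x)) : x = [] ∨ Occ ((Nd.coalg ℓ).Unf w (t.chd ℓ b)) x := by
  by_cases hx : x = []
  · exact Or.inl hx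
  · rcases h with h | ⟨φ, hφ, hy⟩
    · unfold sh at h
      split at h <;> simp_all
    · rcases Coalg.mem_Unf.1 hφ with ⟨a, ha, rfl⟩ | ⟨b', hb', ψ, hψ, rfl⟩
      · obtain ⟨i, hi, h⟩ := mem_mapA.1 hy
        exact (hx (sh_eq_sh h).2.symm).elim
      · obtain ⟨i, hi, h⟩ := mem_mapA.1 hy
        obtain ⟨rfl, rfl⟩ := sh_eq_sh h
        exact Or.inr ⟨ψ, hψ, hi⟩

omit hS hU in
theorem sub_leaf {t : Nd} (ht : t.IsLeaf) (x : List ℕ) : (Nd.coalg ℓ).sub t x = t := by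
  rcases t with ⟨σ, ps⟩ | ⟨B, ch⟩
  · have : ps = [] := ht
    subst this
    induction x with
    | nil => rfl
    | cons b x ih => exact ih
  · exact ht.elim

omit hS hU in
theorem norm_of_leaf {t : Nd} (ht : t.IsLeaf) {x : List ℕ}
    (h : x = [] ∨ Occ ((Nd.coalg ℓ).Unf w t) x) : x = [] := by
  rcases h with h | ⟨φ, hφ, -⟩
  · exact h
  · rw [Unf_leaf ht] at hφ
    exact hφ.elim

/-- Types of elements of a tree embedded into a structure which only meets its root. -/
theorem lam_sub_of_tr {J : Str RelSym X} {t : Nd} (ht : t.Good w U c) {ι : List ℕ → X}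
    (hι : Function.Injective ι)
    (hJ : ∀ φ ∈ J, φ ∈ img ι ((Nd.coalg ℓ).Unf w t) ∨ ∀ x, x ≠ [] → ι x ∉ φ.2)
    (h0 : ∀ q ∈ U.sublists, Tr J q (ι []) → q ∈ t.lam) (x : List ℕ) (hx : ∀ i ∈ x, i < w)
    (ho : norm x = [] ∨ Occ ((Nd.coalg ℓ).Unf w t) (norm x)) :
    ∀ q ∈ U.sublists, Tr J q (ι (norm x)) → q ∈ ((Nd.coalg ℓ).sub t x).lam := by
  classical
  induction x generalizing t ι with
  | nil => exact h0
  | cons b x ih =>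
    by_cases hl : t.IsLeaf
    · rw [norm_of_leaf hl ho, sub_leaf hl]
      exact h0
    have hbw : b < w := hx b (by simp)
    refine ih (t := t.chd ℓ b) (ι := fun x => ι (sh b x)) (good_chd hS ht hbw)
      (hι.comp (sh_injective b)) ?_ ?_ (fun i hi => hx i (by simp [hi])) (occ_chd hS ho)
    · intro φ hφ
      rcases hJ φ hφ with ⟨ψ, hψ, rfl⟩ | h
      · rcases Coalg.mem_Unf.1 hψ with ⟨a, ha, rfl⟩ | ⟨b', hb', χ, hχ, rfl⟩
        · refine Or.inr fun x hx hmem => ?_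
          rw [mapA_mapA] at hmem
          obtain ⟨i, hi, h⟩ := mem_mapA.1 hmem
          exact hx (sh_eq_sh (hι h)).2.symm
        · by_cases hbb : b' = b
          · subst hbb
            exact Or.inl ⟨χ, hχ, by rw [mapA_mapA]⟩
          · refine Or.inr fun x hx hmem => ?_
            rw [mapA_mapA] at hmem
            obtain ⟨i, hi, h⟩ := mem_mapA.1 hmem
            exact hbb (sh_eq_sh (hι h)).1
      · refine Or.inr fun x hx => h _ fun hs => ?_
        unfold sh at hs
        split at hs <;> simp_all
    · intro q hq hT
      set lo : X → ℕ := fun y => if h : ∃ x, ι x = y ∧ x.headI < w then h.choose.headI else 0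
        with hlo
      have hlo1 : ∀ b x, b < w → lo (ι (sh b x)) = b := fun b x hb => by
        have hex : ∃ z, ι z = ι (sh b x) ∧ z.headI < w := ⟨_, rfl, by rwa [headI_sh]⟩
        simp only [hlo, dif_pos hex, hι hex.choose_spec.1, headI_sh]
      refine good_comb hS ht hl hbw hq (comb_mono (fun _ h => h) ?_ (comb_complete hU (N := J)
        (B := t.bag) (Nb := fun b => if b = 0 then J else
          img (fun x => ι (sh b x)) ((Nd.coalg ℓ).Unf w (t.chd ℓ b)))
        lo (fun b => ι (sh b [])) ?_ ?_ (b0 := b) (hlo1 b [] hbw) (fun a ha => mem_pats hq ha) hT))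
      · rintro b' hb' P ⟨hP1, -, hP2⟩
        by_cases h0' : b' = 0
        · subst h0'
          rw [lam_chd_zero]
          simp only [if_true, sh_zero_nil] at hP2
          exact h0 P hP1 hP2
        · simp only [if_neg h0'] at hP2
          exact lam_of_tr hS hU (good_chd hS ht hb') hP1
            (hP2.of_img (hι.comp (sh_injective b')))
      · intro y
        simp only [hlo]
        split
        · rename_i h
          exact h.choose_spec.2
        · exact hU.pos
      · intro φ hφ
        rcases hJ φ hφ with ⟨ψ, hψ, rfl⟩ | h
        · rcases Coalg.mem_Unf.1 hψ with ⟨a, ha, rfl⟩ | ⟨b', hb', χ, hχ, rfl⟩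
          · have hlt := good_bag_lt hS hU ht a ha
            refine Or.inl ⟨fun y hy => ?_, ?_⟩
            · rw [mapA_mapA] at hy
              obtain ⟨i, hi, rfl⟩ := mem_mapA.1 hy
              rw [hlo1 i [] (hlt i hi)]
            · rw [mapA_mapA, mapA_mapA, mapA_eq_self fun i hi => hlo1 i [] (hlt i hi)]
              exact ha
          · refine Or.inr ⟨b', hb', fun y hy => ?_, ?_⟩
            · rw [mapA_mapA] at hy
              obtain ⟨i, hi, rfl⟩ := mem_mapA.1 hy
              exact hlo1 b' i hb'
            · split
              · exact hφ
              · exact ⟨χ, hχ, by rw [mapA_mapA]⟩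
        · refine Or.inr ⟨0, hU.pos, fun y hy => ?_, by simpa using hφ⟩
          simp only [hlo]
          split
          · rename_i hex
            by_cases hnil : hex.choose = []
            · rw [hnil]
              rfl
            · exact (h _ hnil (by rwa [hex.choose_spec.1])).elim
          · rfl

omit hS in
theorem tr_of_pending {σ : Ty} {ps : List Pt} {p : Pt} (hp : p ∈ ps) :
    Tr ((Nd.coalg ℓ).Unf w (Nd.st σ ps)) p [] := by
  induction ps with
  | nil => cases hp
  | cons p' ps ih =>
    rcases List.mem_cons.1 hp with rfl | hp
    · exact ⟨fun i => sh i [], sh_zero_nil, fun a ha =>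
        Coalg.bag_mem_Unf (K := Nd.coalg ℓ) (s := Nd.st σ (p :: ps)) ha⟩
    · have := (ih hp).map (h := sh 0) (N := (Nd.coalg ℓ).Unf w (Nd.st σ (p' :: ps)))
        fun φ hφ => Coalg.ch_mem_Unf (K := Nd.coalg ℓ) hU.pos (by simpa [Nd.coalg, Nd.chd] using hφ)
      rwa [sh_zero_nil] at this

omit hS in
theorem tr_of_lam {t : Nd} (hf : t.Full) {p : Pt} (hp : p ∈ t.lam) :
    Tr ((Nd.coalg ℓ).Unf w t) p [] := by
  induction t with
  | st σ ps =>
    have : ps = σ := hf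
    subst this
    exact tr_of_pending hU hp
  | dn B ch ih =>
    have := (ih 0 (hf 0) hp).map (h := sh 0) (N := (Nd.coalg ℓ).Unf w (Nd.dn B ch))
        fun φ hφ => Coalg.ch_mem_Unf (K := Nd.coalg ℓ) hU.pos hφ
    rwa [sh_zero_nil] at this

omit hS in
theorem full_chd {t : Nd} (hl : ¬ t.IsLeaf) (hf : (∃ σ ps, t = Nd.st σ ps) ∨ t.Full) {b : ℕ} :
    (t.chd ℓ b).Full ∨ b = 0 := by
  rcases t with ⟨σ, _ | ⟨p, ps⟩⟩ | ⟨B, ch⟩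
  · exact (hl rfl).elim
  · by_cases h0 : b = 0
    · exact Or.inr h0
    · simp [Nd.chd, h0, Nd.Full]
  · rcases hf with ⟨σ, ps, h⟩ | hf
    · cases h
    · exact Or.inl (hf b)

omit hS in
theorem tr_of_lam_sub {J : Str RelSym X} {t : Nd} (hf : (∃ σ ps, t = Nd.st σ ps) ∨ t.Full)
    {ι : List ℕ → X} (hJ : ∀ φ ∈ (Nd.coalg ℓ).Unf w t, mapA ι φ ∈ J)
    (h0 : ∀ p ∈ t.lam, Tr J p (ι [])) (x : List ℕ) (hx : ∀ i ∈ x, i < w)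
    (ho : norm x = [] ∨ Occ ((Nd.coalg ℓ).Unf w t) (norm x)) :
    ∀ p ∈ ((Nd.coalg ℓ).sub t x).lam, Tr J p (ι (norm x)) := by
  induction x generalizing t ι with
  | nil => exact h0
  | cons b x ih =>
    by_cases hl : t.IsLeaf
    · rw [norm_of_leaf hl ho, sub_leaf hl]
      exact h0
    have hbw : b < w := hx b (by simp)
    have hJ' : ∀ φ ∈ (Nd.coalg ℓ).Unf w (t.chd ℓ b), mapA (fun x => ι (sh b x)) φ ∈ J :=
      fun φ hφ => by
        have := hJ _ (Coalg.ch_mem_Unf (K := Nd.coalg ℓ) hbw hφ)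
        rwa [mapA_mapA] at this
    refine ih (t := t.chd ℓ b) (ι := fun x => ι (sh b x)) ?_ hJ' ?_ (fun i hi => hx i (by simp [hi]))
      ?_
    · rcases t with ⟨σ, _ | ⟨p, ps⟩⟩ | ⟨B, ch⟩
      · exact (hl rfl).elim
      · left
        by_cases h0 : b = 0 <;> simp [Nd.chd, h0]
      · rcases full_chd (ℓ := ℓ) (b := b) hU hl hf with h | h
        · exact Or.inr h
        · rcases hf with ⟨σ, ps, h⟩ | hf
          · cases h
          · exact Or.inr (hf b)
    · rcases full_chd (ℓ := ℓ) (b := b) hU hl hf with h | rfl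
      · exact fun p hp => (tr_of_lam hU h hp).map hJ'
      · rw [lam_chd_zero, sh_zero_nil]
        exact h0
    · by_cases hx0 : norm x = []
      · exact Or.inl hx0
      · rcases ho with h | ⟨φ, hφ, hy⟩
        · rw [norm_cons] at h
          unfold sh at h
          split at h <;> simp_all
        · rw [norm_cons] at hy
          rcases Coalg.mem_Unf.1 hφ with ⟨a, ha, rfl⟩ | ⟨b', hb', ψ, hψ, rfl⟩
          · obtain ⟨i, hi, h⟩ := mem_mapA.1 hy
            exact (hx0 (sh_eq_sh h).2.symm).elim
          · obtain ⟨i, hi, h⟩ := mem_mapA.1 hy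
            obtain ⟨rfl, rfl⟩ := sh_eq_sh h
            exact Or.inr ⟨ψ, hψ, hi⟩

theorem lam_mod (hT : ∀ t ∈ Ts, t.1 ∈ U.sublists ∧ t.2 ∈ U.sublists) {s : Nd} (hs : s.Good w U c) :
    ∀ t ∈ Ts, t.1 ∈ s.lam → t.2 ∈ s.lam := fun t ht h =>
  have hl := good_lam hS hs
  hl.2 _ (hS.mod _ hl.1 t ht (hS.sub _ hl.1 _ h))

omit hS hU in
theorem tr_occ {M : Str RelSym X} {p : Pt} {e : X} (hp : ∃ a ∈ p, 0 ∈ a.2) (h : Tr M p e) :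
    Occ M e := by
  obtain ⟨a, ha, h0⟩ := hp
  obtain ⟨f, rfl, hf⟩ := h
  exact ⟨_, hf a ha, mem_mapA.2 ⟨0, h0, rfl⟩⟩

theorem occ_norm {t : Nd} (ht : t.Good w U c) {y : List ℕ} (h : Occ ((Nd.coalg ℓ).Unf w t) y) :
    ∃ x : List ℕ, (∀ i ∈ x, i < w) ∧ norm x = y := by
  obtain ⟨φ, hφ, hy⟩ := h
  exact Coalg.mem_args (K := Nd.coalg ℓ) (Nd.Good w U c) (fun s hs b hb => good_chd hS hs hb)
    (fun s hs => good_bag_lt hS hU hs) ht hφ y hy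

/-- Unfoldings of good trees are models. -/
theorem mod_unf (hT : ∀ t ∈ Ts, t.1 ∈ U.sublists ∧ t.2 ∈ U.sublists ∧ ∃ a ∈ t.1, 0 ∈ a.2) {s : Nd}
    (hs : s.Good w U c) (hf : s.Full) : Mod Ts ((Nd.coalg ℓ).Unf w s) := by
  intro t ht e he
  have ho := tr_occ (hT t ht).2.2 he
  obtain ⟨x, hx, rfl⟩ := occ_norm hS hU hs ho
  have h1 := lam_sub_of_tr hS hU hs (ι := fun x => x) Function.injective_id
    (fun φ hφ => Or.inl ⟨φ, hφ, mapA_id φ⟩) (fun q hq h => lam_of_tr hS hU hs hq h) x hx (Or.inr ho)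
    _ (hT t ht).1 he
  exact tr_of_lam_sub hU (Or.inr hf) (ι := fun x => x) (fun φ hφ => by rwa [mapA_id])
    (fun p hp => tr_of_lam hU hf hp) x hx (Or.inr ho) _
    (lam_mod hS hU (fun t ht => ⟨(hT t ht).1, (hT t ht).2.1⟩) (good_sub hS hs x hx) t ht h1)

end Trees

end

section

variable {X : Type}

/-! ### Types derived from databases -/

section Alpha

variable {w : ℕ} {U : Pt} {Ts : List (Pt × Pt)} {c : Ty → Ty} {ℓ : Ty → Pt → ℕ → Ty}

open Classical in
/-- The type derived at the root from the database part of a tree. -/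
noncomputable def alpha (w : ℕ) (U : Pt) (c : Ty → Ty) : Nd → Ty
  | .st _ _ => c []
  | .dn B ch => c (U.sublists.filter fun q => comb w B (fun b P => P ∈ alpha w U c (ch b)) 0 q)

/-- The database part of a tree. -/
def Nd.strip : Nd → Nd
  | .st σ _ => .st σ []
  | .dn B ch => .dn B fun b => (ch b).strip

theorem filter_mem_tys {p : Pt → Bool} : U.sublists.filter p ∈ tys U :=
  List.mem_sublists.2 List.filter_sublist

theorem nil_mem_tys : ([] : Ty) ∈ tys U := List.mem_sublists.2 (List.nil_sublist _)

variable (hS : Sys w U Ts c ℓ)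
include hS

theorem alpha_mem (t : Nd) : alpha w U c t ∈ tys U := by
  cases t <;> exact hS.c_mem _

theorem alpha_closed (t : Nd) : ∀ q ∈ c (alpha w U c t), q ∈ alpha w U c t := by
  cases t with
  | st σ ps => exact hS.c_cl _ nil_mem_tys _ (hS.c_mem _) fun _ h => h
  | dn B ch => exact hS.c_cl _ filter_mem_tys _ (hS.c_mem _) fun _ h => h

theorem alpha_dn {B : Pt} {ch : ℕ → Nd} {q : Pt} (hq : q ∈ U.sublists)
    (h : comb w B (fun b P => P ∈ alpha w U c (ch b)) 0 q) : q ∈ alpha w U c (.dn B ch) :=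
  hS.sub _ filter_mem_tys _ (List.mem_filter.2 ⟨hq, by simpa using h⟩)

theorem good_alpha (t : Nd) : (Nd.st (alpha w U c t) (alpha w U c t)).Good w U c :=
  ⟨alpha_mem hS t, alpha_closed hS t, fun _ h => h⟩

theorem alpha_sound {M : Str RelSym X} (hM : Mod Ts M) {t : Nd} {h : List ℕ → X}
    (hD : ∀ φ ∈ (Nd.coalg ℓ).Unf w t.strip, mapA h φ ∈ M) :
    ∀ p ∈ alpha w U c t, Tr M p (h []) := by
  induction t generalizing h with
  | st σ ps => exact hS.c_sound X M hM [] nil_mem_tys (h []) (by simp)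
  | dn B ch ih =>
    refine hS.c_sound X M hM _ filter_mem_tys (h []) fun q hq => ?_
    have hq' := (List.mem_filter.1 hq).2
    simp only [decide_eq_true_eq] at hq'
    have := comb_sound (M := M) (e := fun b => h (sh b [])) (fun a ha => ?_) (fun b hb p hp => ?_) hq'
    · simpa [sh_zero_nil] using this
    · have := hD _ (Coalg.bag_mem_Unf (K := Nd.coalg ℓ) (s := (Nd.dn B ch).strip) (a := a) ha)
      rwa [mapA_mapA] at this
    · exact ih b (h := fun x => h (sh b x)) (fun φ hφ => by
        have := hD _ (Coalg.ch_mem_Unf (K := Nd.coalg ℓ) (s := (Nd.dn B ch).strip) hb hφ)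
        rwa [mapA_mapA] at this) p hp

end Alpha

theorem strip_sub {w : ℕ} {ℓ : Ty → Pt → ℕ → Ty} {t : Nd} :
    (Nd.coalg ℓ).Unf w t.strip ⊆ (Nd.coalg ℓ).Unf w t := by
  rintro φ ⟨n, hn⟩
  refine ⟨n, ?_⟩
  induction n generalizing t φ with
  | zero => exact hn
  | succ n ih =>
    cases t with
    | st σ ps =>
      rw [UnfN_leaf (show (Nd.st σ ps).strip.IsLeaf from rfl)] at hn
      exact hn.elim
    | dn B ch =>
      rcases hn with h | ⟨b, hb, ψ, hψ, rfl⟩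
      · exact Or.inl h
      · exact Or.inr ⟨b, hb, ψ, ih hψ, rfl⟩

theorem strip_finite {w : ℕ} {ℓ : Ty → Pt → ℕ → Ty} (t : Nd) :
    ((Nd.coalg ℓ).Unf w t.strip).Finite := by
  induction t with
  | st σ ps =>
    rw [Unf_leaf (show (Nd.st σ ps).strip.IsLeaf from rfl)]
    exact Set.finite_empty
  | dn B ch ih =>
    have : (Nd.coalg ℓ).Unf w (Nd.dn B ch).strip ⊆
        mapA (fun i => sh i []) '' {a | a ∈ B} ∪
          ⋃ b ∈ {b | b < w}, mapA (sh b) '' (Nd.coalg ℓ).Unf w (ch b).strip := by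
      intro φ hφ
      rcases Coalg.mem_Unf.1 hφ with ⟨a, ha, rfl⟩ | ⟨b, hb, ψ, hψ, rfl⟩
      · exact Or.inl ⟨a, ha, rfl⟩
      · exact Or.inr (Set.mem_biUnion hb ⟨ψ, hψ, rfl⟩)
    refine Set.Finite.subset (Set.Finite.union (Set.Finite.image _ (List.finite_toSet B))
      (Set.Finite.biUnion (Set.finite_lt_nat w) fun b _ => (ih b).image _)) this

/-- `Real N D t d`: the tree `t` unravels the database `D ⊆ N` at `d`, with the types of `N`. -/
def Real (U : Pt) (N D : Str RelSym X) : Nd → X → Prop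
  | .st σ ps, d => ps = σ ∧ σ ∈ tys U ∧ ∀ q ∈ U.sublists, q ∈ σ ↔ Tr N q d
  | .dn B ch, d => B ∈ U.sublists ∧ ∃ δ : ℕ → X, δ 0 = d ∧ (∀ a ∈ B, mapA δ a ∈ D) ∧
      ∀ b, Real U N D (ch b) (δ b)

section Real

variable {w : ℕ} {U : Pt} {Ts : List (Pt × Pt)} {c : Ty → Ty} {ℓ : Ty → Pt → ℕ → Ty}
  {N D : Str RelSym X}

theorem Real.full {t : Nd} {d : X} (h : Real U N D t d) : t.Full := by
  induction t generalizing d with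
  | st σ ps => exact h.1
  | dn B ch ih =>
    obtain ⟨-, δ, -, -, h⟩ := h
    exact fun b => ih b (h b)

theorem Real.lam {t : Nd} {d : X} (h : Real U N D t d) :
    t.lam ∈ tys U ∧ ∀ q ∈ U.sublists, q ∈ t.lam ↔ Tr N q d := by
  induction t generalizing d with
  | st σ ps => exact h.2
  | dn B ch ih =>
    obtain ⟨-, δ, rfl, -, h⟩ := h
    exact ih 0 (h 0)

open Classical in
theorem exists_real (d : X) : ∃ t, Real U N D t d :=
  ⟨.st (U.sublists.filter fun q => Tr N q d) _, rfl, filter_mem_tys, fun q hq => by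
    rw [List.mem_filter]
    simp [hq]⟩

theorem Real.good (hS : Sys w U Ts c ℓ) (hN : Mod Ts N) (hD : D ⊆ N) {t : Nd} {d : X}
    (h : Real U N D t d) : t.Good w U c := by
  induction t generalizing d with
  | st σ ps =>
    obtain ⟨rfl, h1, h2⟩ := h
    refine ⟨h1, fun q hq => ?_, fun _ h => h⟩
    exact (h2 q (mem_tys (hS.c_mem _) hq)).2 (hS.c_sound X N hN ps h1 d
      (fun q hq => (h2 q (mem_tys h1 hq)).1 hq) q hq)
  | dn B ch ih =>
    obtain ⟨hB, δ, rfl, h1, h⟩ := h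
    refine ⟨hB, fun b => ih b (h b), fun b hb q hq hc => ?_⟩
    exact ((h b).lam.2 q hq).2 (comb_sound (fun a ha => hD (h1 a ha))
      (fun b' hb' p hp => ((h b').lam.2 p (mem_tys (h b').lam.1 hp)).1 hp) hc)

/-- Unfoldings of trees are mapped into models. -/
theorem Real.exists_hom (hS : Sys w U Ts c ℓ) (hN : Mod Ts N) (hD : D ⊆ N) {t : Nd} {d : X}
    (h : Real U N D t d) : ∃ G : List ℕ → X, G [] = d ∧
      ∀ φ ∈ (Nd.coalg ℓ).Unf w t, mapA G φ ∈ N := by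
  let Inv : Nd → X → Prop := fun t d => Real U N D t d ∨
    ∃ σ ps, t = .st σ ps ∧ σ ∈ tys U ∧ (∀ p ∈ ps, p ∈ σ) ∧ ∀ p ∈ σ, Tr N p d
  suffices step : ∀ s e, Inv s e → ∃ f : ℕ → X, f 0 = e ∧
      (∀ a ∈ (Nd.coalg ℓ).bag s, mapA f a ∈ N) ∧ ∀ b < w, Inv ((Nd.coalg ℓ).ch s b) (f b) by
    obtain ⟨G, h0, hG, -⟩ := Coalg.exists_map (K := Nd.coalg ℓ) (w := w) (M := N) Inv step
      (s := t) (e := d) (Or.inl h)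
    exact ⟨G, h0, hG⟩
  intro s e hs
  have hst : ∀ σ ps, σ ∈ tys U → (∀ p ∈ ps, p ∈ σ) → (∀ p ∈ σ, Tr N p e) →
      ∃ f : ℕ → X, f 0 = e ∧ (∀ a ∈ (Nd.coalg ℓ).bag (.st σ ps), mapA f a ∈ N) ∧
        ∀ b < w, Inv ((Nd.coalg ℓ).ch (.st σ ps) b) (f b) := by
    intro σ ps hσ hps ht
    rcases ps with _ | ⟨p, ps⟩
    · exact ⟨fun _ => e, rfl, fun a ha => (List.not_mem_nil ha).elim,
        fun b _ => Or.inr ⟨σ, [], rfl, hσ, by simp, ht⟩⟩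
    · obtain ⟨f, rfl, hf⟩ := ht p (hps p (by simp))
      refine ⟨f, rfl, hf, fun b hb => Or.inr ?_⟩
      by_cases h0 : b = 0
      · subst h0
        exact ⟨σ, ps, by simp [Nd.coalg, Nd.chd], hσ, fun p hp => hps p (by simp [hp]), ht⟩
      · exact ⟨ℓ σ p b, ℓ σ p b, by simp [Nd.coalg, Nd.chd, h0], hS.ℓ_mem _ _ _, fun _ h => h,
          hS.ℓ_sound X N hN σ hσ p (hS.sub _ hσ _ (hps p (by simp))) f ht hf b hb h0⟩
  rcases hs with hs | ⟨σ, ps, rfl, hσ, hps, ht⟩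
  · cases s with
    | st σ ps =>
      obtain ⟨rfl, h1, h2⟩ := hs
      exact hst _ _ h1 (fun _ h => h) fun p hp => (h2 p (mem_tys h1 hp)).1 hp
    | dn B ch =>
      obtain ⟨-, δ, rfl, h1, h⟩ := hs
      exact ⟨δ, rfl, fun a ha => hD (h1 a ha), fun b _ => Or.inl (h b)⟩
  · exact hst σ ps hσ hps ht

/-- Among the trees unravelling a database, one derives the largest type. -/
theorem exists_max_real (c : Ty → Ty) (hc : ∀ σ, c σ ∈ tys U) (d : X) : ∃ t, Real U N D t d ∧
    ∀ t', Real U N D t' d → (∀ q ∈ alpha w U c t, q ∈ alpha w U c t') →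
      ∀ q ∈ alpha w U c t', q ∈ alpha w U c t := by
  classical
  let m : Nd → ℕ := fun t => U.sublists.toFinset.card - (alpha w U c t).toFinset.card
  have hsub : ∀ t, (alpha w U c t).toFinset ⊆ U.sublists.toFinset := fun t q hq => by
    rw [List.mem_toFinset] at hq ⊢
    have : alpha w U c t ∈ tys U := by cases t <;> exact hc _
    exact mem_tys this hq
  obtain ⟨t0, ht0⟩ := exists_real (U := U) (N := N) (D := D) d
  obtain ⟨t, ht, hmin⟩ := WellFounded.has_min (measure m).wf {t | Real U N D t d} ⟨t0, ht0⟩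
  refine ⟨t, ht, fun t' ht' hss q hq => ?_⟩
  have h1 : ¬ m t' < m t := hmin t' ht'
  have h2 : (alpha w U c t).toFinset ⊆ (alpha w U c t').toFinset := fun q hq => by
    rw [List.mem_toFinset] at hq ⊢
    exact hss q hq
  have h3 := Finset.card_le_card (hsub t')
  have h4 := Finset.card_le_card (hsub t)
  have h5 : (alpha w U c t').toFinset.card ≤ (alpha w U c t).toFinset.card := by
    simp only [m] at h1
    omega
  have := Finset.eq_of_subset_of_card_le h2 h5
  have hq' : q ∈ (alpha w U c t').toFinset := List.mem_toFinset.2 hq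
  rwa [← this, List.mem_toFinset] at hq'

end Real

/-! ### The model assembled from the derived types -/

section Join

variable {w : ℕ} {U : Pt} {Ts : List (Pt × Pt)} {c : Ty → Ty} {ℓ : Ty → Pt → ℕ → Ty}

/-- The database `D` with the unfolding of the type `α d` attached to each element `d`. -/
def join (w : ℕ) (ℓ : Ty → Pt → ℕ → Ty) (D : Str RelSym X) (α : X → Ty) :
    Str RelSym (X × List ℕ) :=
  {φ | (∃ ψ ∈ D, mapA (fun d => (d, [])) ψ = φ) ∨
    ∃ d, ∃ ψ ∈ (Nd.coalg ℓ).Unf w (.st (α d) (α d)), mapA (fun x => (d, x)) ψ = φ}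

theorem mk_injective (d : X) : Function.Injective fun x : List ℕ => (d, x) :=
  fun _ _ h => (Prod.mk.inj h).2

variable (hS : Sys w U Ts c ℓ) (hU : Uni w U) {D : Str RelSym X} {α : X → Ty}
include hS hU

theorem join_root (hα : ∀ d, (Nd.st (α d) (α d)).Good w U c)
    (hmax : ∀ B ∈ U.sublists, ∀ δ : ℕ → X, (∀ a ∈ B, mapA δ a ∈ D) → ∀ q ∈ U.sublists,
      comb w B (fun b P => P ∈ α (δ b)) 0 q → q ∈ α (δ 0)) {d : X} {q : Pt}
    (hq : q ∈ U.sublists) (h : Tr (join w ℓ D α) q (d, [])) : q ∈ α d := by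
  classical
  obtain ⟨f, h0, hf⟩ := h
  have hqU : ∀ a ∈ q, a ∈ U := fun a ha => mem_pats hq ha
  let δ : ℕ → X := fun i => (f i).1
  let lo : X × List ℕ → ℕ := fun x => if hx : ∃ i, i < w ∧ δ i = x.1 then Nat.find hx else 0
  have hlow : ∀ x, lo x < w := fun x => by
    simp only [lo]
    split
    · rename_i hx
      exact (Nat.find_spec hx).1
    · exact hU.pos
  have hlo1 : ∀ i < w, ∀ x, δ (lo (δ i, x)) = δ i := fun i hi x => by
    have hx : ∃ j, j < w ∧ δ j = ((δ i, x) : X × List ℕ).1 := ⟨i, hi, rfl⟩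
    simp only [lo, dif_pos hx]
    exact (Nat.find_spec hx).2
  have hd : δ 0 = d := by simp [δ, h0]
  rw [← hd]
  let B : Pt := U.filter fun a => mapA δ a ∈ D
  refine hmax B (List.mem_sublists.2 List.filter_sublist) δ (fun a ha => by
    simpa using (List.mem_filter.1 ha).2) q hq ?_
  refine comb_mono (fun _ h => h) ?_ (comb_complete hU (N := mapA f '' {a | a ∈ q}) (B := B)
    (Nb := fun b => mapA (fun x => (δ b, x)) '' (Nd.coalg ℓ).Unf w (.st (α (δ b)) (α (δ b))))
    lo (fun b => (δ b, [])) hlow ?_ (b0 := 0) ?_ hqU ?_)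
  · rintro b hb P ⟨hP1, -, hP2⟩
    exact lam_of_tr hS hU (hα (δ b)) hP1 (hP2.of_img (mk_injective (δ b)))
  · rintro _ ⟨a, ha, rfl⟩
    have hlt := hU.lt a (hqU a ha)
    rcases hf a ha with ⟨ψ, hψ, he⟩ | ⟨d', ψ, hψ, he⟩
    · have hx : ∀ i ∈ a.2, f i = (δ i, []) := fun i hi => by
        have : f i ∈ (mapA (fun d => ((d, []) : X × List ℕ)) ψ).2 := by
          rw [he]
          exact mem_mapA.2 ⟨i, hi, rfl⟩
        obtain ⟨y, -, hy⟩ := mem_mapA.1 this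
        simp only [δ, ← hy]
      left
      have hψ' : ψ = mapA δ a := by
        have := congrArg (mapA Prod.fst) he
        rw [mapA_mapA, mapA_mapA] at this
        rwa [mapA_id] at this
      refine ⟨fun x hx' => ?_, List.mem_filter.2 ⟨?_, ?_⟩⟩
      · obtain ⟨i, hi, rfl⟩ := mem_mapA.1 hx'
        rw [hx i hi, hlo1 i (hlt i hi)]
      · rw [mapA_mapA]
        exact hU.ren a (hqU a ha) _ fun i _ => hlow _
      · rw [mapA_mapA, mapA_mapA, mapA_congr (g := δ) fun i hi => by
          rw [hx i hi]
          exact hlo1 i (hlt i hi) []]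
        simpa [hψ'] using hψ
    · right
      have hx : ∀ i ∈ a.2, δ i = d' := fun i hi => by
        have : f i ∈ (mapA (fun x => (d', x)) ψ).2 := by
          rw [he]
          exact mem_mapA.2 ⟨i, hi, rfl⟩
        obtain ⟨y, -, hy⟩ := mem_mapA.1 this
        simp only [δ, ← hy]
      obtain ⟨i0, hi0⟩ := List.exists_mem_of_ne_nil _ (hU.ne a (hqU a ha))
      have hlo2 : ∀ i ∈ a.2, lo (f i) = lo (d', []) := fun i hi => by
        have : (f i).1 = d' := hx i hi
        simp only [lo, this]
      refine ⟨lo (d', []), hlow _, fun x hx' => ?_, ?_⟩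
      · obtain ⟨i, hi, rfl⟩ := mem_mapA.1 hx'
        exact hlo2 i hi
      · have : δ (lo (d', [])) = d' := by
          have := hlo1 i0 (hlt i0 hi0) []
          rwa [hx i0 hi0] at this
        rw [this]
        exact ⟨ψ, hψ, he⟩
  · have hx : ∃ j, j < w ∧ δ j = ((δ 0, []) : X × List ℕ).1 := ⟨0, hU.pos, rfl⟩
    simp only [lo, dif_pos hx]
    exact (Nat.find_eq_zero hx).2 ⟨hU.pos, rfl⟩
  · exact ⟨f, by rw [h0, hd], fun a ha => ⟨a, ha, rfl⟩⟩

theorem join_mod (hT : ∀ t ∈ Ts, t.1 ∈ U.sublists ∧ t.2 ∈ U.sublists ∧ ∃ a ∈ t.1, 0 ∈ a.2)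
    (hα : ∀ d, (Nd.st (α d) (α d)).Good w U c)
    (hmax : ∀ B ∈ U.sublists, ∀ δ : ℕ → X, (∀ a ∈ B, mapA δ a ∈ D) → ∀ q ∈ U.sublists,
      comb w B (fun b P => P ∈ α (δ b)) 0 q → q ∈ α (δ 0)) : Mod Ts (join w ℓ D α) := by
  intro t ht e he
  obtain ⟨d, y, x, hy, hx, ho⟩ : ∃ d y x, e = (d, norm x) ∧ (∀ i ∈ x, i < w) ∧ norm x = y ∧
      (norm x = [] ∨ Occ ((Nd.coalg ℓ).Unf w (.st (α d) (α d))) (norm x)) := by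
    obtain ⟨φ, hφ, h⟩ := tr_occ (hT t ht).2.2 he
    rcases hφ with ⟨ψ, hψ, rfl⟩ | ⟨d, ψ, hψ, rfl⟩
    · obtain ⟨d, hd, rfl⟩ := mem_mapA.1 h
      exact ⟨d, [], [], rfl, by simp, rfl, Or.inl rfl⟩
    · obtain ⟨y, hy, rfl⟩ := mem_mapA.1 h
      obtain ⟨x, hx, rfl⟩ := occ_norm hS hU (hα d) ⟨ψ, hψ, hy⟩
      exact ⟨d, norm x, x, rfl, hx, rfl, Or.inr ⟨ψ, hψ, hy⟩⟩
  subst hy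
  have hroot : ∀ q ∈ U.sublists, Tr (join w ℓ D α) q (d, []) → q ∈ α d := fun q hq h =>
    join_root hS hU hα hmax hq h
  have h1 := lam_sub_of_tr hS hU (hα d) (J := join w ℓ D α) (ι := fun x => (d, x)) (mk_injective d)
    (fun φ hφ => ?_) hroot x hx ho.2 _ (hT t ht).1 he
  · refine tr_of_lam_sub hU (Or.inl ⟨_, _, rfl⟩) (ι := fun x => (d, x))
      (fun φ hφ => Or.inr ⟨d, φ, hφ, rfl⟩) (fun p hp => ?_) x hx ho.2 _
      (lam_mod hS hU (fun t ht => ⟨(hT t ht).1, (hT t ht).2.1⟩) (good_sub hS (hα d) x hx) t ht h1)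
    exact (tr_of_lam hU (t := .st (α d) (α d)) rfl hp).map (h := fun x => (d, x))
      fun φ hφ => Or.inr ⟨d, φ, hφ, rfl⟩
  · rcases hφ with ⟨ψ, hψ, rfl⟩ | ⟨d', ψ, hψ, rfl⟩
    · refine Or.inr fun x hx h => ?_
      obtain ⟨y, -, hy⟩ := mem_mapA.1 h
      exact hx (Prod.mk.inj hy).2.symm
    · by_cases hd : d' = d
      · subst hd
        exact Or.inl ⟨ψ, hψ, rfl⟩
      · refine Or.inr fun x hx h => ?_
        obtain ⟨y, -, hy⟩ := mem_mapA.1 h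
        exact hd (Prod.mk.inj hy).1

end Join

end

section

variable {X Y : Type}

/-! ### Labelled patterns and simulations -/

/-- Relation symbols and labels. -/
abbrev Lab := RelSym ⊕ Ty

abbrev LPt := Pat Lab

/-- The universe of labelled atoms. -/
def LA (w : ℕ) (U : Pt) (Q : List RelSym) : LPt :=
  (U.filter fun a => a.1 ∈ Q).map (fun a => (Sum.inl a.1, a.2)) ++
    (tys U).flatMap fun τ => (List.range w).map fun i => (Sum.inr τ, [i])

theorem mem_LA {w : ℕ} {U : Pt} {Q : List RelSym} {a : At Lab} : a ∈ LA w U Q ↔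
    (∃ b ∈ U, b.1 ∈ Q ∧ (Sum.inl b.1, b.2) = a) ∨ ∃ τ ∈ tys U, ∃ i < w, (Sum.inr τ, [i]) = a := by
  simp only [LA, List.mem_append, List.mem_map, List.mem_filter, decide_eq_true_eq,
    List.mem_flatMap, List.mem_range, and_assoc]

theorem uni_LA {w : ℕ} {U : Pt} {Q : List RelSym} (hU : Uni w U) : Uni w (LA w U Q) where
  pos := hU.pos
  lt a ha := by
    rcases mem_LA.1 ha with ⟨b, hb, -, rfl⟩ | ⟨τ, -, i, hi, rfl⟩
    · exact hU.lt b hb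
    · simpa using hi
  ne a ha := by
    rcases mem_LA.1 ha with ⟨b, hb, -, rfl⟩ | ⟨τ, -, i, hi, rfl⟩
    · exact hU.ne b hb
    · simp
  ren a ha g hg := by
    rcases mem_LA.1 ha with ⟨b, hb, hQ, rfl⟩ | ⟨τ, hτ, i, hi, rfl⟩
    · exact mem_LA.2 (Or.inl ⟨_, hU.ren b hb g hg, hQ, rfl⟩)
    · exact mem_LA.2 (Or.inr ⟨τ, hτ, g i, hg i (by simp), rfl⟩)

/-- The structure `M` over `Q`, with labels. -/
def LM (Q : List RelSym) (M : Str RelSym X) (Z : X → Ty → Prop) : Str Lab X :=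
  {φ | (∃ ψ ∈ M, ψ.1 ∈ Q ∧ (Sum.inl ψ.1, ψ.2) = φ) ∨ ∃ x τ, Z x τ ∧ (Sum.inr τ, [x]) = φ}

theorem inl_mem_LM {Q : List RelSym} {M : Str RelSym X} {Z : X → Ty → Prop} {r : RelSym}
    {l : List X} : (Sum.inl r, l) ∈ LM Q M Z ↔ (r, l) ∈ M ∧ r ∈ Q := by
  constructor
  · rintro (⟨ψ, h1, h2, h3⟩ | ⟨x, τ, -, h⟩)
    · cases h3
      exact ⟨h1, h2⟩
    · simp at h
  · rintro ⟨h1, h2⟩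
    exact Or.inl ⟨_, h1, h2, rfl⟩

theorem inr_mem_LM {Q : List RelSym} {M : Str RelSym X} {Z : X → Ty → Prop} {τ : Ty} {x : X} :
    (Sum.inr τ, [x]) ∈ LM Q M Z ↔ Z x τ := by
  constructor
  · rintro (⟨ψ, h1, h2, h3⟩ | ⟨x', τ', h, h'⟩)
    · simp at h3
    · cases h'
      exact h
  · exact fun h => Or.inr ⟨x, τ, h, rfl⟩

theorem LM_map {Q : List RelSym} {M : Str RelSym X} {N : Str RelSym Y} {Z : X → Ty → Prop}
    {Z' : Y → Ty → Prop} {h : X → Y} (hM : ∀ φ ∈ M, φ.1 ∈ Q → mapA h φ ∈ N)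
    (hZ : ∀ x τ, Z x τ → Z' (h x) τ) : ∀ φ ∈ LM Q M Z, mapA h φ ∈ LM Q N Z' := by
  rintro φ (⟨ψ, h1, h2, rfl⟩ | ⟨x, τ, hx, rfl⟩)
  · exact Or.inl ⟨_, hM ψ h1 h2, h2, rfl⟩
  · exact Or.inr ⟨_, τ, hZ x τ hx, rfl⟩

theorem LM_mono {Q : List RelSym} {M : Str RelSym X} {Z Z' : X → Ty → Prop}
    (hZ : ∀ x τ, Z x τ → Z' x τ) : LM Q M Z ⊆ LM Q M Z' := fun φ hφ => by
  have := LM_map (h := fun x => x) (N := M) (fun φ hφ _ => by rwa [mapA_id]) hZ φ hφ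
  rwa [mapA_id] at this

/-- The variable `i` belongs to the component of `y` in `p`. -/
def Cn (Q : List RelSym) (p : Pt) (y i : ℕ) : Prop :=
  ∀ V : Set ℕ, y ∈ V → (∀ a ∈ p, a.1 ∈ Q → (∃ j ∈ a.2, j ∈ V) → ∀ j ∈ a.2, j ∈ V) → i ∈ V

theorem Cn.refl {Q : List RelSym} {p : Pt} (y : ℕ) : Cn Q p y y := fun _ h _ => h

theorem Cn.trans {Q : List RelSym} {p : Pt} {x y z : ℕ} (h : Cn Q p x y) (h' : Cn Q p y z) :
    Cn Q p x z := fun V hx hV => h' V (h V hx hV) hV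

theorem Cn.of_atom {Q : List RelSym} {p : Pt} {a : At RelSym} (ha : a ∈ p) (hQ : a.1 ∈ Q)
    {i j : ℕ} (hi : i ∈ a.2) (hj : j ∈ a.2) : Cn Q p i j :=
  fun _ hx hV => hV a ha hQ ⟨i, hi, hx⟩ j hj

/-- The label of the element `b` of the pattern `p` at an element labelled `τ`. -/
def labt (ℓ : Ty → Pt → ℕ → Ty) (τ : Ty) (p : Pt) (b : ℕ) : Ty := if b = 0 then τ else ℓ τ p b

open Classical in
/-- The labelled component of `y` in `p`, rooted at `y`. -/
noncomputable def LL (w : ℕ) (U : Pt) (Q : List RelSym) (ℓ : Ty → Pt → ℕ → Ty) (τ : Ty) (p : Pt)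
    (y : ℕ) : LPt :=
  (LA w U Q).filter fun a' =>
    (∃ a ∈ p, a.1 ∈ Q ∧ (∀ i ∈ a.2, Cn Q p y i) ∧ a' = (Sum.inl a.1, a.2.map (Equiv.swap 0 y))) ∨
      ∃ i < w, Cn Q p y i ∧ a' = (Sum.inr (labt ℓ τ p i), [Equiv.swap 0 y i])

section Sims

variable {w : ℕ} {U : Pt} {Q : List RelSym} {ℓ : Ty → Pt → ℕ → Ty}

theorem LL_mem {τ : Ty} {p : Pt} {y : ℕ} : LL w U Q ℓ τ p y ∈ (LA w U Q).sublists :=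
  List.mem_sublists.2 List.filter_sublist

theorem mem_LL {τ : Ty} {p : Pt} {y : ℕ} {a' : At Lab} : a' ∈ LL w U Q ℓ τ p y ↔
    a' ∈ LA w U Q ∧ ((∃ a ∈ p, a.1 ∈ Q ∧ (∀ i ∈ a.2, Cn Q p y i) ∧
        a' = (Sum.inl a.1, a.2.map (Equiv.swap 0 y))) ∨
      ∃ i < w, Cn Q p y i ∧ a' = (Sum.inr (labt ℓ τ p i), [Equiv.swap 0 y i])) := by
  simp [LL, List.mem_filter]

theorem swap_lt {y i : ℕ} (hw : 0 < w) (hy : y < w) (hi : i < w) : Equiv.swap 0 y i < w := by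
  rw [Equiv.swap_apply_def]
  split_ifs <;> assumption

theorem labt_mem (hℓ : ∀ σ p b, ℓ σ p b ∈ tys U) {τ : Ty} (hτ : τ ∈ tys U) (p : Pt) (b : ℕ) :
    labt ℓ τ p b ∈ tys U := by
  unfold labt
  split
  · exact hτ
  · exact hℓ _ _ _

theorem inl_mem_LL (hU : Uni w U) {τ : Ty} {p : Pt} (hp : p ∈ U.sublists) {y : ℕ} (hy : y < w)
    {a : At RelSym} (ha : a ∈ p) (hQ : a.1 ∈ Q) (hc : ∀ i ∈ a.2, Cn Q p y i) :
    (Sum.inl a.1, a.2.map (Equiv.swap 0 y)) ∈ LL w U Q ℓ τ p y :=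
  mem_LL.2 ⟨mem_LA.2 (Or.inl ⟨mapA (Equiv.swap 0 y) a, hU.ren a (mem_pats hp ha) _ fun i hi =>
    swap_lt hU.pos hy (hU.lt a (mem_pats hp ha) i hi), hQ, rfl⟩), Or.inl ⟨a, ha, hQ, hc, rfl⟩⟩

theorem inr_mem_LL (hU : Uni w U) (hℓ : ∀ σ p b, ℓ σ p b ∈ tys U) {τ : Ty} (hτ : τ ∈ tys U)
    {p : Pt} {y : ℕ} (hy : y < w) {i : ℕ} (hi : i < w) (hc : Cn Q p y i) :
    (Sum.inr (labt ℓ τ p i), [Equiv.swap 0 y i]) ∈ LL w U Q ℓ τ p y :=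
  mem_LL.2 ⟨mem_LA.2 (Or.inr ⟨_, labt_mem hℓ hτ p i, _, swap_lt hU.pos hy hi, rfl⟩),
    Or.inr ⟨i, hi, hc, rfl⟩⟩

theorem LL_conn (hU : Uni w U) {τ : Ty} {p : Pt} (hp : p ∈ U.sublists) {y : ℕ} (hy : y < w) :
    Conn (LL w U Q ℓ τ p y) := by
  intro V h0 hV
  have key : ∀ i, Cn Q p y i → Equiv.swap 0 y i ∈ V := fun i hi => by
    refine (hi {i | Cn Q p y i ∧ Equiv.swap 0 y i ∈ V} ⟨Cn.refl y, by simpa using h0⟩ ?_).2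
    rintro a ha hQ ⟨j, hj, hcj, hjV⟩ k hk
    have hc : ∀ i ∈ a.2, Cn Q p y i := fun i hi => hcj.trans (Cn.of_atom ha hQ hj hi)
    exact ⟨hc k hk, hV _ (inl_mem_LL hU hp hy ha hQ hc) ⟨_, List.mem_map_of_mem hj, hjV⟩ _
      (List.mem_map_of_mem hk)⟩
  intro a' ha' j hj
  rcases (mem_LL.1 ha').2 with ⟨a, ha, hQ, hc, rfl⟩ | ⟨i, hi, hc, rfl⟩
  · obtain ⟨i, hi, rfl⟩ := List.mem_map.1 hj
    exact key i (hc i hi)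
  · simp only [List.mem_singleton] at hj
    subst hj
    exact key i hc

theorem LL_tr {M : Str RelSym X} {Z : X → Ty → Prop} {τ : Ty} {p : Pt} {f : ℕ → X}
    (hf : ∀ a ∈ p, a.1 ∈ Q → mapA f a ∈ M) (hZ : ∀ i < w, Z (f i) (labt ℓ τ p i)) (y : ℕ) :
    Tr (LM Q M Z) (LL w U Q ℓ τ p y) (f y) := by
  have hs : ∀ i, f (Equiv.swap 0 y (Equiv.swap 0 y i)) = f i := fun i => by simp
  refine ⟨fun i => f (Equiv.swap 0 y i), by simp, fun a' ha' => ?_⟩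
  rcases (mem_LL.1 ha').2 with ⟨a, ha, hQ, hc, rfl⟩ | ⟨i, hi, hc, rfl⟩
  · refine inl_mem_LM.2 ⟨?_, hQ⟩
    have := hf a ha hQ
    simpa [mapA, Function.comp_def] using this
  · simp only [mapA, List.map_cons, List.map_nil, hs]
    exact inr_mem_LM.2 (hZ i hi)

theorem LL_use (hU : Uni w U) (hℓ : ∀ σ p b, ℓ σ p b ∈ tys U) {M : Str RelSym X}
    {Z : X → Ty → Prop} {τ : Ty} (hτ : τ ∈ tys U) {p : Pt} (hp : p ∈ U.sublists) {y : ℕ}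
    (hy : y < w) {e : X} (h : Tr (LM Q M Z) (LL w U Q ℓ τ p y) e) :
    ∃ g : ℕ → X, g y = e ∧ (∀ a ∈ p, a.1 ∈ Q → (∀ i ∈ a.2, Cn Q p y i) → mapA g a ∈ M) ∧
      ∀ i < w, Cn Q p y i → Z (g i) (labt ℓ τ p i) := by
  obtain ⟨g, h0, hg⟩ := h
  refine ⟨fun i => g (Equiv.swap 0 y i), by simpa using h0, fun a ha hQ hc => ?_,
    fun i hi hc => ?_⟩
  · have := (inl_mem_LM.1 (hg _ (inl_mem_LL hU hp hy ha hQ hc))).1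
    simpa [mapA, Function.comp_def] using this
  · exact inr_mem_LM.1 (hg _ (inr_mem_LL hU hℓ hτ hy hi hc))

/-- Local satisfiability of all components gives satisfiability. -/
theorem exists_assign (hU : Uni w U) (hℓ : ∀ σ p b, ℓ σ p b ∈ tys U) {M : Str RelSym X}
    {Z : X → Ty → Prop} {τ : Ty} (hτ : τ ∈ tys U) {p : Pt} (hp : p ∈ U.sublists) {e : X}
    (h0 : Tr (LM Q M Z) (LL w U Q ℓ τ p 0) e)
    (h : ∀ y < w, ∃ e, Tr (LM Q M Z) (LL w U Q ℓ τ p y) e) :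
    ∃ f : ℕ → X, f 0 = e ∧ (∀ a ∈ p, a.1 ∈ Q → mapA f a ∈ M) ∧
      ∀ i < w, Z (f i) (labt ℓ τ p i) := by
  have hg : ∀ y, ∃ g : ℕ → X, y < w → (y = 0 → g 0 = e) ∧
      (∀ a ∈ p, a.1 ∈ Q → (∀ i ∈ a.2, Cn Q p y i) → mapA g a ∈ M) ∧
      ∀ i < w, Cn Q p y i → Z (g i) (labt ℓ τ p i) := fun y => by
    by_cases hy : y < w
    · by_cases hy0 : y = 0
      · subst hy0
        obtain ⟨g, hg0, hg⟩ := LL_use hU hℓ hτ hp hy h0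
        exact ⟨g, fun _ => ⟨fun _ => hg0, hg⟩⟩
      · obtain ⟨e', he'⟩ := h y hy
        obtain ⟨g, -, hg⟩ := LL_use hU hℓ hτ hp hy he'
        exact ⟨g, fun _ => ⟨fun h => (hy0 h).elim, hg⟩⟩
    · exact ⟨fun _ => e, fun h => (hy h).elim⟩
  choose g hg using hg
  let rep : ℕ → ℕ := fun i => sInf {y | Cn Q p y i}
  have hrep : ∀ i, Cn Q p (rep i) i := fun i => Nat.sInf_mem (s := {y | Cn Q p y i}) ⟨i, Cn.refl i⟩
  have hle : ∀ i, rep i ≤ i := fun i => Nat.sInf_le (s := {y | Cn Q p y i}) (Cn.refl i)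
  refine ⟨fun i => g (rep i) i, ?_, fun a ha hQ => ?_, fun i hi => ?_⟩
  · have : rep 0 = 0 := Nat.le_zero.1 (hle 0)
    simp only [this]
    exact (hg 0 hU.pos).1 rfl
  · have haU := mem_pats hp ha
    obtain ⟨i0, hi0⟩ := List.exists_mem_of_ne_nil _ (hU.ne a haU)
    have heq : ∀ i ∈ a.2, rep i = rep i0 := fun i hi => by
      have : {y | Cn Q p y i} = {y | Cn Q p y i0} := Set.ext fun y =>
        ⟨fun h => h.trans (Cn.of_atom ha hQ hi hi0), fun h => h.trans (Cn.of_atom ha hQ hi0 hi)⟩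
      simp only [rep, this]
    rw [mapA_congr (g := g (rep i0)) fun i hi => by rw [heq i hi]]
    exact (hg (rep i0) ((hle i0).trans_lt (hU.lt a haU i0 hi0))).2.1 a ha hQ fun i hi => by
      rw [← heq i hi]
      exact hrep i
  · exact (hg (rep i) ((hle i).trans_lt hi)).2.2 i hi (hrep i)

/-- Types reachable from `α` by `ℓ`. -/
inductive Reach (w : ℕ) (ℓ : Ty → Pt → ℕ → Ty) (α : Ty) : Ty → Prop
  | base : Reach w ℓ α α
  | step {τ : Ty} {p : Pt} {b : ℕ} : Reach w ℓ α τ → p ∈ τ → b < w → Reach w ℓ α (labt ℓ τ p b)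

/-- Labelled patterns which have to hold somewhere. -/
def Free (w : ℕ) (U : Pt) (Q : List RelSym) (ℓ : Ty → Pt → ℕ → Ty) (α : Ty) (P : LPt) : Prop :=
  ∃ τ, Reach w ℓ α τ ∧ ∃ p ∈ τ, ∃ y < w, P = LL w U Q ℓ τ p y

theorem Reach.mem_tys (hℓ : ∀ σ p b, ℓ σ p b ∈ tys U) {α τ : Ty} (hα : α ∈ tys U)
    (h : Reach w ℓ α τ) : τ ∈ tys U := by
  induction h with
  | base => exact hα
  | step _ _ _ ih => exact labt_mem hℓ ih _ _

/-- `Z` is a simulation: every label is supported. -/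
def Sim (w : ℕ) (U : Pt) (Q : List RelSym) (ℓ : Ty → Pt → ℕ → Ty) (M : Str RelSym X)
    (Z : X → Ty → Prop) : Prop :=
  ∀ x τ, Z x τ → τ ∈ tys U ∧ ∀ p ∈ τ, Tr (LM Q M Z) (LL w U Q ℓ τ p 0) x

/-- Stages of the largest simulation. -/
def Zs (w : ℕ) (U : Pt) (Q : List RelSym) (ℓ : Ty → Pt → ℕ → Ty) (M : Str RelSym X) :
    ℕ → X → Ty → Prop
  | 0, _, τ => τ ∈ tys U
  | n + 1, x, τ => τ ∈ tys U ∧ ∀ p ∈ τ, Tr (LM Q M (Zs w U Q ℓ M n)) (LL w U Q ℓ τ p 0) x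

theorem Zs_tys {M : Str RelSym X} {n : ℕ} {x : X} {τ : Ty} (h : Zs w U Q ℓ M n x τ) :
    τ ∈ tys U := by
  cases n with
  | zero => exact h
  | succ n => exact h.1

theorem Zs_succ {M : Str RelSym X} (n : ℕ) : ∀ x τ, Zs w U Q ℓ M (n + 1) x τ → Zs w U Q ℓ M n x τ := by
  induction n with
  | zero => exact fun x τ h => h.1
  | succ n ih => exact fun x τ h => ⟨h.1, fun p hp => (h.2 p hp).mono (LM_mono ih)⟩

theorem Zs_anti {M : Str RelSym X} {n m : ℕ} (h : n ≤ m) :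
    ∀ x τ, Zs w U Q ℓ M m x τ → Zs w U Q ℓ M n x τ := by
  induction h with
  | refl => exact fun _ _ h => h
  | step _ ih => exact fun x τ h => ih x τ (Zs_succ _ x τ h)

theorem Sim.zs {M : Str RelSym X} {Z : X → Ty → Prop} (h : Sim w U Q ℓ M Z) (n : ℕ) :
    ∀ x τ, Z x τ → Zs w U Q ℓ M n x τ := by
  induction n with
  | zero => exact fun x τ hx => (h x τ hx).1
  | succ n ih => exact fun x τ hx => ⟨(h x τ hx).1, fun p hp => ((h x τ hx).2 p hp).mono (LM_mono ih)⟩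

theorem Zs_map {M : Str RelSym X} {N : Str RelSym Y} {h : X → Y}
    (hM : ∀ φ ∈ M, φ.1 ∈ Q → mapA h φ ∈ N) (n : ℕ) :
    ∀ x τ, Zs w U Q ℓ M n x τ → Zs w U Q ℓ N n (h x) τ := by
  induction n with
  | zero => exact fun x τ hx => hx
  | succ n ih => exact fun x τ hx => ⟨hx.1, fun p hp => (hx.2 p hp).map (LM_map hM ih)⟩

theorem Sim.push {M : Str RelSym X} {N : Str RelSym Y} {h : X → Y} {Z : X → Ty → Prop}
    (hZ : Sim w U Q ℓ M Z) (hM : ∀ φ ∈ M, φ.1 ∈ Q → mapA h φ ∈ N) :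
    Sim w U Q ℓ N fun y τ => ∃ x, h x = y ∧ Z x τ := by
  rintro _ τ ⟨x, rfl, hx⟩
  exact ⟨(hZ x τ hx).1, fun p hp => ((hZ x τ hx).2 p hp).map (LM_map hM fun x τ h => ⟨x, rfl, h⟩)⟩

/-- The largest simulation. -/
def Zmax (w : ℕ) (U : Pt) (Q : List RelSym) (ℓ : Ty → Pt → ℕ → Ty) (M : Str RelSym X) (x : X)
    (τ : Ty) : Prop := ∃ Z, Sim w U Q ℓ M Z ∧ Z x τ

theorem sim_zmax {M : Str RelSym X} : Sim w U Q ℓ M (Zmax w U Q ℓ M) := by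
  rintro x τ ⟨Z, hZ, hx⟩
  exact ⟨(hZ x τ hx).1, fun p hp => ((hZ x τ hx).2 p hp).mono (LM_mono fun x τ h => ⟨Z, hZ, h⟩)⟩

/-- True types in a model form a simulation. -/
theorem sim_true {Ts : List (Pt × Pt)} {c : Ty → Ty} (hS : Sys w U Ts c ℓ) {M : Str RelSym X}
    (hM : Mod Ts M) : Sim w U Q ℓ M fun x τ => τ ∈ tys U ∧ ∀ p ∈ τ, Tr M p x := by
  rintro x τ ⟨hτ, hx⟩
  refine ⟨hτ, fun p hp => ?_⟩
  obtain ⟨f, rfl, hf⟩ := hx p hp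
  refine LL_tr (fun a ha _ => hf a ha) (fun i hi => ⟨labt_mem hS.ℓ_mem hτ p i, ?_⟩) 0
  unfold labt
  split
  · rename_i h0
    rwa [h0]
  · rename_i h0
    exact hS.ℓ_sound X M hM τ hτ p (hS.sub τ hτ p hp) f hx hf i hi h0

theorem free_true {Ts : List (Pt × Pt)} {c : Ty → Ty} (hS : Sys w U Ts c ℓ) {M : Str RelSym X}
    (hM : Mod Ts M) {α : Ty} (hα : α ∈ tys U) {x : X} (hx : ∀ p ∈ α, Tr M p x) {P : LPt}
    (hP : Free w U Q ℓ α P) :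
    ∃ e, Tr (LM Q M fun x τ => τ ∈ tys U ∧ ∀ p ∈ τ, Tr M p x) P e := by
  have key : ∀ τ p, τ ∈ tys U → p ∈ τ → (∃ x, ∀ p ∈ τ, Tr M p x) → ∃ f : ℕ → X,
      (∀ a ∈ p, mapA f a ∈ M) ∧ ∀ i < w, ∀ q ∈ labt ℓ τ p i, Tr M q (f i) := by
    rintro τ p hτ hp ⟨x, hx⟩
    obtain ⟨f, rfl, hf⟩ := hx p hp
    refine ⟨f, hf, fun i hi => ?_⟩
    unfold labt
    split
    · rename_i h0
      rwa [h0]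
    · rename_i h0
      exact hS.ℓ_sound X M hM τ hτ p (hS.sub τ hτ p hp) f hx hf i hi h0
  obtain ⟨τ, hτ, p, hp, y, hy, rfl⟩ := hP
  have hex : ∃ x, ∀ p ∈ τ, Tr M p x := by
    clear hp
    induction hτ with
    | base => exact ⟨x, hx⟩
    | step h hp hb ih =>
      obtain ⟨f, -, hf⟩ := key _ _ (h.mem_tys hS.ℓ_mem hα) hp ih
      exact ⟨_, hf _ hb⟩
  have hτ' := hτ.mem_tys hS.ℓ_mem hα
  obtain ⟨f, hf, hf'⟩ := key τ p hτ' hp hex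
  exact ⟨_, LL_tr (fun a ha _ => hf a ha) (fun i hi => ⟨labt_mem hS.ℓ_mem hτ' p i, hf' i hi⟩) y⟩

/-- One step in the construction of a homomorphism from an unfolding. -/
theorem exists_assign_node (hU : Uni w U) (hℓ : ∀ σ p b, ℓ σ p b ∈ tys U) {M : Str RelSym X}
    {Z : X → Ty → Prop} {α : Ty} (hα : α ∈ tys U)
    (hfree : ∀ P, Free w U Q ℓ α P → ∃ e, Tr (LM Q M Z) P e) {τ : Ty} {ps : List Pt}
    (hps : ∀ p ∈ ps, p ∈ τ) (hτ : Reach w ℓ α τ) {e : X} (he : Z e τ)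
    (hZ : ∀ p ∈ τ, Tr (LM Q M Z) (LL w U Q ℓ τ p 0) e) :
    ∃ f : ℕ → X, f 0 = e ∧ (∀ a ∈ (Nd.st τ ps).bag, a.1 ∈ Q → mapA f a ∈ M) ∧
      ∀ b < w, ∃ τ' ps', (Nd.st τ ps).chd ℓ b = .st τ' ps' ∧ (∀ p ∈ ps', p ∈ τ') ∧
        Reach w ℓ α τ' ∧ Z (f b) τ' := by
  rcases ps with _ | ⟨p, ps⟩
  · exact ⟨fun _ => e, rfl, fun a ha => (List.not_mem_nil ha).elim, fun b _ =>
      ⟨τ, [], rfl, by simp, hτ, he⟩⟩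
  · have hp := hps p (by simp)
    have hτ' := hτ.mem_tys hℓ hα
    obtain ⟨f, rfl, hf, hf'⟩ := exists_assign hU hℓ hτ' (mem_tys hτ' hp) (hZ p hp)
      fun y hy => hfree _ ⟨τ, hτ, p, hp, y, hy, rfl⟩
    refine ⟨f, rfl, hf, fun b hb => ?_⟩
    have hr := hτ.step hp hb
    have hz := hf' b hb
    by_cases h0 : b = 0
    · subst h0
      exact ⟨τ, ps, by simp [Nd.chd], fun p hp => hps p (by simp [hp]), hτ, by
        simpa [labt] using hz⟩
    · simp only [labt, if_neg h0] at hr hz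
      exact ⟨_, _, by simp only [Nd.chd, if_neg h0], fun _ h => h, hr, hz⟩

theorem exists_hom_of_sim (hU : Uni w U) (hℓ : ∀ σ p b, ℓ σ p b ∈ tys U) {M : Str RelSym X}
    {Z : X → Ty → Prop} (hZ : Sim w U Q ℓ M Z) {α : Ty} {d : X} (hd : Z d α)
    (hfree : ∀ P, Free w U Q ℓ α P → ∃ e, Tr (LM Q M Z) P e) :
    ∃ G : List ℕ → X, G [] = d ∧
      ∀ φ ∈ (Nd.coalg ℓ).Unf w (.st α α), φ.1 ∈ Q → mapA G φ ∈ M := by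
  obtain ⟨G, h0, hG, -⟩ := Coalg.exists_map (K := Nd.coalg ℓ) (w := w)
    (M := {φ | φ.1 ∈ Q → φ ∈ M})
    (fun s e => ∃ τ ps, s = .st τ ps ∧ (∀ p ∈ ps, p ∈ τ) ∧ Reach w ℓ α τ ∧ Z e τ)
    (by
      rintro _ e ⟨τ, ps, rfl, hps, hτ, he⟩
      exact exists_assign_node hU hℓ (hZ _ _ hd).1 hfree hps hτ he (hZ _ _ he).2)
    (s := .st α α) (e := d) ⟨α, α, rfl, fun _ h => h, .base, hd⟩
  exact ⟨G, h0, hG⟩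

/-- Cutting a coalgebra at a given depth. -/
def Coalg.cut {ρ S : Type} (K : Coalg ρ S) : Coalg ρ (ℕ × S) where
  bag s := if s.1 = 0 then [] else K.bag s.2
  ch s b := (s.1 - 1, K.ch s.2 b)

theorem Coalg.cut_subset {ρ S : Type} {K : Coalg ρ S} {n : ℕ} {s : S} :
    K.UnfN w n s ⊆ K.cut.Unf w (n, s) := by
  induction n generalizing s with
  | zero => exact Set.empty_subset _
  | succ n ih =>
    rintro φ (⟨a, ha, rfl⟩ | ⟨b, hb, ψ, hψ, rfl⟩)
    · exact Coalg.bag_mem_Unf (K := K.cut) (by simpa [Coalg.cut] using ha)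
    · exact Coalg.ch_mem_Unf (K := K.cut) hb (ih hψ)

theorem exists_hom_of_zs (hU : Uni w U) (hℓ : ∀ σ p b, ℓ σ p b ∈ tys U) {M : Str RelSym X}
    {α : Ty} {d : X} {n : ℕ} (hd : Zs w U Q ℓ M n d α)
    (hfree : ∀ P, Free w U Q ℓ α P → ∃ e, Tr (LM Q M (Zs w U Q ℓ M n)) P e) :
    ∃ G : List ℕ → X, G [] = d ∧
      ∀ φ ∈ (Nd.coalg ℓ).UnfN w n (.st α α), φ.1 ∈ Q → mapA G φ ∈ M := by
  obtain ⟨G, h0, hG, -⟩ := Coalg.exists_map (K := (Nd.coalg ℓ).cut) (w := w)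
    (M := {φ | φ.1 ∈ Q → φ ∈ M})
    (fun s e => s.1 ≤ n ∧ ∃ τ ps, s.2 = .st τ ps ∧ (∀ p ∈ ps, p ∈ τ) ∧ Reach w ℓ α τ ∧
      Zs w U Q ℓ M s.1 e τ)
    (by
      rintro ⟨k, s⟩ e ⟨hk, τ, ps, hs, hps, hτ, he⟩
      dsimp only at hs hk he
      subst hs
      rcases k with _ | k
      · have hα := Zs_tys hd
        have hch : ∀ b, ∃ τ' ps', (Nd.st τ ps).chd ℓ b = .st τ' ps' ∧ (b < w →
            (∀ p ∈ ps', p ∈ τ') ∧ Reach w ℓ α τ') := fun b => by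
          rcases ps with _ | ⟨p, ps⟩
          · exact ⟨τ, [], rfl, fun _ => ⟨by simp, hτ⟩⟩
          · by_cases h0 : b = 0
            · exact ⟨τ, ps, by simp [Nd.chd, h0], fun _ => ⟨fun p hp => hps p (by simp [hp]), hτ⟩⟩
            · refine ⟨ℓ τ p b, ℓ τ p b, by simp [Nd.chd, h0], fun hb => ⟨fun _ h => h, ?_⟩⟩
              have := hτ.step (hps p (by simp)) hb
              rwa [labt, if_neg h0] at this
        refine ⟨fun _ => e, rfl, fun a ha => by simp [Coalg.cut] at ha, fun b hb => ?_⟩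
        obtain ⟨τ', ps', h1, h2⟩ := hch b
        exact ⟨by simp [Coalg.cut], τ', ps', h1, (h2 hb).1, (h2 hb).2, (h2 hb).2.mem_tys hℓ hα⟩
      · obtain ⟨f, h0, hf, hf'⟩ := exists_assign_node hU hℓ (Zs_tys hd)
          (fun P hP => (hfree P hP).imp fun e h => h.mono (LM_mono (Zs_anti (by omega : k ≤ n))))
          hps hτ (Zs_succ _ _ _ he) he.2
        exact ⟨f, h0, fun a ha hQ => hf a (by simpa [Coalg.cut, Nd.coalg] using ha) hQ, fun b hb =>
          ⟨by simp only [Coalg.cut]; omega, hf' b hb⟩⟩)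
    (s := (n, .st α α)) (e := d) ⟨le_rfl, α, α, rfl, fun _ h => h, .base, hd⟩
  exact ⟨G, h0, fun φ hφ => hG φ (Coalg.cut_subset hφ)⟩

end Sims

end

/-! ### Decomposition of truth in unfoldings -/

section Decompose

variable {ρ X S : Type} {w : ℕ} {V : Pat ρ} {K : Coalg ρ S}

/-- Truth at the root of an unfolding. -/
theorem comb_of_tr_unf (hV : Uni w V) {s : S} (hlt : ∀ a ∈ K.bag s, ∀ i ∈ a.2, i < w) {q : Pat ρ}
    (hq : ∀ a ∈ q, a ∈ V) (h : Tr (K.Unf w s) q []) :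
    comb w (K.bag s) (fun b P => P ∈ V.sublists ∧ (Conn q → Conn P) ∧
      Tr (K.Unf w (K.ch s b)) P []) 0 q := by
  have hlo : ∀ b x, b < w → (if (sh b x).headI < w then (sh b x).headI else 0) = b :=
    fun b x hb => by simp [headI_sh, hb]
  have := comb_complete hV (N := K.Unf w s) (B := K.bag s)
    (Nb := fun b => img (sh b) (K.Unf w (K.ch s b)))
    (fun x => if x.headI < w then x.headI else 0) (fun b => sh b [])
    (fun x => by split <;> [assumption; exact hV.pos]) ?_ (b0 := 0) (hlo 0 [] hV.pos) (q := q)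
    hq (by rwa [sh_zero_nil])
  · exact comb_mono (fun _ h => h) (fun b hb P hP =>
      ⟨hP.1, hP.2.1, hP.2.2.of_img (sh_injective b)⟩) this
  · intro φ hφ
    rcases Coalg.mem_Unf.1 hφ with ⟨a, ha, rfl⟩ | ⟨b, hb, ψ, hψ, rfl⟩
    · refine Or.inl ⟨fun x hx => ?_, ?_⟩
      · obtain ⟨i, hi, rfl⟩ := mem_mapA.1 hx
        simp only [hlo i [] (hlt a ha i hi)]
      · rw [mapA_mapA, mapA_eq_self fun i hi => hlo i [] (hlt a ha i hi)]
        exact ha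
    · refine Or.inr ⟨b, hb, fun x hx => ?_, ψ, hψ, rfl⟩
      obtain ⟨i, hi, rfl⟩ := mem_mapA.1 hx
      exact hlo b i hb

/-- `J` meets the unfolding of `s`, embedded by `ι`, only in the root. -/
def Meets (w : ℕ) (K : Coalg ρ S) (J : Str ρ X) (s : S) (ι : List ℕ → X) : Prop :=
  Function.Injective ι ∧ ∀ φ ∈ J, φ ∈ img ι (K.Unf w s) ∨ ∀ x, x ≠ [] → ι x ∉ φ.2

theorem sh_ne_nil {b : ℕ} {x : List ℕ} (h : x ≠ []) : sh b x ≠ [] := by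
  unfold sh
  split <;> simp_all

theorem Meets.ch {J : Str ρ X} {s : S} {ι : List ℕ → X} (h : Meets w K J s ι) (b : ℕ) :
    Meets w K J (K.ch s b) (fun x => ι (sh b x)) := by
  refine ⟨h.1.comp (sh_injective b), fun φ hφ => ?_⟩
  rcases h.2 φ hφ with ⟨ψ, hψ, rfl⟩ | h
  · rcases Coalg.mem_Unf.1 hψ with ⟨a, ha, rfl⟩ | ⟨b', hb', χ, hχ, rfl⟩
    · refine Or.inr fun x hx hmem => ?_
      rw [mapA_mapA] at hmem
      obtain ⟨i, hi, h'⟩ := mem_mapA.1 hmem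
      exact hx (sh_eq_sh (h.1 h')).2.symm
    · by_cases hbb : b' = b
      · subst hbb
        exact Or.inl ⟨χ, hχ, by rw [mapA_mapA]⟩
      · refine Or.inr fun x hx hmem => ?_
        rw [mapA_mapA] at hmem
        obtain ⟨i, hi, h'⟩ := mem_mapA.1 hmem
        exact hbb (sh_eq_sh (h.1 h')).1
  · exact Or.inr fun x hx => h _ (sh_ne_nil hx)

open Classical in
/-- Truth at an element of the root bag of an embedded unfolding. -/
theorem comb_of_tr_meets (hV : Uni w V) {J : Str ρ X} {s : S} {ι : List ℕ → X}
    (hM : Meets w K J s ι) (hlt : ∀ a ∈ K.bag s, ∀ i ∈ a.2, i < w) {b : ℕ} (hbw : b < w)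
    {q : Pat ρ} (hq : ∀ a ∈ q, a ∈ V) (hT : Tr J q (ι (sh b []))) :
    comb w (K.bag s) (fun b P => P ∈ V.sublists ∧ (Conn q → Conn P) ∧
      if b = 0 then Tr J P (ι []) else Tr (K.Unf w (K.ch s b)) P []) b q := by
  have hι := hM.1
  set lo : X → ℕ := fun y => if h : ∃ x, ι x = y ∧ x.headI < w then h.choose.headI else 0 with hlo
  have hlo1 : ∀ b x, b < w → lo (ι (sh b x)) = b := fun b x hb => by
    have hex : ∃ z, ι z = ι (sh b x) ∧ z.headI < w := ⟨_, rfl, by rwa [headI_sh]⟩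
    simp only [hlo, dif_pos hex, hι hex.choose_spec.1, headI_sh]
  refine comb_mono (fun _ h => h) ?_ (comb_complete hV (N := J) (B := K.bag s)
    (Nb := fun b => if b = 0 then J else img (fun x => ι (sh b x)) (K.Unf w (K.ch s b)))
    lo (fun b => ι (sh b [])) ?_ ?_ (b0 := b) (hlo1 b [] hbw) hq hT)
  · rintro b' hb' P ⟨hP1, hP2, hP3⟩
    refine ⟨hP1, hP2, ?_⟩
    by_cases h0 : b' = 0
    · subst h0
      simpa only [if_true, sh_zero_nil] using hP3
    · simp only [if_neg h0] at hP3 ⊢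
      exact hP3.of_img (hι.comp (sh_injective b'))
  · intro y
    simp only [hlo]
    split
    · rename_i h
      exact h.choose_spec.2
    · exact hV.pos
  · intro φ hφ
    have hout : ∀ h : (∀ x, x ≠ [] → ι x ∉ φ.2), ∀ y ∈ φ.2, lo y = 0 := fun h y hy => by
      simp only [hlo]
      split
      · rename_i hex
        have := hex.choose_spec.1
        by_cases hn : hex.choose = []
        · rw [hn]
          rfl
        · exact (h _ hn (by rwa [this])).elim
      · rfl
    rcases hM.2 φ hφ with ⟨ψ, hψ, rfl⟩ | h
    · rcases Coalg.mem_Unf.1 hψ with ⟨a, ha, rfl⟩ | ⟨b', hb', χ, hχ, rfl⟩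
      · rw [mapA_mapA]
        refine Or.inl ⟨fun x hx => ?_, ?_⟩
        · obtain ⟨i, hi, rfl⟩ := mem_mapA.1 hx
          simp only [hlo1 i [] (hlt a ha i hi)]
        · rw [mapA_mapA, mapA_eq_self fun i hi => hlo1 i [] (hlt a ha i hi)]
          exact ha
      · rw [mapA_mapA]
        refine Or.inr ⟨b', hb', fun x hx => ?_, ?_⟩
        · obtain ⟨i, hi, rfl⟩ := mem_mapA.1 hx
          exact hlo1 b' i hb'
        · split
          · rwa [mapA_mapA] at hφ
          · exact ⟨χ, hχ, rfl⟩
    · exact Or.inr ⟨0, hV.pos, hout h, by simpa using hφ⟩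

end Decompose

/-! ### Annotations of trees by labelled patterns -/

/-- Patterns claimed to hold at a node, and those claimed to hold within its subtree. -/
abbrev Info := List LPt × List LPt

open Classical in
/-- Connected labelled patterns. -/
noncomputable def LC (w : ℕ) (U : Pt) (Q : List RelSym) : List LPt :=
  (LA w U Q).sublists.filter fun q => Conn q

noncomputable def infos (w : ℕ) (U : Pt) (Q : List RelSym) : List Info :=
  (LC w U Q).sublists.product (LC w U Q).sublists

def lbl (τ : Ty) : At Lab := (Sum.inr τ, [0])

open Classical in
/-- The labelled bag. -/
noncomputable def bagL (U : Pt) (Q : List RelSym) (B : Pt) (Θ : List LPt) : LPt :=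
  (B.filter fun a => a.1 ∈ Q).map (fun a => (Sum.inl a.1, a.2)) ++
    ((tys U).filter fun τ => [lbl τ] ∈ Θ).map lbl

/-- The annotations `J` at the elements of a bag `B` justify the annotation `I`. -/
structure Step (w : ℕ) (U : Pt) (Q : List RelSym) (B : Pt) (I : Info) (J : ℕ → Info) : Prop where
  zero : (J 0).1 = I.1
  pos : ∀ q ∈ I.2, comb w (bagL U Q B I.1) (fun b P => P ∈ (J b).2) 0 q
  top : ∀ b < w, b ≠ 0 → ∀ q ∈ (J b).1,
    comb w (bagL U Q B I.1) (fun b P => P ∈ if b = 0 then I.1 else (J b).2) b q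

/-- Local conditions on annotations. -/
structure Loc (w : ℕ) (U : Pt) (Q : List RelSym) (ℓ : Ty → Pt → ℕ → Ty) (t : Nd) (I : Info) :
    Prop where
  mem : I ∈ infos w U Q
  ok : ∀ τ ∈ tys U, [lbl τ] ∈ I.1 → ∀ p ∈ τ, LL w U Q ℓ τ p 0 ∈ I.1
  leaf : t.IsLeaf → ∀ q ∈ I.2, ∀ a ∈ q, ∃ τ ∈ tys U, a = lbl τ ∧ [a] ∈ I.1

/-- Annotations extending to the whole unfolding; `ℓ` governs the trees, `ℓ'` the labels. -/
def Ann (w : ℕ) (U : Pt) (Q : List RelSym) (ℓ ℓ' : Ty → Pt → ℕ → Ty) (t : Nd) (I : Info) : Prop :=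
  ∃ R : Nd → Info → Prop, (∀ t I, R t I → Loc w U Q ℓ' t I ∧
    ∃ J, Step w U Q t.bag I J ∧ ∀ b < w, R (t.chd ℓ b) (J b)) ∧ R t I

/-- Annotations with `X` at some node of depth `n`. -/
inductive AnnX (w : ℕ) (U : Pt) (Q : List RelSym) (ℓ ℓ' : Ty → Pt → ℕ → Ty) (X : LPt) :
    ℕ → Nd → Info → Prop
  | here {t : Nd} {I : Info} : Ann w U Q ℓ ℓ' t I → X ∈ I.1 → AnnX w U Q ℓ ℓ' X 0 t I
  | step {n : ℕ} {t : Nd} {I : Info} {J : ℕ → Info} {b : ℕ} : ¬ t.IsLeaf → Loc w U Q ℓ' t I →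
    Step w U Q t.bag I J → (∀ b < w, Ann w U Q ℓ ℓ' (t.chd ℓ b) (J b)) → b < w →
    AnnX w U Q ℓ ℓ' X n (t.chd ℓ b) (J b) → AnnX w U Q ℓ ℓ' X (n + 1) t I

section Basic

variable {w : ℕ} {U : Pt} {Q : List RelSym} {ℓ ℓ' : Ty → Pt → ℕ → Ty}

theorem mem_LC {q : LPt} : q ∈ LC w U Q ↔ q ∈ (LA w U Q).sublists ∧ Conn q := by
  simp [LC, List.mem_filter]

theorem mem_infos {I : Info} : I ∈ infos w U Q ↔
    I.1 ∈ (LC w U Q).sublists ∧ I.2 ∈ (LC w U Q).sublists := by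
  obtain ⟨a, b⟩ := I
  exact List.mem_product

theorem mem_bagL {B : Pt} {Θ : List LPt} {a : At Lab} : a ∈ bagL U Q B Θ ↔
    (∃ b ∈ B, b.1 ∈ Q ∧ (Sum.inl b.1, b.2) = a) ∨ ∃ τ ∈ tys U, [lbl τ] ∈ Θ ∧ lbl τ = a := by
  simp [bagL, List.mem_filter, and_assoc]

theorem Ann.unfold {t : Nd} {I : Info} (h : Ann w U Q ℓ ℓ' t I) : Loc w U Q ℓ' t I ∧
    ∃ J, Step w U Q t.bag I J ∧ ∀ b < w, Ann w U Q ℓ ℓ' (t.chd ℓ b) (J b) := by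
  obtain ⟨R, hR, h⟩ := h
  obtain ⟨h1, J, h2, h3⟩ := hR t I h
  exact ⟨h1, J, h2, fun b hb => ⟨R, hR, h3 b hb⟩⟩

theorem Ann.fold {t : Nd} {I : Info} (hl : Loc w U Q ℓ' t I) {J : ℕ → Info}
    (hs : Step w U Q t.bag I J) (hJ : ∀ b < w, Ann w U Q ℓ ℓ' (t.chd ℓ b) (J b)) :
    Ann w U Q ℓ ℓ' t I := by
  refine ⟨fun t' I' => (t' = t ∧ I' = I) ∨ Ann w U Q ℓ ℓ' t' I', ?_, Or.inl ⟨rfl, rfl⟩⟩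
  rintro t' I' (⟨rfl, rfl⟩ | h)
  · exact ⟨hl, J, hs, fun b hb => Or.inr (hJ b hb)⟩
  · obtain ⟨h1, J', h2, h3⟩ := h.unfold
    exact ⟨h1, J', h2, fun b hb => Or.inr (h3 b hb)⟩

theorem AnnX.ann {X : LPt} {n : ℕ} {t : Nd} {I : Info} (h : AnnX w U Q ℓ ℓ' X n t I) :
    Ann w U Q ℓ ℓ' t I := by
  cases h with
  | here h _ => exact h
  | step _ hl hs hJ _ _ => exact Ann.fold hl hs hJ

theorem lbl_mem_LC (hw : 0 < w) {τ : Ty} (hτ : τ ∈ tys U) : [lbl τ] ∈ LC w U Q := by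
  refine mem_LC.2 ⟨?_, ?_⟩
  · refine List.mem_sublists.2 (List.singleton_sublist.2 (mem_LA.2 (Or.inr ⟨τ, hτ, 0, hw, rfl⟩)))
  · intro V h0 _ a ha i hi
    simp only [List.mem_singleton] at ha
    subst ha
    simp only [lbl, List.mem_singleton] at hi
    rwa [hi]

end Basic

section Complete

variable {w : ℕ} {U : Pt} {Q : List RelSym} {ℓ ℓ' : Ty → Pt → ℕ → Ty} {M : Str RelSym (List ℕ)}
  {Z : List ℕ → Ty → Prop}

open Classical in
/-- Trees with labels. -/
noncomputable def labCoalg (U : Pt) (Q : List RelSym) (ℓ : Ty → Pt → ℕ → Ty)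
    (Z : List ℕ → Ty → Prop) : Coalg Lab (Nd × (List ℕ → List ℕ)) where
  bag s := (s.1.bag.filter fun a => a.1 ∈ Q).map (fun a => (Sum.inl a.1, a.2)) ++
    ((tys U).filter fun τ => Z (s.2 []) τ).map lbl
  ch s b := (s.1.chd ℓ b, fun x => s.2 (sh b x))

theorem mem_lab_bag {s : Nd × (List ℕ → List ℕ)} {a : At Lab} :
    a ∈ (labCoalg U Q ℓ Z).bag s ↔ (∃ b ∈ s.1.bag, b.1 ∈ Q ∧ (Sum.inl b.1, b.2) = a) ∨
      ∃ τ ∈ tys U, Z (s.2 []) τ ∧ lbl τ = a := by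
  simp only [labCoalg, List.mem_append, List.mem_map, List.mem_filter, decide_eq_true_eq, and_assoc]

theorem inl_mem_lab {t : Nd} {ι : List ℕ → List ℕ} {φ} (hφ : φ ∈ (Nd.coalg ℓ).Unf w t)
    (hQ : φ.1 ∈ Q) : (Sum.inl φ.1, φ.2) ∈ (labCoalg U Q ℓ Z).Unf w (t, ι) := by
  obtain ⟨n, hn⟩ := hφ
  induction n generalizing t ι φ with
  | zero => exact hn.elim
  | succ n ih =>
    rcases hn with ⟨a, ha, rfl⟩ | ⟨b, hb, ψ, hψ, rfl⟩
    · exact Coalg.bag_mem_Unf (K := labCoalg U Q ℓ Z) (s := (t, ι))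
        (mem_lab_bag.2 (Or.inl ⟨a, ha, hQ, rfl⟩))
    · exact Coalg.ch_mem_Unf (K := labCoalg U Q ℓ Z) (s := (t, ι)) hb
        (ih (t := t.chd ℓ b) (φ := ψ) hQ hψ)

theorem inr_mem_lab {t : Nd} {ι : List ℕ → List ℕ} (x : List ℕ) (hx : ∀ i ∈ x, i < w) {τ : Ty}
    (hτ : τ ∈ tys U) (h : Z (ι (norm x)) τ) :
    (Sum.inr τ, [norm x]) ∈ (labCoalg U Q ℓ Z).Unf w (t, ι) := by
  induction x generalizing t ι with
  | nil =>
    exact Coalg.bag_mem_Unf (K := labCoalg U Q ℓ Z) (s := (t, ι))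
      (mem_lab_bag.2 (Or.inr ⟨τ, hτ, h, rfl⟩))
  | cons b x ih =>
    exact Coalg.ch_mem_Unf (K := labCoalg U Q ℓ Z) (s := (t, ι)) (hx b (by simp))
      (ih (fun i hi => hx i (by simp [hi])) h)

theorem lab_leaf {t : Nd} (ht : t.IsLeaf) {ι : List ℕ → List ℕ} {φ}
    (hφ : φ ∈ (labCoalg U Q ℓ Z).Unf w (t, ι)) :
    ∃ τ ∈ tys U, ∃ x, Z (ι x) τ ∧ φ = (Sum.inr τ, [x]) := by
  obtain ⟨n, hn⟩ := hφ
  rcases t with ⟨σ, ps⟩ | ⟨B, ch⟩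
  · have : ps = [] := ht
    subst this
    induction n generalizing ι φ with
    | zero => exact hn.elim
    | succ n ih =>
      rcases hn with ⟨a, ha, rfl⟩ | ⟨b, hb, ψ, hψ, rfl⟩
      · rcases mem_lab_bag.1 ha with ⟨a', h, -⟩ | ⟨τ, hτ, h, rfl⟩
        · cases h
        · exact ⟨τ, hτ, [], h, rfl⟩
      · obtain ⟨τ, hτ, x, h, rfl⟩ := ih hψ
        exact ⟨τ, hτ, sh b x, h, rfl⟩
  · exact ht.elim

open Classical in
/-- The annotation given by truth. -/
noncomputable def trueInfo (w : ℕ) (U : Pt) (Q : List RelSym) (ℓ : Ty → Pt → ℕ → Ty)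
    (M : Str RelSym (List ℕ)) (Z : List ℕ → Ty → Prop) (t : Nd) (ι : List ℕ → List ℕ) : Info :=
  ((LC w U Q).filter fun q => Tr (LM Q M Z) q (ι []),
    (LC w U Q).filter fun q => Tr ((labCoalg U Q ℓ Z).Unf w (t, ι)) q [])

theorem mem_trueInfo_fst {t : Nd} {ι : List ℕ → List ℕ} {q : LPt} :
    q ∈ (trueInfo w U Q ℓ M Z t ι).1 ↔ q ∈ LC w U Q ∧ Tr (LM Q M Z) q (ι []) := by
  simp [trueInfo, List.mem_filter]

theorem mem_trueInfo_snd {t : Nd} {ι : List ℕ → List ℕ} {q : LPt} :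
    q ∈ (trueInfo w U Q ℓ M Z t ι).2 ↔
      q ∈ LC w U Q ∧ Tr ((labCoalg U Q ℓ Z).Unf w (t, ι)) q [] := by
  simp [trueInfo, List.mem_filter]

variable {Ts : List (Pt × Pt)} {c : Ty → Ty} (hS : Sys w U Ts c ℓ) (hU : Uni w U)
  (hZ : Sim w U Q ℓ' M Z)
include hU

theorem mem_lab_bagL {t : Nd} {ι : List ℕ → List ℕ} {a : At Lab}
    (ha : a ∈ (labCoalg U Q ℓ Z).bag (t, ι)) :
    a ∈ bagL U Q t.bag (trueInfo w U Q ℓ M Z t ι).1 := by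
  rcases mem_lab_bag.1 ha with h | ⟨τ, hτ, h, rfl⟩
  · exact mem_bagL.2 (Or.inl h)
  · refine mem_bagL.2 (Or.inr ⟨τ, hτ, mem_trueInfo_fst.2 ⟨lbl_mem_LC hU.pos hτ, fun _ => ι [], rfl,
      fun a ha => ?_⟩, rfl⟩)
    rw [List.mem_singleton.1 ha]
    exact inr_mem_LM.2 h

include hZ

theorem loc_trueInfo {t : Nd} {ι : List ℕ → List ℕ} :
    Loc w U Q ℓ' t (trueInfo w U Q ℓ M Z t ι) where
  mem := mem_infos.2 ⟨List.mem_sublists.2 List.filter_sublist,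
    List.mem_sublists.2 List.filter_sublist⟩
  ok τ hτ h p hp := by
    obtain ⟨f, h0, hf⟩ := (mem_trueInfo_fst.1 h).2
    have hz := hZ (ι []) τ (by
      have := hf (lbl τ) (by simp)
      rw [← h0]
      exact inr_mem_LM.1 this)
    exact mem_trueInfo_fst.2 ⟨mem_LC.2 ⟨LL_mem, LL_conn hU (mem_tys hτ hp) hU.pos⟩, hz.2 p hp⟩
  leaf ht q hq a ha := by
    obtain ⟨hc, f, h0, hf⟩ := mem_trueInfo_snd.1 hq
    obtain ⟨hs, hc⟩ := mem_LC.1 hc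
    have hun : ∀ a ∈ q, ∃ τ ∈ tys U, ∃ i, a = (Sum.inr τ, [i]) ∧ Z (ι (f i)) τ := fun a ha => by
      obtain ⟨τ, hτ, x, hx, h⟩ := lab_leaf ht (hf a ha)
      obtain ⟨r, l⟩ := a
      simp only [mapA, Prod.mk.injEq] at h
      obtain ⟨i, hl, rfl⟩ := List.map_eq_singleton_iff.1 h.2
      exact ⟨τ, hτ, i, by rw [h.1, hl], hx⟩
    have h00 := hc {0} rfl (fun a ha ⟨i, hi, hi0⟩ j hj => by
      obtain ⟨τ, -, k, rfl, -⟩ := hun a ha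
      simp only [List.mem_singleton] at hi hj
      rw [hj, ← hi]
      exact hi0)
    obtain ⟨τ, hτ, i, rfl, hz⟩ := hun a ha
    have hi : i = 0 := h00 _ ha i (by simp)
    subst hi
    rw [h0] at hz
    refine ⟨τ, hτ, rfl, mem_trueInfo_fst.2 ⟨lbl_mem_LC hU.pos hτ, fun _ => ι [], rfl,
      fun a ha => ?_⟩⟩
    rw [List.mem_singleton.1 ha]
    exact inr_mem_LM.2 hz

include hS

omit hZ in
theorem step_trueInfo {t : Nd} (ht : t.Good w U c) {ι : List ℕ → List ℕ}
    (hM : Meets w (labCoalg U Q ℓ Z) (LM Q M Z) (t, ι) ι) :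
    Step w U Q t.bag (trueInfo w U Q ℓ M Z t ι)
      fun b => trueInfo w U Q ℓ M Z (t.chd ℓ b) fun x => ι (sh b x) where
  zero := by
    exact List.filter_congr fun q _ => decide_eq_decide.2 (by simp only [sh_zero_nil])
  pos q hq := by
    obtain ⟨hc, h⟩ := mem_trueInfo_snd.1 hq
    obtain ⟨hs, hc⟩ := mem_LC.1 hc
    refine comb_mono (fun a ha => mem_lab_bagL hU ha) (fun b hb P hP => ?_)
      (comb_of_tr_unf (uni_LA hU) ?_ (fun a ha => (List.mem_sublists.1 hs).subset ha) h)
    · exact mem_trueInfo_snd.2 ⟨mem_LC.2 ⟨hP.1, hP.2.1 hc⟩, hP.2.2⟩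
    · intro a ha i hi
      rcases mem_lab_bag.1 ha with ⟨b, hb, -, rfl⟩ | ⟨τ, -, -, rfl⟩
      · exact good_bag_lt hS hU ht b hb i hi
      · simp only [lbl, List.mem_singleton] at hi
        rw [hi]
        exact hU.pos
  top b hb h0 q hq := by
    obtain ⟨hc, h⟩ := mem_trueInfo_fst.1 hq
    obtain ⟨hs, hc⟩ := mem_LC.1 hc
    refine comb_mono (fun a ha => mem_lab_bagL hU ha) (fun b hb P hP => ?_)
      (comb_of_tr_meets (uni_LA hU) hM ?_ hb (fun a ha => (List.mem_sublists.1 hs).subset ha) h)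
    · obtain ⟨h1, h2, h3⟩ := hP
      have hP := mem_LC.2 ⟨h1, h2 hc⟩
      split
      · rename_i h0
        rw [if_pos h0] at h3
        exact mem_trueInfo_fst.2 ⟨hP, h3⟩
      · rename_i h0
        rw [if_neg h0] at h3
        exact mem_trueInfo_snd.2 ⟨hP, h3⟩
    · intro a ha i hi
      rcases mem_lab_bag.1 ha with ⟨b, hb, -, rfl⟩ | ⟨τ, -, -, rfl⟩
      · exact good_bag_lt hS hU ht b hb i hi
      · simp only [lbl, List.mem_singleton] at hi
        rw [hi]
        exact hU.pos

theorem ann_trueInfo {t : Nd} (ht : t.Good w U c) {ι : List ℕ → List ℕ}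
    (hM : Meets w (labCoalg U Q ℓ Z) (LM Q M Z) (t, ι) ι) :
    Ann w U Q ℓ ℓ' t (trueInfo w U Q ℓ M Z t ι) := by
  refine ⟨fun t I => ∃ ι, t.Good w U c ∧ Meets w (labCoalg U Q ℓ Z) (LM Q M Z) (t, ι) ι ∧
    I = trueInfo w U Q ℓ M Z t ι, ?_, ι, ht, hM, rfl⟩
  rintro t _ ⟨ι, ht, hM, rfl⟩
  exact ⟨loc_trueInfo hU hZ, _, step_trueInfo hS hU ht hM,
    fun b hb => ⟨_, good_chd hS ht hb, hM.ch b, rfl⟩⟩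

end Complete

/-! ### Soundness of annotations -/

/-- The number of distinct atoms. -/
noncomputable def cd (q : LPt) : ℕ := by
  classical exact q.toFinset.card

/-- The number of nonzero letters. -/
def nz (π : List ℕ) : ℕ := (π.filter (· ≠ 0)).length

theorem nz_append (π : List ℕ) (b : ℕ) : nz (π ++ [b]) = nz π + if b = 0 then 0 else 1 := by
  by_cases h : b = 0 <;> simp [nz, List.filter_append, h]

theorem norm_append_zero (π : List ℕ) : norm (π ++ [0]) = norm π := by
  simp [norm, sh_zero_nil]

/-- The number of steps to the leaf along zeros. -/
def Nd.rk : Nd → ℕ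
  | .st _ ps => ps.length
  | .dn _ ch => (ch 0).rk + 1

theorem Nd.rk_chd {ℓ : Ty → Pt → ℕ → Ty} {t : Nd} (h : ¬ t.IsLeaf) :
    (t.chd ℓ 0).rk < t.rk := by
  rcases t with ⟨σ, _ | ⟨p, ps⟩⟩ | ⟨B, ch⟩
  · exact (h rfl).elim
  · simp [Nd.chd, Nd.rk]
  · simp [Nd.chd, Nd.rk]

theorem comb_card {w : ℕ} {B : LPt} {θ : ℕ → LPt → Prop} {b0 : ℕ} {q : LPt} (hq : q ≠ [])
    (hc : Conn q) (hne : ∀ a ∈ q, a.2 ≠ []) (h : comb w B θ b0 q) :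
    comb w B (fun b P => θ b P ∧ cd P ≤ cd q ∧ (b ≠ b0 → cd P < cd q)) b0 q := by
  classical
  obtain ⟨loc, ex, P, h1, h2, h3, h4, h5⟩ := h
  refine ⟨loc, ex, P, h1, h2, h3, h4, fun a ha => ?_⟩
  rcases h5 a ha with h | ⟨b, hb, h6, h7, h8⟩
  · exact Or.inl h
  refine Or.inr ⟨b, hb, h6, ⟨h7, ?_, fun hbb => ?_⟩, h8⟩
  · refine le_trans (Finset.card_le_card (t := q.toFinset.image (mapA (rx ex))) fun a' ha' => ?_)
      Finset.card_image_le
    obtain ⟨a, ha, -, rfl⟩ := h4 b a' (List.mem_toFinset.1 ha')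
    exact Finset.mem_image_of_mem _ (List.mem_toFinset.2 ha)
  · obtain ⟨a0, ha0, h0⟩ : ∃ a ∈ q, 0 ∈ a.2 := by
      by_contra! hno
      obtain ⟨a, ha⟩ := List.exists_mem_of_ne_nil q hq
      obtain ⟨i, hi⟩ := List.exists_mem_of_ne_nil _ (hne a ha)
      have := hc {0} rfl (fun a ha ⟨i, hi, hi0⟩ => (hno a ha (by
        rw [Set.mem_singleton_iff] at hi0
        rwa [hi0] at hi)).elim) a ha i hi
      rw [Set.mem_singleton_iff] at this
      rw [this] at hi
      exact hno a ha hi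
    refine lt_of_le_of_lt (Finset.card_le_card
      (t := (q.toFinset.erase a0).image (mapA (rx ex))) fun a' ha' => ?_)
      (lt_of_le_of_lt Finset.card_image_le (Finset.card_erase_lt_of_mem (List.mem_toFinset.2 ha0)))
    obtain ⟨a, ha, hl, rfl⟩ := h4 b a' (List.mem_toFinset.1 ha')
    refine Finset.mem_image_of_mem _ (Finset.mem_erase.2 ⟨?_, List.mem_toFinset.2 ha⟩)
    rintro rfl
    exact hbb (by rw [← hl 0 h0, h2])

section Runs

variable {w : ℕ} {U : Pt} {Q : List RelSym} {ℓ ℓ' : Ty → Pt → ℕ → Ty}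

/-- An annotation of all nodes of the unfolding of `t`. -/
structure Run (w : ℕ) (U : Pt) (Q : List RelSym) (ℓ ℓ' : Ty → Pt → ℕ → Ty) (t : Nd)
    (R : List ℕ → Info) : Prop where
  loc : ∀ π : List ℕ, (∀ i ∈ π, i < w) → Loc w U Q ℓ' ((Nd.coalg ℓ).sub t π) (R π)
  step : ∀ π : List ℕ, (∀ i ∈ π, i < w) →
    Step w U Q ((Nd.coalg ℓ).sub t π).bag (R π) fun b => R (π ++ [b])

theorem Coalg.sub_append {ρ S : Type} (K : Coalg ρ S) (s : S) (π : List ℕ) (b : ℕ) :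
    K.sub s (π ++ [b]) = K.ch (K.sub s π) b := by
  simp [Coalg.sub]

theorem Ann.exists_run {t : Nd} {I : Info} (h : Ann w U Q ℓ ℓ' t I) :
    ∃ R, Run w U Q ℓ ℓ' t R ∧ R [] = I := by
  have hJ : ∀ t I, ∃ J : ℕ → Info, Ann w U Q ℓ ℓ' t I →
      Step w U Q t.bag I J ∧ ∀ b < w, Ann w U Q ℓ ℓ' (t.chd ℓ b) (J b) := fun t I => by
    by_cases h : Ann w U Q ℓ ℓ' t I
    · obtain ⟨-, J, hJ⟩ := h.unfold
      exact ⟨J, fun _ => hJ⟩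
    · exact ⟨fun _ => I, fun h' => (h h').elim⟩
  choose J hJ using hJ
  let go : List ℕ → Nd × Info := fun π =>
    π.foldl (fun y b => (y.1.chd ℓ b, J y.1 y.2 b)) (t, I)
  have happ : ∀ π b, go (π ++ [b]) = ((go π).1.chd ℓ b, J (go π).1 (go π).2 b) := fun π b => by
    simp [go]
  have hgo : ∀ π : List ℕ, (∀ i ∈ π, i < w) →
      (go π).1 = (Nd.coalg ℓ).sub t π ∧ Ann w U Q ℓ ℓ' (go π).1 (go π).2 := by
    intro π
    induction π using List.reverseRecOn with
    | nil => exact fun _ => ⟨rfl, h⟩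
    | append_singleton π b ih =>
      intro hπ
      obtain ⟨h1, h2⟩ := ih fun i hi => hπ i (by simp [hi])
      rw [happ, Coalg.sub_append, ← h1]
      exact ⟨rfl, (hJ _ _ h2).2 b (hπ b (by simp))⟩
  refine ⟨fun π => (go π).2, ⟨fun π hπ => ?_, fun π hπ => ?_⟩, rfl⟩
  · rw [← (hgo π hπ).1]
    exact (hgo π hπ).2.unfold.1
  · simp only [happ]
    rw [← (hgo π hπ).1]
    exact (hJ _ _ (hgo π hπ).2).1

theorem Run.cons {t : Nd} {I : Info} {J : ℕ → Info} {Rs : ℕ → List ℕ → Info}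
    (hl : Loc w U Q ℓ' t I) (hs : Step w U Q t.bag I J) (hJ : ∀ b, Rs b [] = J b)
    (hR : ∀ b < w, Run w U Q ℓ ℓ' (t.chd ℓ b) (Rs b)) :
    Run w U Q ℓ ℓ' t fun π => match π with | [] => I | b :: π => Rs b π where
  loc π hπ := by
    rcases π with _ | ⟨b, π⟩
    · exact hl
    · exact (hR b (hπ b (by simp))).loc π fun i hi => hπ i (by simp [hi])
  step π hπ := by
    rcases π with _ | ⟨b, π⟩
    · simp only [List.nil_append, hJ]
      exact hs
    · exact (hR b (hπ b (by simp))).step π fun i hi => hπ i (by simp [hi])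

/-- Paths through inner nodes. -/
def NL (w : ℕ) (ℓ : Ty → Pt → ℕ → Ty) : Nd → List ℕ → Prop
  | _, [] => True
  | t, b :: π => ¬ t.IsLeaf ∧ b < w ∧ NL w ℓ (t.chd ℓ b) π

theorem NL.lt {t : Nd} {π : List ℕ} (h : NL w ℓ t π) : ∀ i ∈ π, i < w := by
  induction π generalizing t with
  | nil => simp
  | cons b π ih =>
    intro i hi
    rcases List.mem_cons.1 hi with rfl | hi
    · exact h.2.1
    · exact ih h.2.2 i hi

theorem AnnX.exists_run {X : LPt} {n : ℕ} {t : Nd} {I : Info} (h : AnnX w U Q ℓ ℓ' X n t I) :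
    ∃ R, Run w U Q ℓ ℓ' t R ∧ R [] = I ∧ ∃ π, NL w ℓ t π ∧ π.length = n ∧ X ∈ (R π).1 := by
  induction h with
  | here h hX =>
    obtain ⟨R, hR, rfl⟩ := h.exists_run
    exact ⟨R, hR, rfl, [], trivial, rfl, hX⟩
  | @step n t I J b hl hloc hs hJ hb _ ih =>
    obtain ⟨R, hR, h0, π, hπ, hn, hX⟩ := ih
    have : ∀ b', ∃ R', R' [] = J b' ∧ (b' < w → Run w U Q ℓ ℓ' (t.chd ℓ b') R') ∧
        (b' = b → R' = R) := fun b' => by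
      by_cases hbb : b' = b
      · subst hbb
        exact ⟨R, h0, fun _ => hR, fun _ => rfl⟩
      · by_cases hb' : b' < w
        · obtain ⟨R', h1, h2⟩ := (hJ b' hb').exists_run
          exact ⟨R', h2, fun _ => h1, fun h => (hbb h).elim⟩
        · exact ⟨fun _ => J b', rfl, fun h => (hb' h).elim, fun h => (hbb h).elim⟩
    choose Rs h1 h2 h3 using this
    refine ⟨_, Run.cons hloc hs h1 h2, rfl, b :: π, ⟨hl, hb, hπ⟩, by simp [hn], ?_⟩
    change X ∈ (Rs b π).1
    rwa [h3 b rfl]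

/-- The labels given by a run at nodes with at least `k` nonzero letters. -/
def RZ (w : ℕ) (U : Pt) (R : List ℕ → Info) (k : ℕ) (y : List ℕ) (τ : Ty) : Prop :=
  τ ∈ tys U ∧ ∃ π : List ℕ, (∀ i ∈ π, i < w) ∧ norm π = y ∧ k ≤ nz π ∧ [lbl τ] ∈ (R π).1

theorem bag_sub_mem {π : List ℕ} (hπ : ∀ i ∈ π, i < w) {a : At RelSym} {t : Nd}
    (h : a ∈ ((Nd.coalg ℓ).sub t π).bag) :
    mapA (fun b => norm (π ++ [b])) a ∈ (Nd.coalg ℓ).Unf w t := by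
  induction π generalizing t with
  | nil => exact Coalg.bag_mem_Unf (K := Nd.coalg ℓ) h
  | cons c π ih =>
    have := Coalg.ch_mem_Unf (K := Nd.coalg ℓ) (hπ c (by simp))
      (ih (fun i hi => hπ i (by simp [hi])) (t := t.chd ℓ c) h)
    rwa [mapA_mapA] at this

variable {t : Nd} {R : List ℕ → Info}

theorem Run.bag_sound (hR : Run w U Q ℓ ℓ' t R) {k : ℕ} {π : List ℕ} (hπ : ∀ i ∈ π, i < w)
    (hk : k ≤ nz π) : ∀ a ∈ bagL U Q ((Nd.coalg ℓ).sub t π).bag (R π).1,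
      mapA (fun b => norm (π ++ [b])) a ∈ LM Q ((Nd.coalg ℓ).Unf w t) (RZ w U R k) := by
  intro a ha
  rcases mem_bagL.1 ha with ⟨a', ha', hQ, rfl⟩ | ⟨τ, hτ, h, rfl⟩
  · refine inl_mem_LM.2 ⟨?_, hQ⟩
    exact bag_sub_mem hπ ha'
  · refine inr_mem_LM.2 ⟨hτ, π, hπ, ?_, hk, h⟩
    exact (norm_append_zero π).symm

variable (hU : Uni w U)
include hU

theorem Run.mem_snd (hR : Run w U Q ℓ ℓ' t R) {π : List ℕ} (hπ : ∀ i ∈ π, i < w) {q : LPt}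
    (hq : q ∈ (R π).1 ∨ q ∈ (R π).2) : Conn q ∧ (∀ a ∈ q, a.2 ≠ []) ∧ cd q ≤ (LA w U Q).length := by
  have h := mem_infos.1 (hR.loc π hπ).mem
  have hq : q ∈ LC w U Q := by
    rcases hq with hq | hq
    · exact (List.mem_sublists.1 h.1).subset hq
    · exact (List.mem_sublists.1 h.2).subset hq
  obtain ⟨h1, h2⟩ := mem_LC.1 hq
  have h1 := List.mem_sublists.1 h1
  refine ⟨h2, fun a ha => (uni_LA hU).ne a (h1.subset ha), ?_⟩
  classical
  exact (List.toFinset_card_le q).trans h1.length_le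

theorem Run.pos_sound (hR : Run w U Q ℓ ℓ' t R) {k : ℕ} (n m : ℕ) : ∀ (π : List ℕ),
    (∀ i ∈ π, i < w) → k ≤ nz π → ∀ q ∈ (R π).2, cd q ≤ n → ((Nd.coalg ℓ).sub t π).rk ≤ m →
      Tr (LM Q ((Nd.coalg ℓ).Unf w t) (RZ w U R k)) q (norm π) := by
  induction n using Nat.strong_induction_on generalizing m with
  | _ n ihn =>
  induction m using Nat.strong_induction_on with
  | _ m ihm =>
  intro π hπ hk q hq hqn hm
  by_cases hl : ((Nd.coalg ℓ).sub t π).IsLeaf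
  · refine ⟨fun _ => norm π, rfl, fun a ha => ?_⟩
    obtain ⟨τ, hτ, rfl, h⟩ := (hR.loc π hπ).leaf hl q hq a ha
    exact inr_mem_LM.2 ⟨hτ, π, hπ, rfl, hk, h⟩
  by_cases hq0 : q = []
  · subst hq0
    exact ⟨fun _ => norm π, rfl, fun a ha => (List.not_mem_nil ha).elim⟩
  obtain ⟨hc, hne, -⟩ := hR.mem_snd hU hπ (Or.inr hq)
  have := comb_sound (hR.bag_sound hπ hk) (fun b hb P hP => ?_)
    (comb_card hq0 hc hne ((hR.step π hπ).pos q hq))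
  · rwa [norm_append_zero] at this
  · obtain ⟨hP, hle, hlt⟩ := hP
    have hπb : ∀ i ∈ π ++ [b], i < w := fun i hi => by
      rcases List.mem_append.1 hi with hi | hi
      · exact hπ i hi
      · rwa [List.mem_singleton.1 hi]
    have hkb : k ≤ nz (π ++ [b]) := hk.trans (by rw [nz_append]; omega)
    by_cases h0 : b = 0
    · subst h0
      refine ihm _ ?_ _ hπb hkb P hP (hle.trans hqn) le_rfl
      rw [Coalg.sub_append]
      exact (Nd.rk_chd hl).trans_le hm
    · exact ihn _ ((hlt h0).trans_le hqn) _ _ hπb hkb P hP le_rfl le_rfl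

theorem Run.top_sound (hR : Run w U Q ℓ ℓ' t R) {k : ℕ} : ∀ (π : List ℕ), (∀ i ∈ π, i < w) →
    ∀ q ∈ (R π).1, (((∀ q ∈ (R []).1, q ∈ (R []).2) ∧ k = 0) ∨ cd q + k ≤ nz π) →
      Tr (LM Q ((Nd.coalg ℓ).Unf w t) (RZ w U R k)) q (norm π) := by
  intro π
  induction π using List.reverseRecOn with
  | nil =>
    intro hπ q hq h
    by_cases hq0 : q = []
    · subst hq0
      exact ⟨fun _ => norm [], rfl, fun a ha => (List.not_mem_nil ha).elim⟩
    · rcases h with ⟨h, rfl⟩ | h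
      · exact hR.pos_sound hU _ _ [] hπ (Nat.zero_le _) q (h q hq) le_rfl le_rfl
      · simp only [nz, List.filter_nil, List.length_nil, Nat.le_zero, Nat.add_eq_zero_iff] at h
        classical
        have := h.1
        simp only [cd, Finset.card_eq_zero, List.toFinset_eq_empty_iff] at this
        exact (hq0 this).elim
  | append_singleton π b ih =>
    intro hπb q hq h
    have hπ : ∀ i ∈ π, i < w := fun i hi => hπb i (by simp [hi])
    have hb : b < w := hπb b (by simp)
    by_cases h0 : b = 0
    · subst h0
      rw [norm_append_zero]
      rw [nz_append, if_pos rfl] at h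
      have := (hR.step π hπ).zero
      rw [this] at hq
      exact ih hπ q hq h
    by_cases hq0 : q = []
    · subst hq0
      exact ⟨fun _ => norm (π ++ [b]), rfl, fun a ha => (List.not_mem_nil ha).elim⟩
    obtain ⟨hc, hne, -⟩ := hR.mem_snd hU hπb (Or.inl hq)
    have h1 : 1 ≤ cd q := by
      classical
      rw [Nat.one_le_iff_ne_zero]
      simpa only [cd, ne_eq, Finset.card_eq_zero, List.toFinset_eq_empty_iff] using hq0
    rw [nz_append, if_neg h0] at h
    have hk : k ≤ nz π := by
      rcases h with ⟨-, rfl⟩ | h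
      · exact Nat.zero_le _
      · omega
    refine comb_sound (hR.bag_sound hπ hk) (fun b' hb' P hP => ?_)
      (comb_card hq0 hc hne ((hR.step π hπ).top b hb h0 q hq))
    obtain ⟨hP, -, hlt⟩ := hP
    by_cases h0' : b' = 0
    · subst h0'
      rw [if_pos rfl] at hP
      have hlt := hlt (Ne.symm h0)
      rw [norm_append_zero]
      exact ih hπ P hP (h.imp id fun h => by omega)
    · rw [if_neg h0'] at hP
      refine hR.pos_sound hU _ _ _ (fun i hi => ?_) ?_ P hP le_rfl le_rfl
      · rcases List.mem_append.1 hi with hi | hi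
        · exact hπ i hi
        · rwa [List.mem_singleton.1 hi]
      · rw [nz_append]
        omega

theorem Run.sim (hR : Run w U Q ℓ ℓ' t R) (hT : ∀ q ∈ (R []).1, q ∈ (R []).2) :
    Sim w U Q ℓ' ((Nd.coalg ℓ).Unf w t) (RZ w U R 0) := by
  rintro _ τ ⟨hτ, π, hπ, rfl, -, h⟩
  exact ⟨hτ, fun p hp => hR.top_sound hU π hπ _ ((hR.loc π hπ).ok τ hτ h p hp) (Or.inl ⟨hT, rfl⟩)⟩

theorem Run.zs (hR : Run w U Q ℓ ℓ' t R) (m : ℕ) :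
    ∀ y τ, RZ w U R (m * (LA w U Q).length) y τ → Zs w U Q ℓ' ((Nd.coalg ℓ).Unf w t) m y τ := by
  induction m with
  | zero => exact fun y τ h => h.1
  | succ m ih =>
    rintro _ τ ⟨hτ, π, hπ, rfl, hk, h⟩
    refine ⟨hτ, fun p hp => ?_⟩
    have hq := (hR.loc π hπ).ok τ hτ h p hp
    refine (hR.top_sound hU π hπ _ hq (Or.inr ?_)).mono (LM_mono ih)
    have := (hR.mem_snd hU hπ (Or.inl hq)).2.2
    rw [Nat.add_mul, one_mul] at hk
    omega

theorem Run.tr_zs (hR : Run w U Q ℓ ℓ' t R) {m : ℕ} {π : List ℕ} (hπ : ∀ i ∈ π, i < w) {q : LPt}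
    (hq : q ∈ (R π).1) (hm : (m + 1) * (LA w U Q).length ≤ nz π) :
    Tr (LM Q ((Nd.coalg ℓ).Unf w t) (Zs w U Q ℓ' ((Nd.coalg ℓ).Unf w t) m)) q (norm π) := by
  refine (hR.top_sound hU π hπ q hq (Or.inr ?_)).mono (LM_mono (hR.zs hU m))
  have := (hR.mem_snd hU hπ (Or.inl hq)).2.2
  rw [Nat.add_mul, one_mul] at hm
  omega

end Runs

/-! ### Local finiteness and compactness -/

/-- Every element occurs in finitely many facts. -/
def LFin {ρ X : Type} (M : Str ρ X) : Prop := ∀ x, {φ ∈ M | x ∈ φ.2}.Finite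

theorem sh_eq_nil {b : ℕ} {x : List ℕ} (h : sh b x = []) : b = 0 ∧ x = [] := by
  unfold sh at h
  split at h
  · assumption
  · cases h

theorem finite_pattern {ρ X : Type} (p : Pat ρ) (f : ℕ → X) :
    {φ : ρ × List X | ∃ a ∈ p, mapA f a = φ}.Finite :=
  ((p.map (mapA f)).finite_toSet).subset fun φ ⟨a, ha, h⟩ => by
    rw [← h]
    exact List.mem_map_of_mem ha

theorem lfin_unf {w : ℕ} {ℓ : Ty → Pt → ℕ → Ty} (t : Nd) : LFin ((Nd.coalg ℓ).Unf w t) := by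
  have h0 : ∀ n, ∀ t : Nd, t.rk ≤ n → {φ ∈ (Nd.coalg ℓ).Unf w t | [] ∈ φ.2}.Finite := by
    intro n
    induction n using Nat.strong_induction_on with
    | _ n ih =>
    intro t ht
    by_cases hl : t.IsLeaf
    · rw [Unf_leaf hl]
      exact Set.finite_empty.subset fun _ h => h.1
    have hlt := Nd.rk_chd (ℓ := ℓ) hl
    refine ((finite_pattern t.bag fun i => sh i []).union
      ((ih _ (hlt.trans_le ht) (t.chd ℓ 0) le_rfl).image (mapA (sh 0)))).subset ?_
    rintro φ ⟨hφ, hmem⟩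
    rcases Coalg.mem_Unf.1 hφ with h | ⟨b, hb, ψ, hψ, rfl⟩
    · exact Or.inl h
    · obtain ⟨y, hy, hy0⟩ := mem_mapA.1 hmem
      obtain ⟨rfl, rfl⟩ := sh_eq_nil hy0
      exact Or.inr ⟨ψ, ⟨hψ, hy⟩, rfl⟩
  intro x
  induction x generalizing t with
  | nil => exact h0 _ t le_rfl
  | cons c x ih =>
    refine ((finite_pattern t.bag fun i => sh i []).union
      ((ih (t.chd ℓ c)).image (mapA (sh c)))).subset ?_
    rintro φ ⟨hφ, hmem⟩
    rcases Coalg.mem_Unf.1 hφ with h | ⟨b, hb, ψ, hψ, rfl⟩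
    · exact Or.inl h
    · obtain ⟨y, hy, hy0⟩ := mem_mapA.1 hmem
      unfold sh at hy0
      split at hy0
      · cases hy0
      · cases hy0
        exact Or.inr ⟨ψ, ⟨hψ, hy⟩, rfl⟩

theorem LFin.union_finite {ρ X : Type} {M N : Str ρ X} (hM : LFin M) (hN : N.Finite) :
    LFin (M ∪ N) := fun x =>
  ((hM x).union hN).subset fun _ ⟨h, hx⟩ => h.imp (fun h => ⟨h, hx⟩) id

theorem lfin_LM {U : Pt} {Q : List RelSym} {X : Type} {M : Str RelSym X} (hM : LFin M)
    {Z : X → Ty → Prop} (hZ : ∀ x τ, Z x τ → τ ∈ tys U) : LFin (LM Q M Z) := fun x => by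
  refine (((hM x).image fun ψ => (Sum.inl ψ.1, ψ.2)).union
    (((tys U).finite_toSet).image fun τ => (Sum.inr τ, [x]))).subset ?_
  rintro φ ⟨⟨ψ, h1, -, rfl⟩ | ⟨y, τ, hy, rfl⟩, hx⟩
  · exact Or.inl ⟨ψ, ⟨h1, hx⟩, rfl⟩
  · simp only [List.mem_singleton] at hx
    subst hx
    exact Or.inr ⟨τ, hZ x τ hy, rfl⟩

open Filter in
theorem eventually_eq_of_finite {X : Type} {s : Set X} (hs : s.Finite) {f : ℕ → X}
    (h : ∀ᶠ n in (hyperfilter ℕ : Filter ℕ), f n ∈ s) :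
    ∃ y ∈ s, ∀ᶠ n in (hyperfilter ℕ : Filter ℕ), f n = y := by
  have := (Ultrafilter.eventually_exists_mem_iff (f := hyperfilter ℕ) hs
    (P := fun y n => f n = y)).1 (h.mono fun n hn => ⟨f n, hn, rfl⟩)
  exact this

open Filter in
/-- Truth of connected patterns in a decreasing sequence of locally finite structures. -/
theorem tr_iInter {ρ X : Type} {N : ℕ → Str ρ X} (hN : ∀ n m, n ≤ m → N m ⊆ N n)
    (hf : LFin (N 0)) {q : Pat ρ} (hq : Conn q) {x : X} (h : ∀ n, Tr (N n) q x) :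
    Tr (⋂ n, N n) q x := by
  choose f h0 hfn using h
  have hV : ∀ a ∈ q, ∀ i ∈ a.2, ∃ y, ∀ᶠ n in (hyperfilter ℕ : Filter ℕ), f n i = y := by
    refine hq {i | ∃ y, ∀ᶠ n in (hyperfilter ℕ : Filter ℕ), f n i = y}
      ⟨x, Eventually.of_forall h0⟩ ?_
    rintro a ha ⟨i, hi, y, hy⟩ j hj
    obtain ⟨ψ, -, hψ⟩ := eventually_eq_of_finite (hf y) (f := fun n => mapA (f n) a)
      (hy.mono fun n hn => ⟨hN 0 n (Nat.zero_le _) (hfn n a ha), mem_mapA.2 ⟨i, hi, hn⟩⟩)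
    obtain ⟨n0, hn0⟩ := hψ.exists
    refine ⟨f n0 j, hψ.mono fun n hn => ?_⟩
    have := hn.trans hn0.symm
    simp only [mapA, Prod.mk.injEq, true_and] at this
    exact List.map_inj_left.1 this j hj
  have hV : ∀ i, ∃ y, (i = 0 → y = x) ∧ ((∃ a ∈ q, i ∈ a.2) →
      ∀ᶠ n in (hyperfilter ℕ : Filter ℕ), f n i = y) := fun i => by
    by_cases h00 : i = 0
    · exact ⟨x, fun _ => rfl, fun _ => Eventually.of_forall fun n => by rw [h00, h0]⟩
    by_cases hi : ∃ a ∈ q, i ∈ a.2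
    · obtain ⟨a, ha, hi⟩ := hi
      obtain ⟨y, hy⟩ := hV a ha i hi
      exact ⟨y, fun h => (h00 h).elim, fun _ => hy⟩
    · exact ⟨x, fun _ => rfl, fun h => (hi h).elim⟩
  choose g hg0 hg using hV
  refine ⟨g, hg0 0 rfl, fun a ha => Set.mem_iInter.2 fun m => ?_⟩
  have h1 : ∀ᶠ n in (hyperfilter ℕ : Filter ℕ), ∀ i ∈ {i | i ∈ a.2}, f n i = g i :=
    (eventually_all_finite (List.finite_toSet a.2)).2 fun i hi => hg i ⟨a, ha, hi⟩
  have h2 : ∀ᶠ n in (hyperfilter ℕ : Filter ℕ), m ≤ n :=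
    (eventually_ge_atTop m).filter_mono Nat.hyperfilter_le_atTop
  obtain ⟨n, hn1, hn2⟩ := (h1.and h2).exists
  rw [mapA_congr fun i hi => (hn1 i hi).symm]
  exact hN m n hn2 (hfn n a ha)

section Compact

variable {w : ℕ} {U : Pt} {Q : List RelSym} {ℓ : Ty → Pt → ℕ → Ty} {X : Type} {M : Str RelSym X}

theorem tr_zs_all (hM : LFin M) {q : LPt} (hq : Conn q) {x : X}
    (h : ∀ n, Tr (LM Q M (Zs w U Q ℓ M n)) q x) :
    Tr (LM Q M fun x τ => ∀ n, Zs w U Q ℓ M n x τ) q x := by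
  refine (tr_iInter (N := fun n => LM Q M (Zs w U Q ℓ M n)) (fun _ _ h => LM_mono (Zs_anti h))
    (lfin_LM hM fun _ _ h => h) hq h).mono fun φ hφ => ?_
  rw [Set.mem_iInter] at hφ
  rcases hφ 0 with ⟨ψ, h1, h2, rfl⟩ | ⟨y, τ, -, rfl⟩
  · exact inl_mem_LM.2 ⟨h1, h2⟩
  · exact inr_mem_LM.2 fun n => inr_mem_LM.1 (hφ n)

theorem sim_zs_all (hU : Uni w U) (hM : LFin M) :
    Sim w U Q ℓ M fun x τ => ∀ n, Zs w U Q ℓ M n x τ := fun _ _ h =>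
  ⟨h 0, fun p hp => tr_zs_all hM (LL_conn hU (mem_tys (h 0) hp) hU.pos) fun n => (h (n + 1)).2 p hp⟩

end Compact

/-! ### Annotations versus simulations -/

/-- What is claimed at the root holds within the tree. -/
def TopG (I : Info) : Prop := ∀ q ∈ I.1, q ∈ I.2

section Paths

variable {w : ℕ} {U : Pt} {Q : List RelSym} {ℓ ℓ' : Ty → Pt → ℕ → Ty}

/-- Elements denoted by paths through inner nodes. -/
def Node (w : ℕ) (ℓ : Ty → Pt → ℕ → Ty) (t : Nd) (y : List ℕ) : Prop := ∃ π, NL w ℓ t π ∧ norm π = y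

theorem node_nil (t : Nd) : Node w ℓ t [] := ⟨[], trivial, rfl⟩

theorem occ_node {Ts : List (Pt × Pt)} {c : Ty → Ty} (hS : Sys w U Ts c ℓ) (hU : Uni w U) {t : Nd}
    (ht : t.Good w U c) {φ} (hφ : φ ∈ (Nd.coalg ℓ).Unf w t) : ∀ y ∈ φ.2, Node w ℓ t y := by
  obtain ⟨n, hn⟩ := hφ
  induction n generalizing t φ with
  | zero => exact hn.elim
  | succ n ih =>
    have hl : ¬ t.IsLeaf := fun hl => by
      rw [UnfN_leaf hl] at hn
      exact hn
    intro y hy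
    rcases hn with ⟨a, ha, rfl⟩ | ⟨b, hb, ψ, hψ, rfl⟩
    · obtain ⟨i, hi, rfl⟩ := mem_mapA.1 hy
      exact ⟨[i], ⟨hl, good_bag_lt hS hU ht a ha i hi, trivial⟩, rfl⟩
    · obtain ⟨z, hz, rfl⟩ := mem_mapA.1 hy
      obtain ⟨π, hπ, rfl⟩ := ih (good_chd hS ht hb) hψ z hz
      exact ⟨b :: π, ⟨hl, hb, hπ⟩, rfl⟩

theorem NL_append {t : Nd} {p ρ : List ℕ} :
    NL w ℓ t (p ++ ρ) ↔ NL w ℓ t p ∧ NL w ℓ ((Nd.coalg ℓ).sub t p) ρ := by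
  induction p generalizing t with
  | nil => exact ⟨fun h => ⟨trivial, h⟩, fun h => h.2⟩
  | cons b p ih =>
    constructor
    · rintro ⟨h1, h2, h3⟩
      exact ⟨⟨h1, h2, (ih.1 h3).1⟩, (ih.1 h3).2⟩
    · rintro ⟨⟨h1, h2, h3⟩, h4⟩
      exact ⟨h1, h2, ih.2 ⟨h3, h4⟩⟩

theorem NL.length_le {B : ℕ} (hB : ∀ σ p b, (ℓ σ p b).length ≤ B) {σ : Ty} {ps : List Pt}
    (hps : ps.length ≤ B) {π : List ℕ} (h : NL w ℓ (.st σ ps) π) :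
    π.length ≤ nz π * (B + 1) + ps.length := by
  induction π generalizing σ ps with
  | nil => simp
  | cons b π ih =>
    obtain ⟨h1, h2, h3⟩ := h
    rcases ps with _ | ⟨p, ps⟩
    · exact (h1 rfl).elim
    by_cases hb : b = 0
    · subst hb
      rw [Nd.chd, if_pos rfl] at h3
      have := ih (by simp at hps; omega) h3
      have hn : nz (0 :: π) = nz π := by simp [nz]
      rw [hn]
      simp only [List.length_cons]
      omega
    · rw [Nd.chd, if_neg hb] at h3
      have := ih (hB _ _ _) h3
      have hn : nz (b :: π) = nz π + 1 := by simp [nz, hb]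
      rw [hn]
      have hl := hB σ p b
      simp only [List.length_cons, Nat.add_mul, one_mul]
      omega

theorem sub_mem_Unf {t : Nd} {x : List ℕ} (hx : ∀ i ∈ x, i < w) {φ}
    (h : φ ∈ (Nd.coalg ℓ).Unf w ((Nd.coalg ℓ).sub t x)) :
    mapA (fun y => x.foldr sh y) φ ∈ (Nd.coalg ℓ).Unf w t := by
  induction x generalizing t with
  | nil =>
    have : mapA (fun y => y) φ = φ := mapA_id φ
    simp only [List.foldr_nil]
    rw [this]
    exact h
  | cons b x ih =>
    have := Coalg.ch_mem_Unf (K := Nd.coalg ℓ) (hx b (by simp))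
      (ih (fun i hi => hx i (by simp [hi])) (t := t.chd ℓ b) h)
    rwa [mapA_mapA] at this

theorem Meets.sub {X : Type} {J : Str RelSym X} {t : Nd} {ι : List ℕ → X}
    (h : Meets w (Nd.coalg ℓ) J t ι) (x : List ℕ) :
    Meets w (Nd.coalg ℓ) J ((Nd.coalg ℓ).sub t x) fun y => ι (x.foldr sh y) := by
  induction x generalizing t ι with
  | nil => exact h
  | cons b x ih => exact ih (h.ch b)

theorem finite_paths (w K : ℕ) : {π : List ℕ | (∀ i ∈ π, i < w) ∧ π.length ≤ K}.Finite := by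
  induction K with
  | zero =>
    refine (Set.finite_singleton []).subset fun π hπ => ?_
    exact List.length_eq_zero_iff.1 (Nat.le_zero.1 hπ.2)
  | succ K ih =>
    refine ((Set.finite_singleton []).union
      (Set.Finite.image2 List.cons (Set.finite_Iio w) ih)).subset ?_
    rintro (_ | ⟨b, π⟩) ⟨h1, h2⟩
    · exact Or.inl rfl
    · exact Or.inr ⟨b, h1 b (by simp), π, ⟨fun i hi => h1 i (by simp [hi]), by simpa using h2⟩, rfl⟩

end Paths

section Core

variable {w : ℕ} {U : Pt} {Q : List RelSym} {ℓ ℓ' : Ty → Pt → ℕ → Ty} {M : Str RelSym (List ℕ)}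
  {Z : List ℕ → Ty → Prop} {Ts : List (Pt × Pt)} {c : Ty → Ty}

theorem annX_trueInfo (hS : Sys w U Ts c ℓ) (hU : Uni w U) (hZ : Sim w U Q ℓ' M Z) {X : LPt}
    (hX : X ∈ LC w U Q) (π : List ℕ) {t : Nd} (ht : t.Good w U c) {ι : List ℕ → List ℕ}
    (hM : Meets w (labCoalg U Q ℓ Z) (LM Q M Z) (t, ι) ι) (hπ : NL w ℓ t π)
    (h : Tr (LM Q M Z) X (ι (norm π))) :
    AnnX w U Q ℓ ℓ' X π.length t (trueInfo w U Q ℓ M Z t ι) := by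
  induction π generalizing t ι with
  | nil => exact .here (ann_trueInfo hS hU hZ ht hM) (mem_trueInfo_fst.2 ⟨hX, h⟩)
  | cons b π ih =>
    exact .step hπ.1 (loc_trueInfo hU hZ) (step_trueInfo hS hU ht hM)
      (fun b hb => ann_trueInfo hS hU hZ (good_chd hS ht hb) (hM.ch b)) hπ.2.1
      (ih (good_chd hS ht hπ.2.1) (hM.ch b) hπ.2.2 h)

open Classical in
/-- Restriction of a family of labels to the nodes of a tree. -/
theorem exists_retract (hS : Sys w U Ts c ℓ) (hU : Uni w U) {t : Nd} (ht : t.Good w U c)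
    (hM : ∀ φ ∈ M, φ ∈ (Nd.coalg ℓ).Unf w t ∨ ∀ x ∈ φ.2, x = []) :
    ∃ r : List ℕ → List ℕ, (∀ y, Node w ℓ t y → r y = y) ∧ (∀ y, Node w ℓ t (r y)) ∧
      ∀ φ ∈ M, mapA r φ ∈ M := by
  have hr : ∀ y, Node w ℓ t y → (if Node w ℓ t y then y else []) = y := fun y hy => if_pos hy
  refine ⟨fun y => if Node w ℓ t y then y else [], hr, fun y => ?_, fun φ hφ => ?_⟩
  · by_cases h : Node w ℓ t y
    · simpa only [if_pos h]
    · simpa only [if_neg h] using node_nil t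
  · rw [mapA_eq_self]
    · exact hφ
    · intro y hy
      refine hr y ?_
      rcases hM φ hφ with h | h
      · exact occ_node hS hU ht h y hy
      · rw [h y hy]
        exact node_nil t

theorem lab_of_node (hZt : ∀ x τ, Z x τ → τ ∈ tys U) {t : Nd}
    (hZn : ∀ x τ, Z x τ → Node w ℓ t x) {φ} (hφ : φ ∈ LM Q M Z) :
    φ ∈ (labCoalg U Q ℓ Z).Unf w (t, fun x => x) ∨
      ∃ ψ ∈ M, ψ ∉ (Nd.coalg ℓ).Unf w t ∧ φ = (Sum.inl ψ.1, ψ.2) := by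
  rcases hφ with ⟨ψ, h1, h2, rfl⟩ | ⟨x, τ, hx, rfl⟩
  · by_cases h : ψ ∈ (Nd.coalg ℓ).Unf w t
    · exact Or.inl (inl_mem_lab h h2)
    · exact Or.inr ⟨ψ, h1, h, rfl⟩
  · obtain ⟨π, hπ, rfl⟩ := hZn x τ hx
    exact Or.inl (inr_mem_lab π hπ.lt (hZt _ τ hx) hx)

theorem exists_annX_of_sim (hS : Sys w U Ts c ℓ) (hU : Uni w U) {t : Nd} (ht : t.Good w U c)
    (hM : ∀ φ ∈ M, φ ∈ (Nd.coalg ℓ).Unf w t ∨ ∀ x ∈ φ.2, x = []) (hZ : Sim w U Q ℓ' M Z) :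
    ∃ I, Ann w U Q ℓ ℓ' t I ∧ (M ⊆ (Nd.coalg ℓ).Unf w t → TopG I) ∧
      (∀ τ, Z [] τ → [lbl τ] ∈ I.1) ∧ (∀ X ∈ LC w U Q, ∀ π, NL w ℓ t π → Tr (LM Q M Z) X (norm π) →
        AnnX w U Q ℓ ℓ' X π.length t I) ∧
      ∀ X ∈ LC w U Q, ∀ e, Tr (LM Q M Z) X e → ∃ n, AnnX w U Q ℓ ℓ' X n t I := by
  obtain ⟨r, hr, hrn, hrM⟩ := exists_retract hS hU ht hM
  have hZ' := hZ.push (N := M) (h := r) fun φ hφ _ => hrM φ hφ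
  set Z' : List ℕ → Ty → Prop := fun y τ => ∃ x, r x = y ∧ Z x τ with hZ'def
  have hZt : ∀ x τ, Z' x τ → τ ∈ tys U := fun x τ h => (hZ' x τ h).1
  have hZn : ∀ x τ, Z' x τ → Node w ℓ t x := fun x τ ⟨y, hy, _⟩ => hy ▸ hrn y
  have hm : Meets w (labCoalg U Q ℓ Z') (LM Q M Z') (t, fun x => x) fun x => x := by
    refine ⟨Function.injective_id, fun φ hφ => ?_⟩
    rcases lab_of_node hZt hZn hφ with h | ⟨ψ, h1, h2, rfl⟩
    · exact Or.inl ⟨φ, h, mapA_id φ⟩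
    · exact Or.inr fun x hx hmem => hx (((hM ψ h1).resolve_left h2) x hmem)
  have key : ∀ X ∈ LC w U Q, ∀ π, NL w ℓ t π → ∀ e, r e = norm π → Tr (LM Q M Z) X e →
      AnnX w U Q ℓ ℓ' X π.length t (trueInfo w U Q ℓ M Z' t fun x => x) := fun X hX π hπ e he h => by
    refine annX_trueInfo hS hU hZ' hX π ht hm hπ ?_
    rw [← he]
    exact h.map (LM_map (N := M) (fun φ hφ _ => hrM φ hφ) (Z' := Z') fun x τ hx => ⟨x, rfl, hx⟩)
  refine ⟨_, ann_trueInfo hS hU hZ' ht hm, fun hsub q hq => ?_, fun τ hτ => ?_,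
    fun X hX π hπ h => key X hX π hπ _ (hr _ ⟨π, hπ, rfl⟩) h, fun X hX e h => ?_⟩
  · obtain ⟨h1, h2⟩ := mem_trueInfo_fst.1 hq
    refine mem_trueInfo_snd.2 ⟨h1, h2.mono fun φ hφ => ?_⟩
    rcases lab_of_node hZt hZn hφ with h | ⟨ψ, h1, h2, rfl⟩
    · exact h
    · exact (h2 (hsub h1)).elim
  · refine mem_trueInfo_fst.2 ⟨lbl_mem_LC hU.pos (hZ _ _ hτ).1, fun _ => [], rfl, fun a ha => ?_⟩
    rw [List.mem_singleton.1 ha]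
    exact inr_mem_LM.2 ⟨[], hr [] (node_nil t), hτ⟩
  · obtain ⟨π, hπ, he⟩ := hrn e
    exact ⟨_, key X hX π hπ e he.symm h⟩

/-- Simulations on a tree are witnessed by annotations. -/
theorem exists_topG_of_sim (hS : Sys w U Ts c ℓ) (hU : Uni w U) {t : Nd} (ht : t.Good w U c)
    (hZ : Sim w U Q ℓ' ((Nd.coalg ℓ).Unf w t) Z) :
    ∃ I, TopG I ∧ Ann w U Q ℓ ℓ' t I ∧ (∀ τ, Z [] τ → [lbl τ] ∈ I.1) ∧
      ∀ X ∈ LC w U Q, (∃ e, Tr (LM Q ((Nd.coalg ℓ).Unf w t) Z) X e) →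
        ∃ n, AnnX w U Q ℓ ℓ' X n t I := by
  obtain ⟨I, h1, h2, h3, -, h5⟩ := exists_annX_of_sim hS hU ht (fun φ hφ => Or.inl hφ) hZ
  exact ⟨I, h2 fun _ h => h, h1, h3, fun X hX ⟨e, he⟩ => h5 X hX e he⟩

theorem sim_of_topG (hU : Uni w U) {t : Nd} {I : Info} (hI : TopG I) :
    (Ann w U Q ℓ ℓ' t I → ∃ Z, Sim w U Q ℓ' ((Nd.coalg ℓ).Unf w t) Z ∧
      ∀ τ ∈ tys U, [lbl τ] ∈ I.1 → Z [] τ) ∧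
    ∀ X n, AnnX w U Q ℓ ℓ' X n t I → ∃ Z, Sim w U Q ℓ' ((Nd.coalg ℓ).Unf w t) Z ∧
      ∃ e, Tr (LM Q ((Nd.coalg ℓ).Unf w t) Z) X e := by
  refine ⟨fun h => ?_, fun X n h => ?_⟩
  · obtain ⟨R, hR, rfl⟩ := h.exists_run
    refine ⟨_, hR.sim hU hI, fun τ hτ h => ⟨hτ, [], by simp, rfl, Nat.zero_le _, h⟩⟩
  · obtain ⟨R, hR, rfl, π, hπ, -, hX⟩ := h.exists_run
    exact ⟨_, hR.sim hU hI, _, hR.top_sound hU π hπ.lt X hX (Or.inl ⟨hI, rfl⟩)⟩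

end Core

/-! ### Limits of annotated branches -/

/-- All states at which the database part ends are in `𝒢`. -/
def Nd.In (w : ℕ) (𝒢 : Set Nd) : Nd → Prop
  | .st σ ps => .st σ ps ∈ 𝒢
  | .dn _ ch => ∀ b < w, (ch b).In w 𝒢

/-- A set of states closed under children. -/
structure Closed (w : ℕ) (ℓ : Ty → Pt → ℕ → Ty) (𝒢 : Set Nd) : Prop where
  fin : 𝒢.Finite
  chd : ∀ s ∈ 𝒢, ∀ b < w, s.chd ℓ b ∈ 𝒢

/-- The annotated node `v` is a child of the annotated node `y`. -/
def Edge (w : ℕ) (U : Pt) (Q : List RelSym) (ℓ ℓ' : Ty → Pt → ℕ → Ty) (v y : Nd × Info) : Prop :=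
  ¬ y.1.IsLeaf ∧ Loc w U Q ℓ' y.1 y.2 ∧ ∃ J, Step w U Q y.1.bag y.2 J ∧
    (∀ b < w, Ann w U Q ℓ ℓ' (y.1.chd ℓ b) (J b)) ∧ ∃ b < w, v = (y.1.chd ℓ b, J b)

/-- There is an annotated branch, infinite towards the root, ending with `X`. -/
def Lim (w : ℕ) (U : Pt) (Q : List RelSym) (ℓ ℓ' : Ty → Pt → ℕ → Ty) (𝒢 : Set Nd) (X : LPt) : Prop :=
  ∃ Y : Set (Nd × Info), (∀ y ∈ Y, y.1 ∈ 𝒢 ∧ Ann w U Q ℓ ℓ' y.1 y.2) ∧ (∃ y ∈ Y, X ∈ y.2.1) ∧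
    ∀ y ∈ Y, ∃ y' ∈ Y, Edge w U Q ℓ ℓ' y y'

theorem exists_forall_of_finite {V : Type} {s : Set V} (hs : s.Finite) {P : ℕ → V → Prop}
    (hP : ∀ n v, P (n + 1) v → P n v) (h : ∀ n, ∃ v ∈ s, P n v) : ∃ v ∈ s, ∀ n, P n v := by
  have hP' : ∀ n m, n ≤ m → ∀ v, P m v → P n v := fun n m hnm => by
    induction hnm with
    | refl => exact fun _ h => h
    | step _ ih => exact fun v h => ih v (hP _ v h)
  by_contra! hcon
  have : ∀ v, ∃ n, v ∈ s → ¬ P n v := fun v => by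
    by_cases hv : v ∈ s
    · obtain ⟨n, hn⟩ := hcon v hv
      exact ⟨n, fun _ => hn⟩
    · exact ⟨0, fun h => (hv h).elim⟩
  choose n hn using this
  obtain ⟨N, hN⟩ := (hs.image n).bddAbove
  obtain ⟨v, hv, hPv⟩ := h N
  exact hn v hv (hP' _ _ (hN ⟨v, hv, rfl⟩) v hPv)

section Lims

variable {w : ℕ} {U : Pt} {Q : List RelSym} {ℓ ℓ' : Ty → Pt → ℕ → Ty} {𝒢 : Set Nd}

/-- There is an annotated branch of length `n` ending in `v`. -/
def Anc (w : ℕ) (U : Pt) (Q : List RelSym) (ℓ ℓ' : Ty → Pt → ℕ → Ty) (𝒢 : Set Nd) :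
    ℕ → Nd × Info → Prop
  | 0, v => v.1 ∈ 𝒢 ∧ Ann w U Q ℓ ℓ' v.1 v.2
  | n + 1, v => ∃ y, Edge w U Q ℓ ℓ' v y ∧ Anc w U Q ℓ ℓ' 𝒢 n y

theorem Edge.ann {v y : Nd × Info} (h : Edge w U Q ℓ ℓ' v y) :
    Ann w U Q ℓ ℓ' v.1 v.2 ∧ Ann w U Q ℓ ℓ' y.1 y.2 := by
  obtain ⟨-, h2, J, h3, h4, b, hb, rfl⟩ := h
  exact ⟨h4 b hb, Ann.fold h2 h3 h4⟩

theorem Edge.annX {v y : Nd × Info} {X : LPt} {n : ℕ} (h : Edge w U Q ℓ ℓ' v y)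
    (hX : AnnX w U Q ℓ ℓ' X n v.1 v.2) : AnnX w U Q ℓ ℓ' X (n + 1) y.1 y.2 := by
  obtain ⟨h1, h2, J, h3, h4, b, hb, rfl⟩ := h
  exact .step h1 h2 h3 h4 hb hX

theorem Anc.base (h𝒢 : Closed w ℓ 𝒢) {n : ℕ} {v : Nd × Info} (h : Anc w U Q ℓ ℓ' 𝒢 n v) :
    v.1 ∈ 𝒢 ∧ Ann w U Q ℓ ℓ' v.1 v.2 := by
  induction n generalizing v with
  | zero => exact h
  | succ n ih =>
    obtain ⟨y, hy, h⟩ := h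
    refine ⟨?_, hy.ann.1⟩
    obtain ⟨-, -, J, -, -, b, hb, rfl⟩ := hy
    exact h𝒢.chd _ (ih h).1 b hb

theorem Anc.pred (h𝒢 : Closed w ℓ 𝒢) (n : ℕ) (v : Nd × Info) (h : Anc w U Q ℓ ℓ' 𝒢 (n + 1) v) :
    Anc w U Q ℓ ℓ' 𝒢 n v := by
  induction n generalizing v with
  | zero => exact h.base h𝒢
  | succ n ih =>
    obtain ⟨y, hy, h⟩ := h
    exact ⟨y, hy, ih y h⟩

theorem AnnX.anc {X : LPt} {n : ℕ} {t : Nd} {I : Info}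
    (h : AnnX w U Q ℓ ℓ' X n t I) {k : ℕ} (hk : Anc w U Q ℓ ℓ' 𝒢 k (t, I)) :
    ∃ v, X ∈ v.2.1 ∧ Anc w U Q ℓ ℓ' 𝒢 (n + k) v := by
  induction h generalizing k with
  | here _ hX => exact ⟨_, hX, by rwa [Nat.zero_add]⟩
  | @step n t I J b hl hloc hs hJ hb _ ih =>
    obtain ⟨v, hv⟩ := ih (k := k + 1) ⟨_, ⟨hl, hloc, J, hs, hJ, b, hb, rfl⟩, hk⟩
    exact ⟨v, by rwa [show n + 1 + k = n + (k + 1) by omega]⟩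

theorem lim_of_annX (h𝒢 : Closed w ℓ 𝒢) {X : LPt}
    (h : ∀ n, ∃ s ∈ 𝒢, ∃ I, AnnX w U Q ℓ ℓ' X n s I) : Lim w U Q ℓ ℓ' 𝒢 X := by
  have hfin : (𝒢 ×ˢ {I | I ∈ infos w U Q}).Finite := h𝒢.fin.prod (List.finite_toSet _)
  have hmem : ∀ n v, Anc w U Q ℓ ℓ' 𝒢 n v → v ∈ 𝒢 ×ˢ {I | I ∈ infos w U Q} := fun n v hv =>
    ⟨(hv.base h𝒢).1, (hv.base h𝒢).2.unfold.1.mem⟩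
  refine ⟨{v | ∀ n, Anc w U Q ℓ ℓ' 𝒢 n v}, fun y hy => hy 0, ?_, fun y hy => ?_⟩
  · obtain ⟨v, -, hv⟩ := exists_forall_of_finite hfin
      (P := fun n v => X ∈ v.2.1 ∧ Anc w U Q ℓ ℓ' 𝒢 n v) (fun n v hv => ⟨hv.1, hv.2.pred h𝒢⟩)
      fun n => by
        obtain ⟨s, hs, I, hI⟩ := h n
        obtain ⟨v, hv, hv'⟩ := hI.anc (𝒢 := 𝒢) (k := 0) ⟨hs, hI.ann⟩
        exact ⟨v, hmem _ v hv', hv, hv'⟩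
    exact ⟨v, fun n => (hv n).2, (hv 0).1⟩
  · obtain ⟨v, -, hv⟩ := exists_forall_of_finite hfin
      (P := fun n v => Edge w U Q ℓ ℓ' y v ∧ Anc w U Q ℓ ℓ' 𝒢 n v)
      (fun n v hv => ⟨hv.1, hv.2.pred h𝒢⟩) fun n => by
        obtain ⟨v, hv, hv'⟩ := hy (n + 1)
        exact ⟨v, hmem _ v hv', hv, hv'⟩
    exact ⟨v, fun n => (hv n).2, (hv 0).1⟩

theorem Lim.exists_annX {X : LPt} (h : Lim w U Q ℓ ℓ' 𝒢 X) (n : ℕ) :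
    ∃ s ∈ 𝒢, ∃ I, AnnX w U Q ℓ ℓ' X n s I := by
  obtain ⟨Y, h1, ⟨y, hy, hX⟩, h2⟩ := h
  suffices ∃ y ∈ Y, AnnX w U Q ℓ ℓ' X n y.1 y.2 by
    obtain ⟨y, hy, h⟩ := this
    exact ⟨_, (h1 y hy).1, _, h⟩
  induction n with
  | zero => exact ⟨y, hy, .here (h1 y hy).2 hX⟩
  | succ n ih =>
    obtain ⟨v, hv, hvX⟩ := ih
    obtain ⟨y', hy', he⟩ := h2 v hv
    exact ⟨y', hy', he.annX hvX⟩

/-- Limits yield truth at all stages. -/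
theorem Lim.tr_zs (hU : Uni w U) {B : ℕ} (hB : ∀ σ p b, (ℓ σ p b).length ≤ B)
    (h𝒢 : ∀ s ∈ 𝒢, ∃ σ ps, s = .st σ ps ∧ ps.length ≤ B) {t : Nd}
    (ht : ∀ s ∈ 𝒢, ∃ x : List ℕ, (∀ i ∈ x, i < w) ∧ (Nd.coalg ℓ).sub t x = s) {X : LPt}
    (h : Lim w U Q ℓ ℓ' 𝒢 X) (m : ℕ) : ∃ e, Tr (LM Q ((Nd.coalg ℓ).Unf w t)
      (Zs w U Q ℓ' ((Nd.coalg ℓ).Unf w t) m)) X e := by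
  set K := (m + 1) * (LA w U Q).length
  obtain ⟨s, hs, I, hI⟩ := h.exists_annX (K * (B + 1) + B)
  obtain ⟨R, hR, rfl, π, hπ, hlen, hX⟩ := hI.exists_run
  obtain ⟨σ, ps, rfl, hps⟩ := h𝒢 s hs
  have h1 := hπ.length_le hB hps
  have hK : K ≤ nz π := by
    by_contra! hlt
    have := Nat.mul_le_mul_right (B + 1) (show nz π + 1 ≤ K from hlt)
    rw [Nat.add_mul, one_mul] at this
    omega
  obtain ⟨x, hx, hxs⟩ := ht _ hs
  have hmap : ∀ φ ∈ (Nd.coalg ℓ).Unf w (Nd.st σ ps), φ.1 ∈ Q →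
      mapA (fun y => x.foldr sh y) φ ∈ (Nd.coalg ℓ).Unf w t := fun φ hφ _ => by
    refine sub_mem_Unf hx ?_
    rwa [hxs]
  exact ⟨_, (hR.tr_zs hU hπ.lt hX hK).map (LM_map hmap (Zs_map hmap m))⟩

theorem exists_depth (h𝒢 : Closed w ℓ 𝒢) {t : Nd} (ht : t.In w 𝒢) :
    ∃ D, ∀ p : List ℕ, (∀ i ∈ p, i < w) → D ≤ p.length → (Nd.coalg ℓ).sub t p ∈ 𝒢 := by
  induction t with
  | st σ ps =>
    refine ⟨0, fun p hp _ => ?_⟩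
    have : ∀ (p : List ℕ) (s : Nd), s ∈ 𝒢 → (∀ i ∈ p, i < w) → (Nd.coalg ℓ).sub s p ∈ 𝒢 := by
      intro p
      induction p with
      | nil => exact fun s hs _ => hs
      | cons b p ih =>
        intro s hs hp
        exact ih (s.chd ℓ b) (h𝒢.chd s hs b (hp b (by simp))) fun i hi => hp i (by simp [hi])
    exact this p _ ht hp
  | dn B ch ih =>
    have : ∀ b, ∃ D, b < w → ∀ p : List ℕ, (∀ i ∈ p, i < w) → D ≤ p.length →
        (Nd.coalg ℓ).sub (ch b) p ∈ 𝒢 := fun b => by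
      by_cases hb : b < w
      · obtain ⟨D, hD⟩ := ih b (ht b hb)
        exact ⟨D, fun _ => hD⟩
      · exact ⟨0, fun h => (hb h).elim⟩
    choose D hD using this
    refine ⟨(Finset.range w).sup D + 1, fun p hp hlen => ?_⟩
    rcases p with _ | ⟨b, p⟩
    · simp at hlen
    · refine hD b (hp b (by simp)) p (fun i hi => hp i (by simp [hi])) (le_trans ?_ (Nat.succ_le_succ_iff.1 hlen))
      exact Finset.le_sup (f := D) (Finset.mem_range.2 (hp b (by simp)))

variable {Ts : List (Pt × Pt)} {c : Ty → Ty}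

theorem unf_atom (hS : Sys w U Ts c ℓ) {t : Nd} (ht : t.Good w U c) {φ}
    (hφ : φ ∈ (Nd.coalg ℓ).Unf w t) : ∃ a ∈ U, ∃ f, mapA f a = φ := by
  obtain ⟨n, hn⟩ := hφ
  induction n generalizing t φ with
  | zero => exact hn.elim
  | succ n ih =>
    rcases hn with ⟨a, ha, rfl⟩ | ⟨b, hb, ψ, hψ, rfl⟩
    · exact ⟨a, mem_pats (good_bag hS ht) ha, _, rfl⟩
    · obtain ⟨a, ha, f, rfl⟩ := ih (good_chd hS ht hb) hψ
      exact ⟨a, ha, _, (mapA_mapA _ _ _).symm⟩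

theorem foldr_sh_injective (p : List ℕ) : Function.Injective fun y => p.foldr sh y := by
  induction p with
  | nil => exact fun _ _ h => h
  | cons b p ih => exact (sh_injective b).comp ih

/-- Cutting out a subtree, collapsing everything else. -/
theorem exists_collapse (hS : Sys w U Ts c ℓ) {t : Nd} (ht : t.Good w U c) (p : List ℕ) :
    ∃ h : List ℕ → List ℕ, (∀ y, h (p.foldr sh y) = y) ∧ ∀ φ ∈ (Nd.coalg ℓ).Unf w t,
      mapA h φ ∈ (Nd.coalg ℓ).Unf w ((Nd.coalg ℓ).sub t p) ∪
        {φ | ∃ a ∈ U, mapA (fun _ => []) a = φ} := by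
  have hinj := foldr_sh_injective p
  have hm : Meets w (Nd.coalg ℓ) ((Nd.coalg ℓ).Unf w t) t fun y => y :=
    ⟨Function.injective_id, fun φ hφ => Or.inl ⟨φ, hφ, mapA_id φ⟩⟩
  refine ⟨Function.extend (fun y => p.foldr sh y) (fun y => y) fun _ => [],
    fun y => hinj.extend_apply _ _ y, fun φ hφ => ?_⟩
  rcases (hm.sub p).2 φ hφ with ⟨ψ, hψ, rfl⟩ | h
  · left
    rw [mapA_mapA, mapA_eq_self fun y _ => hinj.extend_apply _ _ y]
    exact hψ
  · right
    obtain ⟨a, ha, f, rfl⟩ := unf_atom hS ht hφ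
    refine ⟨a, ha, ?_⟩
    rw [mapA_mapA]
    refine mapA_congr fun i hi => ?_
    by_cases hy : ∃ x, (fun y => p.foldr sh y) x = f i
    · obtain ⟨x, hx⟩ := hy
      rw [← hx, hinj.extend_apply]
      by_contra hne
      exact h x (fun h => hne h.symm) (mem_mapA.2 ⟨i, hi, hx.symm⟩)
    · exact (Function.extend_apply' (f := fun y => p.foldr sh y) (fun y => y) (fun _ => []) (f i) hy).symm

/-- Truth at all stages is due to a simulation or to a limit. -/
theorem exists_annX_or_lim (hS : Sys w U Ts c ℓ) (hU : Uni w U) (h𝒢 : Closed w ℓ 𝒢) {t : Nd}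
    (ht : t.Good w U c) (hin : t.In w 𝒢) {X : LPt} (hX : X ∈ LC w U Q)
    (h : ∀ n, ∃ e, Tr (LM Q ((Nd.coalg ℓ).Unf w t) (Zs w U Q ℓ' ((Nd.coalg ℓ).Unf w t) n)) X e) :
    (∃ I, TopG I ∧ ∃ n, AnnX w U Q ℓ ℓ' X n t I) ∨ Lim w U Q ℓ ℓ' 𝒢 X := by
  set M := (Nd.coalg ℓ).Unf w t with hMdef
  set T : ℕ → List ℕ → Prop := fun n y => Tr (LM Q M (Zs w U Q ℓ' M n)) X y with hT
  have hTs : ∀ n y, T (n + 1) y → T n y := fun n y h => h.mono (LM_mono (Zs_succ n))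
  have hTa : ∀ n m, n ≤ m → ∀ y, T m y → T n y := fun n m hnm y h => h.mono (LM_mono (Zs_anti hnm))
  have hc := (mem_LC.1 hX).2
  by_cases hex : ∃ y, ∀ n, T n y
  · left
    obtain ⟨y, hy⟩ := hex
    obtain ⟨I, hI, -, -, hIX⟩ := exists_topG_of_sim hS hU ht (sim_zs_all (ℓ := ℓ') (Q := Q) hU
      (lfin_unf t))
    exact ⟨I, hI, hIX X hX ⟨y, tr_zs_all (lfin_unf t) hc hy⟩⟩
  right
  push Not at hex
  obtain ⟨r, -, hrn, hrM⟩ := exists_retract hS hU ht (M := M) fun φ hφ => Or.inl hφ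
  have hnode : ∀ n, ∃ π, NL w ℓ t π ∧ T n (norm π) := fun n => by
    obtain ⟨e, he⟩ := h n
    obtain ⟨π, hπ, hr⟩ := hrn e
    refine ⟨π, hπ, ?_⟩
    rw [hr]
    exact he.map (LM_map (fun φ hφ _ => hrM φ hφ) (Zs_map (fun φ hφ _ => hrM φ hφ) n))
  obtain ⟨D, hD⟩ := exists_depth h𝒢 hin
  refine lim_of_annX h𝒢 fun K => ?_
  choose bd hbd using hex
  obtain ⟨N, hN⟩ := ((finite_paths w (D + K)).image fun π => bd (norm π)).bddAbove
  have hlong : ∀ n, ∃ π, NL w ℓ t π ∧ D + K ≤ π.length ∧ T n (norm π) := fun n => by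
    obtain ⟨π, hπ, hTπ⟩ := hnode (max n N)
    refine ⟨π, hπ, ?_, hTa _ _ (le_max_left n N) _ hTπ⟩
    by_contra! hlt
    exact hbd (norm π) (hTa _ _ ((hN ⟨π, ⟨hπ.lt, hlt.le⟩, rfl⟩).trans (le_max_right n N)) _ hTπ)
  obtain ⟨⟨s, ρ⟩, ⟨hs, -⟩, hv⟩ := exists_forall_of_finite (h𝒢.fin.prod (finite_paths w K))
    (P := fun n v => ∃ p, (∀ i ∈ p, i < w) ∧ (Nd.coalg ℓ).sub t p = v.1 ∧ NL w ℓ v.1 v.2 ∧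
      v.2.length = K ∧ T n (norm (p ++ v.2)))
    (fun n v ⟨p, h1, h2, h3, h4, h5⟩ => ⟨p, h1, h2, h3, h4, hTs n _ h5⟩) fun n => by
      obtain ⟨π, hπ, hlen, hTπ⟩ := hlong n
      rw [← List.take_append_drop (π.length - K) π] at hπ hTπ
      have hlt := (NL_append.1 hπ).1.lt
      have hlt2 := (NL_append.1 hπ).2.lt
      have hl : (π.drop (π.length - K)).length = K := by
        rw [List.length_drop]
        omega
      exact ⟨(_, π.drop (π.length - K)), ⟨hD _ hlt (by rw [List.length_take]; omega),
        hlt2, hl.le⟩, _, hlt, rfl, (NL_append.1 hπ).2, hl, hTπ⟩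
  simp only at hv
  obtain ⟨p0, hp0, hps, hρ, hK, -⟩ := hv 0
  have hsg : s.Good w U c := hps ▸ good_sub hS ht p0 hp0
  set M' := (Nd.coalg ℓ).Unf w s ∪ {φ | ∃ a ∈ U, mapA (fun _ => []) a = φ} with hM'
  have hMlf : LFin M' := (lfin_unf s).union_finite (finite_pattern U _)
  have htr : ∀ n, Tr (LM Q M' (Zs w U Q ℓ' M' n)) X (norm ρ) := fun n => by
    obtain ⟨p, -, hps, -, -, hTn⟩ := hv n
    obtain ⟨h, hh, hhM⟩ := exists_collapse hS ht p
    rw [hps] at hhM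
    have := hTn.map (LM_map (fun φ hφ _ => hhM φ hφ) (Zs_map (fun φ hφ _ => hhM φ hφ) n))
    rw [norm, List.foldr_append] at this
    rwa [hh] at this
  obtain ⟨I, -, -, -, hI, -⟩ := exists_annX_of_sim (ℓ := ℓ) hS hU hsg (M := M') (fun φ hφ => by
    rcases hφ with h | ⟨a, -, rfl⟩
    · exact Or.inl h
    · refine Or.inr fun x hx => ?_
      obtain ⟨i, -, rfl⟩ := mem_mapA.1 hx
      rfl) (sim_zs_all (ℓ := ℓ') (Q := Q) hU hMlf)
  exact ⟨s, hs, I, hK ▸ hI X hX ρ hρ (tr_zs_all hMlf hc htr)⟩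

end Lims

/-! ### Conservativity by finite homomorphisms -/

/-- Every finite part of the second chase maps into the first chase. -/
theorem cqConservative_iff {T1 T2 : List TGD} {SD SQ : Schema} (h2 : ∀ t ∈ T2, t.wf) :
    CQConservative T1 T2 SD SQ ↔ ∀ D, IsDatabase D SD → ∀ F ⊆ chase T2 D, F.Finite →
      ∃ h, DBPres h ∧ IsHomOn SQ h F (chase T1 D) := by
  classical
  constructor
  · intro H D hD F hF hfin
    have hfact := chase_fact (T := T2) hD.1.1 h2 fun f hf => (hD.1.2 f hf).1
    let e : Term → ℕ := Encodable.encode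
    let δ : ℕ → Term := fun n => (Encodable.decode n).getD (.const 0)
    have hδ : ∀ t, δ (e t) = t := fun t => by simp [δ, e]
    let L := hfin.toFinset.toList.filter fun f => f.rel ∈ SQ
    have hL : ∀ f, f ∈ L ↔ f ∈ F ∧ f.rel ∈ SQ := fun f => by simp [L]
    let C := (L.flatMap Fct.args).filter fun t => t.isConst
    have hC : ∀ n, Term.const n ∈ C ↔ ∃ f ∈ L, Term.const n ∈ f.args := fun n => by
      simp only [C, List.mem_filter, decide_eq_true_eq, List.mem_flatMap]
      exact and_iff_left trivial
    have hC' : ∀ t ∈ C, ∃ n, t = Term.const n := fun t ht => by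
      have := of_decide_eq_true (List.mem_filter.1 ht).2
      rcases t with n | n
      · exact ⟨n, rfl⟩
      · exact this.elim
    have hadom : ∀ t ∈ C, t ∈ adom D := fun t ht => by
      obtain ⟨n, rfl⟩ := hC' t ht
      obtain ⟨f, hf, hn⟩ := (hC n).1 ht
      exact (hfact f (hF ((hL f).1 hf).1)).2.2 n hn
    have hinst : ∀ f : Fct, (Atom.inst δ ⟨f.rel, f.args.map e⟩) = f := fun f => by
      simp only [Atom.inst, List.map_map]
      have : δ ∘ e = id := funext hδ
      rw [this, List.map_id]
    obtain ⟨-, h, hh, hans⟩ := H D hD ⟨L.map fun f => ⟨f.rel, f.args.map e⟩, C.map e⟩ (by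
        intro a ha
        obtain ⟨f, hf, rfl⟩ := List.mem_map.1 ha
        have := (hfact f (hF ((hL f).1 hf).1)).1
        exact ⟨((hL f).1 hf).2, by simpa [Atom.wf, Fct.wf] using this⟩) C
      ⟨hadom, δ, fun a ha => by
        obtain ⟨f, hf, rfl⟩ := List.mem_map.1 ha
        rw [hinst]
        exact hF ((hL f).1 hf).1, by
        simp only [List.map_map]
        have : δ ∘ e = id := funext hδ
        rw [this, List.map_id]⟩
    simp only [List.map_map] at hans
    have hid : ∀ t ∈ C, h (e t) = t := fun t ht => by
      have : C.map (h ∘ e) = C.map id := by rw [hans, List.map_id]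
      exact List.map_inj_left.1 this t ht
    refine ⟨fun t => if t.isConst then t else h (e t), fun n => by simp [Term.isConst],
      fun f hf hQ => ?_⟩
    have hfL := (hL f).2 ⟨hf, hQ⟩
    have := hh _ (List.mem_map.2 ⟨f, hfL, rfl⟩)
    rw [Atom.inst, List.map_map] at this
    convert this using 1
    rw [Fct.map]
    congr 1
    refine List.map_congr_left fun t ht => ?_
    split
    · rename_i hc
      rcases t with n | n
      · exact (hid _ ((hC n).2 ⟨f, hfL, ht⟩)).symm
      · exact hc.elim
    · rfl
  · rintro H D hD q hq c ⟨hc, g, hg, rfl⟩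
    refine ⟨hc, ?_⟩
    obtain ⟨h, hh, hhom⟩ := H D hD {f | f ∈ q.atoms.map (Atom.inst g)} (fun f hf => by
      obtain ⟨a, ha, rfl⟩ := List.mem_map.1 hf
      exact hg a ha) (List.finite_toSet _)
    refine ⟨fun i => h (g i), fun a ha => ?_, List.map_congr_left fun i hi => ?_⟩
    · have := hhom _ (List.mem_map.2 ⟨a, ha, rfl⟩) (hq a ha).1
      simpa [Fct.map, Atom.inst, Function.comp_def] using this
    · obtain ⟨f, hf, hm⟩ := hc (g i) (List.mem_map.2 ⟨i, hi, rfl⟩)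
      have := (hD.1.2 f hf).2 _ hm
      rcases hgi : g i with n | n
      · exact hh n
      · rw [hgi] at this
        exact this.elim

/-! ### Finite support of simulations -/

section Support

variable {w : ℕ} {U : Pt} {Q : List RelSym} {ℓ : Ty → Pt → ℕ → Ty} {X Y : Type}

theorem finite_support_tr {N : Str RelSym X} {M : Str RelSym Y} {Z : X → Ty → Prop}
    {Z' : Y → Ty → Prop} (hZ : ∀ x τ, Z x τ → ∃ F ⊆ N, F.Finite ∧ ∀ G : X → Y,
      (∀ φ ∈ F, φ.1 ∈ Q → mapA G φ ∈ M) → Z' (G x) τ) {P : LPt} {x : X} (h : Tr (LM Q N Z) P x) :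
    ∃ F ⊆ N, F.Finite ∧ ∀ G : X → Y, (∀ φ ∈ F, φ.1 ∈ Q → mapA G φ ∈ M) →
      Tr (LM Q M Z') P (G x) := by
  obtain ⟨f, rfl, hf⟩ := h
  have : ∀ a ∈ P, ∃ F ⊆ N, F.Finite ∧ ∀ G : X → Y, (∀ φ ∈ F, φ.1 ∈ Q → mapA G φ ∈ M) →
      mapA G (mapA f a) ∈ LM Q M Z' := fun a ha => by
    rcases hf a ha with ⟨ψ, h1, h2, h3⟩ | ⟨y, τ, h1, h3⟩
    · refine ⟨{ψ}, by simpa using h1, Set.finite_singleton _, fun G hG => ?_⟩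
      rw [← h3]
      exact Or.inl ⟨_, hG ψ rfl h2, h2, rfl⟩
    · obtain ⟨F, hF, hfin, hG⟩ := hZ y τ h1
      refine ⟨F, hF, hfin, fun G h => ?_⟩
      rw [← h3]
      exact Or.inr ⟨_, τ, hG G h, rfl⟩
  choose! F hF hfin hG using this
  refine ⟨⋃ a ∈ {a | a ∈ P}, F a, Set.iUnion₂_subset hF,
    Set.Finite.biUnion (List.finite_toSet P) hfin, fun G h => ⟨fun i => G (f i), rfl,
      fun a ha => ?_⟩⟩
  have := hG a ha G fun φ hφ => h φ (Set.mem_biUnion (show a ∈ {a | a ∈ P} from ha) hφ)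
  rwa [mapA_mapA] at this

theorem finite_support_zs {N : Str RelSym X} {M : Str RelSym Y} {Z : X → Ty → Prop}
    (hZ : Sim w U Q ℓ N Z) (n : ℕ) : ∀ x τ, Z x τ → ∃ F ⊆ N, F.Finite ∧ ∀ G : X → Y,
      (∀ φ ∈ F, φ.1 ∈ Q → mapA G φ ∈ M) → Zs w U Q ℓ M n (G x) τ := by
  induction n with
  | zero => exact fun x τ h => ⟨∅, Set.empty_subset _, Set.finite_empty, fun _ _ => (hZ x τ h).1⟩
  | succ n ih =>
    intro x τ h
    choose! F hF hfin hG using fun p hp => finite_support_tr ih ((hZ x τ h).2 p hp)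
    refine ⟨⋃ p ∈ {p | p ∈ τ}, F p, Set.iUnion₂_subset hF,
      Set.Finite.biUnion (List.finite_toSet τ) hfin, fun G h' => ⟨(hZ x τ h).1, fun p hp => ?_⟩⟩
    exact hG p hp G fun φ hφ => h' φ (Set.mem_biUnion (show p ∈ {p | p ∈ τ} from hp) hφ)

end Support

/-! ### Characterisation of conservativity -/

/-- The database part of a tree uses only symbols from `S`. -/
def Nd.Over (S : List RelSym) : Nd → Prop
  | .st _ _ => True
  | .dn B ch => (∀ a ∈ B, a.1 ∈ S) ∧ ∀ b, (ch b).Over S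

/-- The states of trees without database part. -/
def states (U : Pt) : Set Nd := {s | ∃ σ ∈ tys U, ∃ ps ∈ tys U, s = .st σ ps}

/-- Trees representing models of databases over `S`. -/
structure Adm (w : ℕ) (U : Pt) (S : List RelSym) (c : Ty → Ty) (t : Nd) : Prop where
  good : t.Good w U c
  full : t.Full
  db : t.Over S

/-- The pattern pairs `Ts` express the dependencies `T`. -/
structure Expr (U : Pt) (T : List TGD) (Ts : List (Pt × Pt)) : Prop where
  wf : ∀ t ∈ T, t.wf
  pats : ∀ t ∈ Ts, t.1 ∈ U.sublists ∧ t.2 ∈ U.sublists ∧ ∃ a ∈ t.1, 0 ∈ a.2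
  sat : ∀ (X : Type) (M : Str RelSym X), Mod Ts M ↔ ∀ t ∈ T, Sat M t

/-- There is a tree witnessing the failure of conservativity. In case `hm` holds, this is about
homomorphisms, otherwise about finite parts. -/
def Bad (hm : Prop) (w : ℕ) (U : Pt) (S Q : List RelSym) (c₁ : Ty → Ty) (ℓ₁ : Ty → Pt → ℕ → Ty)
    (c₂ : Ty → Ty) (ℓ₂ : Ty → Pt → ℕ → Ty) : Prop :=
  (∃ t, Adm w U S c₁ t ∧
    ¬ ∃ I, TopG I ∧ Ann w U Q ℓ₁ ℓ₂ t I ∧ [lbl (alpha w U c₂ t)] ∈ I.1) ∨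
  ∃ X ∈ LC w U Q, ∃ 𝒢 ⊆ states U, (∀ s ∈ 𝒢, ∀ b < w, s.chd ℓ₁ b ∈ 𝒢) ∧
    (hm ∨ ¬ Lim w U Q ℓ₁ ℓ₂ 𝒢 X) ∧ ∃ t, Adm w U S c₁ t ∧ t.In w 𝒢 ∧
      Free w U Q ℓ₂ (alpha w U c₂ t) X ∧ ¬ ∃ I, TopG I ∧ ∃ n, AnnX w U Q ℓ₁ ℓ₂ X n t I

section Main

variable {w : ℕ} {U : Pt} {S Q : List RelSym} {T1 T2 : List TGD} {Ts₁ Ts₂ : List (Pt × Pt)}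
  {c₁ c₂ : Ty → Ty} {ℓ₁ ℓ₂ : Ty → Pt → ℕ → Ty}

theorem states_finite (U : Pt) : (states U).Finite := by
  have : states U ⊆ ⋃ σ ∈ {σ | σ ∈ tys U}, (fun ps => Nd.st σ ps) '' {ps | ps ∈ tys U} := by
    rintro s ⟨σ, hσ, ps, hps, rfl⟩
    exact Set.mem_biUnion hσ ⟨ps, hps, rfl⟩
  exact (Set.Finite.biUnion (List.finite_toSet _) fun σ _ =>
    (List.finite_toSet _).image _).subset this

theorem Closed.of_states {𝒢 : Set Nd} (h : 𝒢 ⊆ states U) (h' : ∀ s ∈ 𝒢, ∀ b < w, s.chd ℓ₁ b ∈ 𝒢) :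
    Closed w ℓ₁ 𝒢 := ⟨(states_finite U).subset h, h'⟩

theorem chd_mem_states (hℓ : ∀ σ p b, ℓ₁ σ p b ∈ tys U) {s : Nd} (hs : s ∈ states U) (b : ℕ) :
    s.chd ℓ₁ b ∈ states U := by
  obtain ⟨σ, hσ, ps, hps, rfl⟩ := hs
  rcases ps with _ | ⟨p, ps⟩
  · exact ⟨σ, hσ, [], hps, rfl⟩
  · change (if b = 0 then Nd.st σ ps else Nd.st (ℓ₁ σ p b) (ℓ₁ σ p b)) ∈ states U
    split
    · exact ⟨σ, hσ, ps, List.mem_sublists.2 ((List.sublist_cons_self p ps).trans (List.mem_sublists.1 hps)), rfl⟩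
    · exact ⟨_, hℓ _ _ _, _, hℓ _ _ _, rfl⟩

theorem strip_unf {c : Ty → Ty} {ℓ : Ty → Pt → ℕ → Ty} {t : Nd} (ht : t.Good w U c)
    (ho : t.Over S) : ∀ φ ∈ (Nd.coalg ℓ).Unf w t.strip, ∃ a ∈ U, a.1 ∈ S ∧ ∃ f, mapA f a = φ := by
  induction t with
  | st σ ps =>
    intro φ hφ
    rw [Unf_leaf (show (Nd.st σ ps).strip.IsLeaf from rfl)] at hφ
    exact hφ.elim
  | dn B ch ih =>
    intro φ hφ
    rcases Coalg.mem_Unf.1 hφ with ⟨a, ha, rfl⟩ | ⟨b, hb, ψ, hψ, rfl⟩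
    · exact ⟨a, mem_pats ht.1 ha, ho.1 a ha, _, rfl⟩
    · obtain ⟨a, ha, haS, f, rfl⟩ := ih b (ht.2.1 b) (ho.2 b) ψ hψ
      exact ⟨a, ha, haS, _, (mapA_mapA _ _ _).symm⟩

/-- The database represented by a tree. -/
theorem exists_database (hS₁ : Sys w U Ts₁ c₁ ℓ₁) (hS₂ : Sys w U Ts₂ c₂ ℓ₂) (hU : Uni w U)
    (hE₁ : Expr U T1 Ts₁) (hE₂ : Expr U T2 Ts₂)
    (hwf : ∀ a ∈ U, a.2.length = a.1.arity ∧ 1 ≤ a.1.arity) {t : Nd} (ht : Adm w U S c₁ t) :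
    ∃ D : Inst, IsDatabase D {r | r ∈ S} ∧ Mod Ts₂ (toStr (chase T2 D)) ∧
      (∀ p ∈ alpha w U c₂ t, Tr (toStr (chase T2 D)) p (.const (Encodable.encode ([] : List ℕ)))) ∧
      ∀ F : Inst, ∀ h, DBPres h → IsHomOn {r | r ∈ Q} h F (chase T1 D) → ∃ G : Term → List ℕ,
        G (.const (Encodable.encode ([] : List ℕ))) = [] ∧
        ∀ φ ∈ toStr F, φ.1 ∈ Q → mapA G φ ∈ (Nd.coalg ℓ₁).Unf w t := by
  let ι : List ℕ → Term := fun x => .const (Encodable.encode x)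
  let dec : Term → List ℕ := fun t => match t with
    | .const n => (Encodable.decode n).getD []
    | .null _ => []
  have hdec : ∀ x, dec (ι x) = x := fun x => by simp [dec, ι]
  let D : Inst := (fun φ : RelSym × List (List ℕ) => (⟨φ.1, φ.2.map ι⟩ : Fct)) ''
    (Nd.coalg ℓ₁).Unf w t.strip
  have hDfin : D.Finite := (strip_finite t).image _
  have hD : IsDatabase D {r | r ∈ S} := by
    refine ⟨⟨hDfin, ?_⟩, ?_⟩
    · rintro _ ⟨φ, hφ, rfl⟩
      obtain ⟨a, ha, -, f, rfl⟩ := strip_unf ht.good ht.db φ hφ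
      refine ⟨by simpa [Fct.wf, mapA] using hwf a ha, fun t ht => ?_⟩
      obtain ⟨x, -, rfl⟩ := List.mem_map.1 ht
      trivial
    · rintro _ ⟨φ, hφ, rfl⟩
      obtain ⟨a, -, ha, f, rfl⟩ := strip_unf ht.good ht.db φ hφ
      exact ha
  have hM2 : Mod Ts₂ (toStr (chase T2 D)) := (hE₂.sat _ _).2 fun t ht => chase_sat hDfin ht
  refine ⟨D, hD, hM2, ?_, fun F h hh hhom => ?_⟩
  · refine alpha_sound hS₂ hM2 (ℓ := ℓ₂) (t := t) (h := ι) fun φ hφ => ?_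
    have hφ' : φ ∈ (Nd.coalg ℓ₁).Unf w t.strip := by
      have : ∀ t : Nd, ∀ n, (Nd.coalg ℓ₂).UnfN w n t.strip ⊆ (Nd.coalg ℓ₁).UnfN w n t.strip := by
        intro t n
        induction n generalizing t with
        | zero => exact fun _ h => h
        | succ n ih =>
          cases t with
          | st σ ps =>
            rw [UnfN_leaf (show (Nd.st σ ps).strip.IsLeaf from rfl)]
            exact Set.empty_subset _
          | dn B ch =>
            rintro _ (h | ⟨b, hb, ψ, hψ, rfl⟩)
            · exact Or.inl h
            · exact Or.inr ⟨b, hb, ψ, ih _ hψ, rfl⟩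
      obtain ⟨n, hn⟩ := hφ
      exact ⟨n, this t n hn⟩
    exact subset_chase T2 hDfin ⟨φ, hφ', rfl⟩
  · have hM : ∀ t' ∈ T1, Sat ((Nd.coalg ℓ₁).Unf w t) t' :=
      (hE₁.sat _ _).1 (mod_unf hS₁ hU hE₁.pats ht.good ht.full)
    obtain ⟨g, hg, hg'⟩ := chase_universal hDfin hE₁.wf hM dec (by
      rintro ⟨r, l⟩ ⟨φ, hφ, heq⟩
      simp only [Fct.mk.injEq] at heq
      obtain ⟨rfl, rfl⟩ := heq
      have : mapA dec (φ.1, φ.2.map ι) = φ := by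
        refine Prod.ext rfl ?_
        simp only [mapA, List.map_map]
        rw [show dec ∘ ι = id from funext hdec, List.map_id]
      rw [this]
      exact strip_sub hφ)
    refine ⟨fun x => g (h x), ?_, fun φ hφ hQ => ?_⟩
    · change g (h (ι [])) = []
      rw [show h (ι []) = ι [] from hh _]
      exact (hg _).trans (hdec [])
    · have := hg' (φ.1, φ.2.map h) (hhom _ hφ hQ)
      rwa [show mapA g (φ.1, φ.2.map h) = mapA g (mapA h φ) from rfl, mapA_mapA] at this

variable (hS₁ : Sys w U Ts₁ c₁ ℓ₁) (hS₂ : Sys w U Ts₂ c₂ ℓ₂) (hU : Uni w U)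
  (hE₁ : Expr U T1 Ts₁) (hE₂ : Expr U T2 Ts₂)
include hS₁ hS₂ hU hE₁ hE₂

theorem not_bad_of_hom (hwf : ∀ a ∈ U, a.2.length = a.1.arity ∧ 1 ≤ a.1.arity)
    (H : HomConservative T1 T2 {r | r ∈ S} {r | r ∈ Q}) :
    ¬ Bad True w U S Q c₁ ℓ₁ c₂ ℓ₂ := by
  have key : ∀ t, Adm w U S c₁ t → ∃ Z, Sim w U Q ℓ₂ ((Nd.coalg ℓ₁).Unf w t) Z ∧
      Z [] (alpha w U c₂ t) ∧ ∀ P, Free w U Q ℓ₂ (alpha w U c₂ t) P →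
        ∃ e, Tr (LM Q ((Nd.coalg ℓ₁).Unf w t) Z) P e := fun t ht => by
    obtain ⟨D, hD, hM, hα, hG⟩ := exists_database hS₁ hS₂ hU hE₁ hE₂ hwf (Q := Q) ht
    obtain ⟨h, hh, hhom⟩ := H D hD
    obtain ⟨G, hG0, hG⟩ := hG _ h hh hhom
    refine ⟨_, (sim_true hS₂ hM).push hG, ⟨_, hG0, alpha_mem hS₂ t, hα⟩, fun P hP => ?_⟩
    obtain ⟨e, he⟩ := free_true hS₂ hM (alpha_mem hS₂ t) hα hP
    exact ⟨_, he.map (LM_map hG fun x τ hx => ⟨x, rfl, hx⟩)⟩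
  rintro (⟨t, ht, hno⟩ | ⟨X, hX, 𝒢, -, -, -, t, ht, -, hfree, hno⟩)
  · obtain ⟨Z, hZ, h0, -⟩ := key t ht
    obtain ⟨I, h1, h2, h3, -⟩ := exists_topG_of_sim hS₁ hU ht.good hZ
    exact hno ⟨I, h1, h2, h3 _ h0⟩
  · obtain ⟨Z, hZ, -, h0⟩ := key t ht
    obtain ⟨I, h1, -, -, h4⟩ := exists_topG_of_sim hS₁ hU ht.good hZ
    exact hno ⟨I, h1, h4 X hX (h0 X hfree)⟩

theorem not_bad_of_cq (hwf : ∀ a ∈ U, a.2.length = a.1.arity ∧ 1 ≤ a.1.arity)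
    (H : CQConservative T1 T2 {r | r ∈ S} {r | r ∈ Q}) :
    ¬ Bad False w U S Q c₁ ℓ₁ c₂ ℓ₂ := by
  rw [cqConservative_iff hE₂.wf] at H
  have key : ∀ t, Adm w U S c₁ t → ∀ n, Zs w U Q ℓ₂ ((Nd.coalg ℓ₁).Unf w t) n [] (alpha w U c₂ t) ∧
      ∀ P, Free w U Q ℓ₂ (alpha w U c₂ t) P →
        ∃ e, Tr (LM Q ((Nd.coalg ℓ₁).Unf w t) (Zs w U Q ℓ₂ ((Nd.coalg ℓ₁).Unf w t) n)) P e :=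
    fun t ht n => by
    obtain ⟨D, hD, hM, hα, hG⟩ := exists_database hS₁ hS₂ hU hE₁ hE₂ hwf (Q := Q) ht
    have hfs := finite_support_zs (M := (Nd.coalg ℓ₁).Unf w t) (sim_true hS₂ hM (Q := Q)) n
    have hmap : ∀ F ⊆ toStr (chase T2 D), F.Finite → ∃ G : Term → List ℕ,
        G (.const (Encodable.encode ([] : List ℕ))) = [] ∧
        ∀ φ ∈ F, φ.1 ∈ Q → mapA G φ ∈ (Nd.coalg ℓ₁).Unf w t := fun F hF hfin => by
      obtain ⟨h, hh, hhom⟩ := H D hD ((fun φ => (⟨φ.1, φ.2⟩ : Fct)) '' F)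
        (by rintro _ ⟨φ, hφ, rfl⟩; exact hF hφ) (hfin.image _)
      obtain ⟨G, h0, hG⟩ := hG _ h hh hhom
      exact ⟨G, h0, fun φ hφ => hG φ ⟨φ, hφ, rfl⟩⟩
    refine ⟨?_, fun P hP => ?_⟩
    · obtain ⟨F, hF, hfin, hFG⟩ := hfs (.const (Encodable.encode ([] : List ℕ))) _
        ⟨alpha_mem hS₂ t, hα⟩
      obtain ⟨G, h0, hG⟩ := hmap F hF hfin
      exact h0 ▸ hFG G hG
    · obtain ⟨e, he⟩ := free_true hS₂ hM (alpha_mem hS₂ t) hα hP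
      obtain ⟨F, hF, hfin, hFG⟩ := finite_support_tr hfs he
      obtain ⟨G, h0, hG⟩ := hmap F hF hfin
      exact ⟨_, hFG G hG⟩
  rintro (⟨t, ht, hno⟩ | ⟨X, hX, 𝒢, h𝒢, h𝒢', hlim, t, ht, hin, hfree, hno⟩)
  · obtain ⟨I, h1, h2, h3, -⟩ := exists_topG_of_sim hS₁ hU ht.good
      (sim_zs_all (ℓ := ℓ₂) (Q := Q) hU (lfin_unf t))
    exact hno ⟨I, h1, h2, h3 _ fun n => (key t ht n).1⟩
  · rcases exists_annX_or_lim hS₁ hU (Closed.of_states h𝒢 h𝒢') ht.good hin hX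
      fun n => (key t ht n).2 X hfree with h | h
    · exact hno h
    · exact hlim.elim id fun h' => h' h

end Main

section Main

variable {w : ℕ} {U : Pt} {S Q : List RelSym} {T1 T2 : List TGD} {Ts₁ Ts₂ : List (Pt × Pt)}
  {c₁ c₂ : Ty → Ty} {ℓ₁ ℓ₂ : Ty → Pt → ℕ → Ty}

theorem Real.over {X : Type} {N D : Str RelSym X} (hD : ∀ φ ∈ D, φ.1 ∈ S) {t : Nd} {d : X}
    (h : Real U N D t d) : t.Over S := by
  induction t generalizing d with
  | st σ ps => trivial
  | dn B ch ih =>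
    obtain ⟨-, δ, -, hB, hch⟩ := h
    exact ⟨fun a ha => hD _ (hB a ha), fun b => ih b (hch b)⟩

/-- The states occurring in a tree. -/
def Nd.occStates (w : ℕ) (ℓ : Ty → Pt → ℕ → Ty) (t : Nd) : Set Nd :=
  {s | (∃ x : List ℕ, (∀ i ∈ x, i < w) ∧ (Nd.coalg ℓ).sub t x = s) ∧ ∃ σ ps, s = .st σ ps}

theorem Nd.in_occStates {ℓ : Ty → Pt → ℕ → Ty} (t : Nd) : t.In w (t.occStates w ℓ) := by
  suffices ∀ s x, (∀ i ∈ x, i < w) → (Nd.coalg ℓ).sub t x = s → s.In w (t.occStates w ℓ) from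
    this t [] (by simp) rfl
  intro s
  induction s with
  | st σ ps => exact fun x hx h => ⟨⟨x, hx, h⟩, σ, ps, rfl⟩
  | dn B ch ih =>
    intro x hx h b hb
    refine ih b (x ++ [b]) (fun i hi => ?_) ?_
    · rcases List.mem_append.1 hi with hi | hi
      · exact hx i hi
      · rwa [List.mem_singleton.1 hi]
    · rw [Coalg.sub_append, h]
      rfl

theorem Nd.occStates_chd {ℓ : Ty → Pt → ℕ → Ty} {t : Nd} :
    ∀ s ∈ t.occStates w ℓ, ∀ b < w, s.chd ℓ b ∈ t.occStates w ℓ := by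
  rintro _ ⟨⟨x, hx, h⟩, σ, ps, rfl⟩ b hb
  refine ⟨⟨x ++ [b], fun i hi => ?_, by rw [Coalg.sub_append, h]; rfl⟩, ?_⟩
  · rcases List.mem_append.1 hi with hi | hi
    · exact hx i hi
    · rwa [List.mem_singleton.1 hi]
  · rcases ps with _ | ⟨p, ps⟩
    · exact ⟨_, _, rfl⟩
    · change ∃ σ' ps', (if b = 0 then Nd.st σ ps else _) = Nd.st σ' ps'
      split <;> exact ⟨_, _, rfl⟩

theorem Nd.occStates_subset {c : Ty → Ty} {ℓ : Ty → Pt → ℕ → Ty} (hℓ : ∀ σ p b, ℓ σ p b ∈ tys U)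
    {t : Nd} (ht : t.Good w U c) (hf : t.Full) : t.occStates w ℓ ⊆ states U := by
  rintro _ ⟨⟨x, -, h⟩, σ, ps, rfl⟩
  have key : ∀ (x : List ℕ) (t : Nd), (t.Good w U c ∧ t.Full ∨ t ∈ states U) →
      (Nd.coalg ℓ).sub t x = .st σ ps → Nd.st σ ps ∈ states U := by
    intro x
    induction x with
    | nil =>
      rintro t (⟨ht, hf⟩ | h) heq
      · have heq : t = .st σ ps := heq
        subst heq
        exact ⟨σ, ht.1, ps, (show ps = σ from hf) ▸ ht.1, rfl⟩
      · exact (show t = _ from heq) ▸ h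
    | cons b x ih =>
      intro t ht heq
      refine ih (t.chd ℓ b) ?_ heq
      rcases ht with ⟨ht, hf⟩ | h
      · rcases t with ⟨σ, ps⟩ | ⟨B, ch⟩
        · refine Or.inr (chd_mem_states hℓ ⟨σ, ht.1, ps, ?_, rfl⟩ b)
          exact (show ps = σ from hf) ▸ ht.1
        · exact Or.inl ⟨ht.2.1 b, hf b⟩
      · exact Or.inr (chd_mem_states hℓ h b)
  exact key x t (Or.inl ⟨ht, hf⟩) h

theorem toStr_mono {I J : Inst} (h : I ⊆ J) : toStr I ⊆ toStr J := fun _ hφ => h hφ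

/-- Maps on the parts of a join assemble to a database-preserving homomorphism. -/
theorem exists_dbPres {D F N : Inst} {h : Term → Term × List ℕ} {G : Term → List ℕ → Term}
    {W : Term → Str RelSym (List ℕ)} (hh : ∀ n, h (.const n) = (.const n, []))
    (hG0 : ∀ d, G d [] = d) (hDN : D ⊆ N)
    (hhom : ∀ φ ∈ toStr F, (∃ ψ ∈ toStr D, mapA (fun d => (d, ([] : List ℕ))) ψ = mapA h φ) ∨
      ∃ d, ∃ ψ ∈ W d, mapA (fun x => (d, x)) ψ = mapA h φ)
    (hG : ∀ d, ∀ ψ ∈ W d, ψ.1 ∈ Q → mapA (G d) ψ ∈ toStr N) :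
    ∃ g, DBPres g ∧ IsHomOn {r | r ∈ Q} g F N := by
  refine ⟨fun x => G (h x).1 (h x).2, fun n => by
    change G (h (.const n)).1 (h (.const n)).2 = _
    rw [hh, hG0], fun f hf hQ => ?_⟩
  rcases hhom (f.rel, f.args) hf with ⟨ψ, hψ, heq⟩ | ⟨d, ψ, hψ, heq⟩
  · have h1 : ψ.1 = f.rel := congrArg Prod.fst heq
    have h2 : ψ.2.map (fun d => (d, ([] : List ℕ))) = f.args.map h := congrArg Prod.snd heq
    have : f.map (fun x => G (h x).1 (h x).2) = ⟨ψ.1, ψ.2⟩ := by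
      rw [Fct.map, h1, show (fun x => G (h x).1 (h x).2) = (fun y => G y.1 y.2) ∘ h from rfl,
        ← List.map_map, ← h2, List.map_map,
        show (fun y : Term × List ℕ => G y.1 y.2) ∘ (fun d => (d, [])) = id from funext hG0,
        List.map_id]
    rw [this]
    exact hDN hψ
  · have h1 : ψ.1 = f.rel := congrArg Prod.fst heq
    have h2 : ψ.2.map (fun x => (d, x)) = f.args.map h := congrArg Prod.snd heq
    have := hG d ψ hψ (h1 ▸ hQ)
    have heq' : f.map (fun x => G (h x).1 (h x).2) = ⟨ψ.1, ψ.2.map (G d)⟩ := by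
      rw [Fct.map, h1, show (fun x => G (h x).1 (h x).2) = (fun y => G y.1 y.2) ∘ h from rfl,
        ← List.map_map, ← h2, List.map_map]
      rfl
    rw [heq']
    exact this

variable (hS₁ : Sys w U Ts₁ c₁ ℓ₁) (hS₂ : Sys w U Ts₂ c₂ ℓ₂) (hU : Uni w U)
  (hE₁ : Expr U T1 Ts₁) (hE₂ : Expr U T2 Ts₂)
include hS₁ hS₂ hU hE₁ hE₂

/-- The second chase maps to the join of unfoldings of types derived from trees. -/
theorem exists_join {D : Inst} (hD : IsDatabase D {r | r ∈ S}) : ∃ t : Term → Nd,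
    (∀ d, Adm w U S c₁ (t d)) ∧ (∀ d, ∃ G, G [] = d ∧ ∀ φ ∈ (Nd.coalg ℓ₁).Unf w (t d),
      mapA G φ ∈ toStr (chase T1 D)) ∧ ∃ h : Term → Term × List ℕ,
      (∀ n, h (.const n) = (.const n, [])) ∧ ∀ φ ∈ toStr (chase T2 D),
        mapA h φ ∈ join w ℓ₂ (toStr D) fun d => alpha w U c₂ (t d) := by
  have hDN := toStr_mono (subset_chase T1 hD.1.1)
  have hN : Mod Ts₁ (toStr (chase T1 D)) := (hE₁.sat _ _).2 fun t ht => chase_sat hD.1.1 ht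
  choose t ht hmax using exists_max_real (w := w) (U := U) (N := toStr (chase T1 D))
    (D := toStr D) c₂ hS₂.c_mem
  refine ⟨t, fun d => ⟨(ht d).good hS₁ hN hDN, (ht d).full, (ht d).over fun φ hφ => hD.2 _ hφ⟩,
    fun d => (ht d).exists_hom hS₁ hN hDN, ?_⟩
  have hM : Mod Ts₂ (join w ℓ₂ (toStr D) fun d => alpha w U c₂ (t d)) := by
    refine join_mod hS₂ hU hE₂.pats (fun d => good_alpha hS₂ _) fun B hB δ hδ q hq h => ?_
    refine hmax (δ 0) (.dn B fun b => t (δ b)) ⟨hB, δ, rfl, hδ, fun b => ht _⟩ (fun q' hq' => ?_) q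
      (alpha_dn hS₂ hq h)
    exact alpha_dn hS₂ (mem_tys (alpha_mem hS₂ _) hq') (comb_self hU.pos hq')
  obtain ⟨h, h1, h2⟩ := chase_universal hD.1.1 hE₂.wf ((hE₂.sat _ _).1 hM) (fun d => (d, []))
    fun φ hφ => Or.inl ⟨φ, hφ, rfl⟩
  exact ⟨h, h1, h2⟩

theorem hom_of_not_bad (H : ¬ Bad True w U S Q c₁ ℓ₁ c₂ ℓ₂) :
    HomConservative T1 T2 {r | r ∈ S} {r | r ∈ Q} := by
  intro D hD
  obtain ⟨t, ht, hG, h, hh, hhom⟩ := exists_join hS₁ hS₂ hU hE₁ hE₂ hD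
  have key : ∀ d, ∃ G : List ℕ → Term, G [] = d ∧ ∀ φ ∈ (Nd.coalg ℓ₂).Unf w
      (.st (alpha w U c₂ (t d)) (alpha w U c₂ (t d))), φ.1 ∈ Q → mapA G φ ∈ toStr (chase T1 D) :=
    fun d => by
    obtain ⟨G, hG0, hG⟩ := hG d
    obtain ⟨I, hI, hI1, hI2⟩ : ∃ I, TopG I ∧ Ann w U Q ℓ₁ ℓ₂ (t d) I ∧
        [lbl (alpha w U c₂ (t d))] ∈ I.1 := by
      by_contra hno
      exact H (Or.inl ⟨t d, ht d, hno⟩)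
    obtain ⟨Z, hZ, hZ'⟩ := (sim_of_topG hU hI).1 hI1
    obtain ⟨G', hG0', hG'⟩ := exists_hom_of_sim hU hS₂.ℓ_mem (sim_zmax (Q := Q) (ℓ := ℓ₂)
      (M := (Nd.coalg ℓ₁).Unf w (t d))) (α := alpha w U c₂ (t d)) (d := [])
      ⟨Z, hZ, hZ' _ (alpha_mem hS₂ _) hI2⟩ fun P hP => by
        have hPC : P ∈ LC w U Q := by
          obtain ⟨τ, hτ, p, hp, y, hy, rfl⟩ := hP
          exact mem_LC.2 ⟨LL_mem, LL_conn hU (mem_tys (hτ.mem_tys hS₂.ℓ_mem (alpha_mem hS₂ _)) hp) hy⟩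
        by_contra hno
        refine H (Or.inr ⟨P, hPC, (t d).occStates w ℓ₁, Nd.occStates_subset hS₁.ℓ_mem (ht d).good
          (ht d).full, Nd.occStates_chd, Or.inl trivial, t d, ht d, Nd.in_occStates _, hP, ?_⟩)
        rintro ⟨I, hI, n, hn⟩
        obtain ⟨Z, hZ, e, he⟩ := (sim_of_topG hU hI).2 P n hn
        exact hno ⟨e, he.mono (LM_mono fun x τ h => ⟨Z, hZ, h⟩)⟩
    refine ⟨fun x => G (G' x), (congrArg G hG0').trans hG0, fun φ hφ hQ => ?_⟩
    have := hG _ (hG' φ hφ hQ)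
    rwa [mapA_mapA] at this
  choose G hG0 hG using key
  exact exists_dbPres hh hG0 (subset_chase T1 hD.1.1) hhom hG

/-- A tree none of whose occurrences gives failure allows approximating simulations. -/
theorem cq_of_not_bad (H : ¬ Bad False w U S Q c₁ ℓ₁ c₂ ℓ₂) :
    CQConservative T1 T2 {r | r ∈ S} {r | r ∈ Q} := by
  rw [cqConservative_iff hE₂.wf]
  intro D hD F hF hfin
  obtain ⟨t, ht, hG, h, hh, hhom⟩ := exists_join hS₁ hS₂ hU hE₁ hE₂ hD
  obtain ⟨n, hn⟩ : ∃ n, ∀ φ ∈ toStr F,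
      (∃ ψ ∈ toStr D, mapA (fun d => (d, ([] : List ℕ))) ψ = mapA h φ) ∨
      ∃ d, ∃ ψ ∈ (Nd.coalg ℓ₂).UnfN w n (.st (alpha w U c₂ (t d)) (alpha w U c₂ (t d))),
        mapA (fun x => (d, x)) ψ = mapA h φ := by
    clear hG hh
    induction F, hfin using Set.Finite.induction_on with
    | empty => exact ⟨0, fun φ h => h.elim⟩
    | @insert f F _ _ ih =>
      obtain ⟨n, hn⟩ := ih ((Set.subset_insert _ _).trans hF)
      rcases hhom (f.rel, f.args) (hF (Set.mem_insert _ _)) with h' | ⟨d, ψ, ⟨m, hm⟩, heq⟩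
      · refine ⟨n, fun φ hφ => ?_⟩
        rcases hφ with hφ | hφ
        · subst hφ
          exact Or.inl h'
        · exact hn φ hφ
      · refine ⟨max n m, fun φ hφ => ?_⟩
        rcases hφ with hφ | hφ
        · subst hφ
          exact Or.inr ⟨d, ψ, Coalg.UnfN_mono (le_max_right _ _) _ hm, heq⟩
        · rcases hn φ hφ with h' | ⟨d, ψ, hψ, heq⟩
          · exact Or.inl h'
          · exact Or.inr ⟨d, ψ, Coalg.UnfN_mono (le_max_left _ _) _ hψ, heq⟩
  have key : ∀ d, ∃ G : List ℕ → Term, G [] = d ∧ ∀ φ ∈ (Nd.coalg ℓ₂).UnfN w n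
      (.st (alpha w U c₂ (t d)) (alpha w U c₂ (t d))), φ.1 ∈ Q → mapA G φ ∈ toStr (chase T1 D) :=
    fun d => by
    obtain ⟨G, hG0, hG⟩ := hG d
    obtain ⟨I, hI, hI1, hI2⟩ : ∃ I, TopG I ∧ Ann w U Q ℓ₁ ℓ₂ (t d) I ∧
        [lbl (alpha w U c₂ (t d))] ∈ I.1 := by
      by_contra hno
      exact H (Or.inl ⟨t d, ht d, hno⟩)
    obtain ⟨Z, hZ, hZ'⟩ := (sim_of_topG hU hI).1 hI1
    obtain ⟨G', hG0', hG'⟩ := exists_hom_of_zs hU hS₂.ℓ_mem (Q := Q) (ℓ := ℓ₂)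
      (M := (Nd.coalg ℓ₁).Unf w (t d)) (α := alpha w U c₂ (t d)) (d := []) (n := n)
      (hZ.zs n _ _ (hZ' _ (alpha_mem hS₂ _) hI2)) fun P hP => by
        have hPC : P ∈ LC w U Q := by
          obtain ⟨τ, hτ, p, hp, y, hy, rfl⟩ := hP
          exact mem_LC.2 ⟨LL_mem, LL_conn hU (mem_tys (hτ.mem_tys hS₂.ℓ_mem (alpha_mem hS₂ _)) hp) hy⟩
        by_contra hno
        have hsub := Nd.occStates_subset (w := w) hS₁.ℓ_mem (ht d).good (ht d).full
        by_cases hlim : Lim w U Q ℓ₁ ℓ₂ ((t d).occStates w ℓ₁) P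
        · refine hno (hlim.tr_zs hU (B := U.sublists.length) (fun σ p b => ?_) (fun s hs => ?_)
            (fun s hs => hs.1) n)
          · exact (List.mem_sublists.1 (hS₁.ℓ_mem σ p b)).length_le
          · obtain ⟨σ, hσ, ps, hps, rfl⟩ := hsub hs
            exact ⟨σ, ps, rfl, (List.mem_sublists.1 hps).length_le⟩
        · refine H (Or.inr ⟨P, hPC, _, hsub, Nd.occStates_chd, Or.inr hlim, t d, ht d,
            Nd.in_occStates _, hP, ?_⟩)
          rintro ⟨I, hI, m, hm⟩
          obtain ⟨Z, hZ, e, he⟩ := (sim_of_topG hU hI).2 P m hm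
          exact hno ⟨e, he.mono (LM_mono fun x τ h => hZ.zs n _ _ h)⟩
    refine ⟨fun x => G (G' x), (congrArg G hG0').trans hG0, fun φ hφ hQ => ?_⟩
    have := hG _ (hG' φ hφ hQ)
    rwa [mapA_mapA] at this
  choose G hG0 hG using key
  exact exists_dbPres hh hG0 (subset_chase T1 hD.1.1) hn hG

end Main

/-! ### Primitive recursive functions and predicates -/

section Primitive

variable {α β γ : Type} [Primcodable α] [Primcodable β] [Primcodable γ]

/-- Primitive recursive functions. -/
@[fun_prop]
def PR {α β : Type} [Primcodable α] [Primcodable β] (f : α → β) : Prop := Primrec f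

/-- Primitive recursive predicates. -/
@[fun_prop]
def PP {α : Type} [Primcodable α] (p : α → Prop) : Prop := PrimrecPred p

@[fun_prop]
theorem PR.id : PR (fun a : α => a) := Primrec.id

@[fun_prop]
theorem PR.const (b : β) : PR (fun _ : α => b) := Primrec.const b

@[fun_prop]
theorem PR.comp {g : β → γ} {f : α → β} (hg : PR g) (hf : PR f) : PR fun a => g (f a) := Primrec.comp hg hf

@[fun_prop]
theorem PP.comp {g : β → Prop} {f : α → β} (hg : PP g) (hf : PR f) : PP fun a => g (f a) := PrimrecPred.comp hg hf

@[fun_prop]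
theorem PR.fst {f : α → β × γ} (hf : PR f) : PR fun a => (f a).1 := Primrec.fst.comp hf

@[fun_prop]
theorem PR.snd {f : α → β × γ} (hf : PR f) : PR fun a => (f a).2 := Primrec.snd.comp hf

@[fun_prop]
theorem PR.pair {f : α → β} {g : α → γ} (hf : PR f) (hg : PR g) : PR fun a => (f a, g a) := Primrec.pair hf hg

@[fun_prop]
theorem PP.const (b : Prop) : PP (fun _ : α => b) := by
  classical exact ⟨fun _ => inferInstance, Primrec.const _⟩

@[fun_prop]
theorem PP.and {p q : α → Prop} (hp : PP p) (hq : PP q) : PP fun a => p a ∧ q a := PrimrecPred.and hp hq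

@[fun_prop]
theorem PP.or {p q : α → Prop} (hp : PP p) (hq : PP q) : PP fun a => p a ∨ q a := PrimrecPred.or hp hq

@[fun_prop]
theorem PP.not {p : α → Prop} (hp : PP p) : PP fun a => ¬ p a  := PrimrecPred.not hp

/-- Implication. -/
def Imp (p q : Prop) : Prop := p → q

@[fun_prop]
theorem PP.imp {p q : α → Prop} (hp : PP p) (hq : PP q) : PP fun a => Imp (p a) (q a) := (PrimrecPred.or (PrimrecPred.not hp) hq).of_eq fun _ => imp_iff_not_or.symm

@[fun_prop]
theorem PP.eq {p q : α → β} (hp : PR p) (hq : PR q) : PP fun a => p a = q a := PrimrecRel.comp Primrec.eq hp hq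

/-- Bounded existential quantification. -/
def LEx (l : List β) (Q : β → Prop) : Prop := ∃ b ∈ l, Q b

/-- Bounded universal quantification. -/
def LAll (l : List β) (Q : β → Prop) : Prop := ∀ b ∈ l, Q b

@[fun_prop]
theorem PP.lex {l : α → List β} {Q : α → β → Prop} (hl : PR l)
    (hQ : PP fun x : α × β => Q x.1 x.2) : PP fun a => LEx (l a) fun b => Q a b :=
  PrimrecRel.comp (R := fun l a => ∃ b ∈ l, Q a b) (PrimrecRel.exists_mem_list
    (R := fun b a => Q a b) (hQ.comp (PR.pair PR.id.snd PR.id.fst))) hl Primrec.id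

@[fun_prop]
theorem PP.lall {l : α → List β} {Q : α → β → Prop} (hl : PR l)
    (hQ : PP fun x : α × β => Q x.1 x.2) : PP fun a => LAll (l a) fun b => Q a b :=
  PrimrecRel.comp (R := fun l a => ∀ b ∈ l, Q a b) (PrimrecRel.forall_mem_list
    (R := fun b a => Q a b) (hQ.comp (PR.pair PR.id.snd PR.id.fst))) hl Primrec.id

@[fun_prop]
theorem PP.mem {l : α → List β} {x : α → β} (hl : PR l) (hx : PR x) :
    PP fun a => x a ∈ l a := by
  refine PrimrecPred.of_eq (p := fun a => LEx (l a) fun y => x a = y) (show PP _ by fun_prop) ?_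
  simp [LEx]

@[fun_prop]
theorem PR.map {l : α → List β} {g : α → β → γ} (hl : PR l)
    (hg : PR fun x : α × β => g x.1 x.2) : PR fun a => (l a).map fun b => g a b :=
  Primrec.list_map hl hg

@[fun_prop]
theorem PR.flatMap {l : α → List β} {g : α → β → List γ} (hl : PR l)
    (hg : PR fun x : α × β => g x.1 x.2) : PR fun a => (l a).flatMap fun b => g a b :=
  Primrec.list_flatMap hl hg

@[fun_prop]
theorem PR.foldr {l : α → List β} {g : α → β → γ → γ} {d : α → γ} (hl : PR l)
    (hd : PR d) (hg : PR fun x : α × β × γ => g x.1 x.2.1 x.2.2) :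
    PR fun a => (l a).foldr (fun b c => g a b c) (d a) :=
  Primrec.list_foldr (h := fun a x => g a x.1 x.2) hl hd hg

@[fun_prop]
theorem PR.getD {l : α → List β} {n : α → ℕ} {d : β} (hl : PR l) (hn : PR n) :
    PR fun a => (l a).getD (n a) d :=
  (Primrec.list_getD d).comp hl hn

@[fun_prop]
theorem PR.range {n : α → ℕ} (hn : PR n) : PR fun a => List.range (n a) :=
  Primrec.list_range.comp hn

@[fun_prop]
theorem PR.cons {x : α → β} {l : α → List β} (hx : PR x) (hl : PR l) :
    PR fun a => x a :: l a := Primrec.list_cons.comp hx hl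

@[fun_prop]
theorem PR.append {l l' : α → List β} (hl : PR l) (hl' : PR l') :
    PR fun a => l a ++ l' a := Primrec.list_append.comp hl hl'

@[fun_prop]
theorem PR.length {l : α → List β} (hl : PR l) :
    PR fun a => (l a).length := Primrec.list_length.comp hl

@[fun_prop]
theorem PR.tail {l : α → List β} (hl : PR l) :
    PR fun a => (l a).tail := Primrec.list_tail.comp hl

@[fun_prop]
theorem PR.ite {p : α → Prop} [DecidablePred p] {f g : α → β} (hp : PP p) (hf : PR f) (hg : PR g) :
    PR fun a => if p a then f a else g a := Primrec.ite hp hf hg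

open Classical in
/-- Filtering with a proposition. -/
noncomputable def LF (l : List β) (Q : β → Prop) : List β := l.filter fun b => decide (Q b)

@[fun_prop]
theorem PR.lf {l : α → List β} {Q : α → β → Prop} (hl : PR l)
    (hQ : PP fun x : α × β => Q x.1 x.2) : PR fun a => LF (l a) fun b => Q a b := by
  classical
  exact (PrimrecRel.listFilter (R := fun b a => Q a b) (hQ.comp (PR.pair PR.id.snd PR.id.fst))).comp hl Primrec.id

@[fun_prop]
theorem PR.sublists {l : α → List β} (hl : PR l) : PR fun a => (l a).sublists := by
  have : ∀ l : List β, l.sublists = l.foldr (fun b s => s.flatMap fun x => [x, b :: x]) [[]] := by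
    intro l
    induction l with
    | nil => rfl
    | cons b l ih =>
      rw [List.sublists_cons]
      simp [ih]
  simp only [this]
  fun_prop

@[fun_prop]
theorem PR.sections {l : α → List (List β)} (hl : PR l) : PR fun a => (l a).sections := by
  have : ∀ l : List (List β), l.sections = l.foldr (fun b s => s.flatMap fun x => b.map fun y => y :: x) [[]] := by
    intro l
    induction l with
    | nil => rfl
    | cons b l ih =>
      simp [List.sections, ih]
  simp only [this]
  fun_prop

@[fun_prop]
theorem PP.lt {p q : α → ℕ} (hp : PR p) (hq : PR q) : PP fun a => p a < q a := PrimrecRel.comp Primrec.nat_lt hp hq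

@[fun_prop]
theorem PR.add {p q : α → ℕ} (hp : PR p) (hq : PR q) : PR fun a => p a + q a := Primrec.nat_add.comp hp hq

@[fun_prop]
theorem PR.inl {f : α → β} (hf : PR f) : PR fun a => (Sum.inl (f a) : β ⊕ γ) := Primrec.sumInl.comp hf

@[fun_prop]
theorem PR.inr {f : α → β} (hf : PR f) : PR fun a => (Sum.inr (f a) : γ ⊕ β) := Primrec.sumInr.comp hf


@[fun_prop]
theorem PR.mapA {ρ : Type} [Primcodable ρ] {a : α → ρ × List β} {g : α → β → γ} (ha : PR a)
    (hg : PR fun x : α × β => g x.1 x.2) : PR fun x => mapA (fun i => g x i) (a x) :=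
  PR.pair ha.fst (PR.map ha.snd hg)

@[fun_prop]
theorem PR.product {l : α → List β} {l' : α → List γ} (hl : PR l) (hl' : PR l') :
    PR fun a => (l a).product (l' a) := by
  unfold List.product
  fun_prop

@[fun_prop]
theorem PP.imply {p q : α → Prop} (hp : PP p) (hq : PP q) : PP fun a => p a → q a := PP.imp hp hq

@[fun_prop]
theorem PP.allLt {n : α → ℕ} {Q : α → ℕ → Prop} (hn : PR n) (hQ : PP fun x : α × ℕ => Q x.1 x.2) :
    PP fun a => ∀ b < n a, Q a b := by
  refine PrimrecPred.of_eq (p := fun a => LAll (List.range (n a)) (Q a)) (show PP _ by fun_prop) ?_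
  simp [LAll]

end Primitive

section

/-! ### Combination as a bounded formula -/

section Sections

variable {β : Type}

/-- There is a function with values from `L i` at `i < n` that satisfies `Φ`. -/
def LFun (n : ℕ) (L : ℕ → List β) (d : β) (Φ : (ℕ → β) → Prop) : Prop :=
  LEx ((List.range n).map L).sections fun l => Φ fun i => l.getD i d

theorem lFun_iff {n : ℕ} {L : ℕ → List β} {d : β} {Φ : (ℕ → β) → Prop} : LFun n L d Φ ↔
      ∃ f : ℕ → β, (∀ i < n, f i ∈ L i) ∧ (∀ i, n ≤ i → f i = d) ∧ Φ f := by
  constructor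
  · rintro ⟨l, hl, hΦ⟩
    rw [List.mem_sections, List.forall₂_iff_get] at hl
    obtain ⟨h1, h2⟩ := hl
    simp only [List.length_map, List.length_range] at h1
    refine ⟨_, fun i hi => ?_, fun i hi => ?_, hΦ⟩
    · have := h2 i (by omega) (by simpa using hi)
      rw [List.getD_eq_getElem _ _ (by omega)]
      simpa using this
    · exact List.getD_eq_default _ _ (by omega)
  · rintro ⟨f, h1, h2, hΦ⟩
    refine ⟨(List.range n).map f, ?_, ?_⟩
    · rw [List.mem_sections, List.forall₂_iff_get]
      exact ⟨by simp, fun i hi _ => by simpa using h1 i (by simpa using hi)⟩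
    · convert hΦ using 2 with i
      by_cases hi : i < n
      · rw [List.getD_eq_getElem _ _ (by simpa using hi)]
        simp
      · rw [List.getD_eq_default _ _ (by simpa using hi), h2 i (by omega)]

end Sections

variable {ρ : Type}

/-- The last clause of combination, for the values of the functions given by lists. -/
def combT (w : ℕ) (B : Pat ρ) (Ls : List (List (Pat ρ))) (b0 : ℕ) (q : Pat ρ) (loc : ℕ → ℕ)
    (ex : ℕ → Bool) (P : ℕ → Pat ρ) : Prop :=
  loc 0 = b0 ∧ ex 0 = true ∧
    (LAll (List.range w) fun b => LAll (P b) fun a' => LEx q fun a =>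
      (LAll a.2 fun i => loc i = b) ∧
        a' = mapA (rx ex) a) ∧
    LAll q fun a => ((LAll a.2 fun i => ex i = true) ∧
        mapA loc a ∈ B) ∨
      LEx (List.range w) fun b => (LAll a.2 fun i => loc i = b) ∧
        P b ∈ Ls.getD b [] ∧
        mapA (rx ex) a ∈ P b

/-- Combination, with all the quantifiers bounded. -/
def combL (w : ℕ) (B : Pat ρ) (Ls : List (List (Pat ρ))) (b0 : ℕ) (q : Pat ρ) : Prop :=
  LFun w (fun _ => List.range w) 0 fun loc => LFun w (fun _ => [true, false]) false fun ex =>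
  LFun w (fun b => [] :: Ls.getD b []) [] fun P => combT w B Ls b0 q loc ex P

theorem getD_map_range {β : Type} {Θ : ℕ → β} {w b : ℕ} {d : β} (hb : b < w) :
    ((List.range w).map Θ).getD b d = Θ b := by
  rw [List.getD_eq_getElem _ _ (by simpa using hb)]
  simp

theorem comb_iff_combL {w : ℕ} (hw : 0 < w) {B : Pat ρ} {Θ : ℕ → List (Pat ρ)} {b0 : ℕ}
    {q : Pat ρ} (hq : ∀ a ∈ q, ∀ i ∈ a.2, i < w) :
    comb w B (fun b P => P ∈ Θ b) b0 q ↔ combL w B ((List.range w).map Θ) b0 q := by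
  classical
  constructor
  · rintro ⟨loc, ex, P, h1, h2, h3, h4, h5⟩
    simp only [combL, lFun_iff]
    refine ⟨fun i => if i < w then loc i else 0, fun i hi => ?_, fun i hi => if_neg (by omega),
      fun i => if i < w then ex i else false, fun i _ => ?_, fun i hi => if_neg (by omega),
      fun b => if b < w ∧ P b ∈ Θ b then P b else [], fun b hb => ?_,
      fun b hb => if_neg (by omega), ?_⟩
    · simpa [hi] using h1 i
    · by_cases h : (if i < w then ex i else false) <;> simp [h]
    · rw [getD_map_range hb]
      by_cases h : P b ∈ Θ b <;> simp [hb, h]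
    have hr : ∀ a ∈ q, mapA (rx fun i => if i < w then ex i else false) a =
        mapA (rx ex) a := fun a ha => mapA_congr fun i hi => by
      simp [hq a ha i hi, rx]
    have hl : ∀ a ∈ q, ∀ b, (∀ i ∈ a.2, loc i = b) →
        ∀ i ∈ a.2, (if i < w then loc i else 0) = b := fun a ha b h i hi => by
      rw [if_pos (hq a ha i hi), h i hi]
    refine ⟨(if_pos hw).trans h2, (if_pos hw).trans h3, fun b hb a' ha' => ?_, fun a ha => ?_⟩
    · by_cases h : b < w ∧ P b ∈ Θ b
      · simp only [if_pos h] at ha'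
        obtain ⟨a, ha, h6, h7⟩ := h4 b a' ha'
        exact ⟨a, ha, hl a ha b h6, h7.trans (hr a ha).symm⟩
      · simp only [if_neg h] at ha'
        cases ha'
    · rcases h5 a ha with ⟨h6, h7⟩ | ⟨b, hb, h6, h7, h8⟩
      · refine Or.inl ⟨fun i hi => (if_pos (hq a ha i hi)).trans (h6 i hi), ?_⟩
        rwa [mapA_congr (g := loc) fun i hi => if_pos (hq a ha i hi)]
      · refine Or.inr ⟨b, List.mem_range.2 hb, hl a ha b h6, ?_, ?_⟩
        · simp only [getD_map_range hb]
          rwa [if_pos ⟨hb, h7⟩]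
        · simp only [hr a ha]
          rwa [if_pos ⟨hb, h7⟩]
  · intro h
    simp only [combL, lFun_iff] at h
    obtain ⟨loc, h1, h1', ex, h2, h2', P, h3, h3', h⟩ := h
    obtain ⟨h4, h5, h6, h7⟩ := h
    refine ⟨loc, ex, P, fun i => ?_, h4, h5, fun b a' ha' => ?_, fun a ha => ?_⟩
    · by_cases hi : i < w
      · exact List.mem_range.1 (h1 i hi)
      · rw [h1' i (by omega)]
        exact hw
    · by_cases hb : b < w
      · exact h6 b (List.mem_range.2 hb) a' ha'
      · rw [h3' b (by omega)] at ha'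
        cases ha'
    · rcases h7 a ha with h8 | ⟨b, hb, h8, h9, h10⟩
      · exact Or.inl h8
      · have hb := List.mem_range.1 hb
        refine Or.inr ⟨b, hb, h8, ?_, h10⟩
        rwa [getD_map_range hb] at h9

section

variable {α : Type} [Primcodable α] [Primcodable ρ]

@[fun_prop]
theorem PP.combL {w b0 : α → ℕ} {B q : α → Pat ρ} {Ls : α → List (List (Pat ρ))} (hw : PR w)
    (hB : PR B) (hL : PR Ls) (hb : PR b0) (hq : PR q) :
    PP fun x => combL (w x) (B x) (Ls x) (b0 x) (q x) := by
  unfold FrontierOne.combL FrontierOne.combT LFun rx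
  fun_prop

end

end

/-! ### The least type system -/

/-- Conditions on a consequence operator and a bound for the types of pattern elements. -/
structure PreSys (w : ℕ) (U : Pt) (Ts : List (Pt × Pt)) (c : Ty → Ty) (ℓ : Ty → Pt → ℕ → Ty) :
    Prop where
  nil : ∀ σ ∈ tys U, [] ∈ c σ
  sub : ∀ σ ∈ tys U, ∀ q ∈ σ, q ∈ c σ
  mod : ∀ σ ∈ tys U, ∀ t ∈ Ts, t.1 ∈ c σ → t.2 ∈ c σ
  c_comb : ∀ σ ∈ tys U, ∀ p ∈ c σ, ∀ q ∈ U.sublists,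
    comb w p (fun b P => P ∈ nx c ℓ σ p b) 0 q → q ∈ c σ
  ℓ_comb : ∀ σ ∈ tys U, ∀ p ∈ c σ, ∀ q ∈ U.sublists, ∀ b < w, b ≠ 0 →
    comb w p (fun b P => P ∈ nx c ℓ σ p b) b q → q ∈ ℓ σ p b
  c_cl : ∀ σ ∈ tys U, ∀ τ ∈ tys U, (∀ q ∈ τ, q ∈ c σ) → ∀ q ∈ c τ, q ∈ c σ
  ℓ_cl : ∀ σ ∈ tys U, ∀ p ∈ c σ, ∀ b < w, b ≠ 0 → ∀ τ ∈ tys U, (∀ q ∈ τ, q ∈ ℓ σ p b) →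
    ∀ q ∈ c τ, q ∈ ℓ σ p b

abbrev CTab := List (Ty × Pt)
abbrev ETab := List (Ty × Pt × ℕ × Pt)

/-- A consequence operator given by a table. -/
noncomputable def cRow (U : Pt) (A : CTab) (σ : Ty) : Ty := LF U.sublists fun q => (σ, q) ∈ A

noncomputable def ℓRow (U : Pt) (E : ETab) (σ : Ty) (p : Pt) (b : ℕ) : Ty :=
  LF U.sublists fun q => (σ, p, b, q) ∈ E

/-- Types of the elements of `p`. -/
noncomputable def nxRow (w : ℕ) (U : Pt) (A : CTab) (E : ETab) (σ : Ty) (p : Pt) : List Ty :=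
  (List.range w).map fun b => if b = 0 then cRow U A σ else ℓRow U E σ p b

def PreTab (w : ℕ) (U : Pt) (Ts : List (Pt × Pt)) (A : CTab) (E : ETab) : Prop :=
  LAll (tys U) fun σ => [] ∈ cRow U A σ ∧ (LAll σ fun q => q ∈ cRow U A σ) ∧
    (LAll Ts fun t => t.1 ∈ cRow U A σ → t.2 ∈ cRow U A σ) ∧
    (LAll (tys U) fun τ => (LAll τ fun q => q ∈ cRow U A σ) →
      LAll (cRow U A τ) fun q => q ∈ cRow U A σ) ∧
    LAll (cRow U A σ) fun p =>
      (LAll U.sublists fun q => combL w p (nxRow w U A E σ p) 0 q → q ∈ cRow U A σ) ∧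
      LAll (List.range w) fun b => ¬ b = 0 →
        (LAll U.sublists fun q => combL w p (nxRow w U A E σ p) b q → q ∈ ℓRow U E σ p b) ∧
        LAll (tys U) fun τ => (LAll τ fun q => q ∈ ℓRow U E σ p b) →
          LAll (cRow U A τ) fun q => q ∈ ℓRow U E σ p b

/-- The least consequence operator. -/
noncomputable def cF (w : ℕ) (U : Pt) (Ts : List (Pt × Pt)) (σ : Ty) : Ty :=
  LF U.sublists fun q => LAll ((tys U).product U.sublists).sublists fun A =>
    LAll ((tys U).product (U.sublists.product ((List.range w).product U.sublists))).sublists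
      fun E => PreTab w U Ts A E → q ∈ cRow U A σ

noncomputable def ℓF (w : ℕ) (U : Pt) (Ts : List (Pt × Pt)) (σ : Ty) (p : Pt) (b : ℕ) : Ty :=
  LF U.sublists fun q => LAll ((tys U).product U.sublists).sublists fun A =>
    LAll ((tys U).product (U.sublists.product ((List.range w).product U.sublists))).sublists
      fun E => PreTab w U Ts A E → q ∈ ℓRow U E σ p b

section

variable {α : Type} [Primcodable α] {w b : α → ℕ} {U p : α → Pt} {σ : α → Ty} {A : α → CTab}
  {E : α → ETab} {Ts : α → List (Pt × Pt)}

@[fun_prop]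
theorem PR.tys (hU : PR U) : PR fun x => tys (U x) := by
  unfold FrontierOne.tys
  fun_prop

@[fun_prop]
theorem PR.cRow (hU : PR U) (hA : PR A) (hσ : PR σ) : PR fun x => cRow (U x) (A x) (σ x) := by
  unfold FrontierOne.cRow
  fun_prop

@[fun_prop]
theorem PR.ℓRow (hU : PR U) (hE : PR E) (hσ : PR σ) (hp : PR p) (hb : PR b) :
    PR fun x => ℓRow (U x) (E x) (σ x) (p x) (b x) := by
  unfold FrontierOne.ℓRow
  fun_prop

@[fun_prop]
theorem PR.nxRow (hw : PR w) (hU : PR U) (hA : PR A) (hE : PR E) (hσ : PR σ) (hp : PR p) :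
    PR fun x => nxRow (w x) (U x) (A x) (E x) (σ x) (p x) := by
  unfold FrontierOne.nxRow
  fun_prop

@[fun_prop]
theorem PP.preTab (hw : PR w) (hU : PR U) (hT : PR Ts) (hA : PR A) (hE : PR E) :
    PP fun x => PreTab (w x) (U x) (Ts x) (A x) (E x) := by
  unfold PreTab
  fun_prop

@[fun_prop]
theorem PR.cF (hw : PR w) (hU : PR U) (hT : PR Ts) (hσ : PR σ) :
    PR fun x => cF (w x) (U x) (Ts x) (σ x) := by
  unfold FrontierOne.cF
  fun_prop

@[fun_prop]
theorem PR.ℓF (hw : PR w) (hU : PR U) (hT : PR Ts) (hσ : PR σ) (hp : PR p) (hb : PR b) :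
    PR fun x => ℓF (w x) (U x) (Ts x) (σ x) (p x) (b x) := by
  unfold FrontierOne.ℓF
  fun_prop

end

theorem mem_LF {β : Type} {l : List β} {Q : β → Prop} {b : β} : b ∈ LF l Q ↔ b ∈ l ∧ Q b := by
  simp [LF]

theorem LF_sublist {β : Type} (l : List β) (Q : β → Prop) : (LF l Q).Sublist l :=
  List.filter_sublist

section

variable {w : ℕ} {U : Pt} {Ts : List (Pt × Pt)}

theorem pats_lt (hU : Uni w U) {q : Pt} (hq : q ∈ U.sublists) : ∀ a ∈ q, ∀ i ∈ a.2, i < w :=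
  fun a ha i hi => hU.lt a (mem_pats hq ha) i hi

theorem nxRow_eq {A : CTab} {E : ETab} {σ : Ty} {p : Pt} :
    nxRow w U A E σ p = (List.range w).map (nx (cRow U A) (ℓRow U E) σ p) := rfl

theorem preTab_iff (hU : Uni w U) {A : CTab} {E : ETab} :
    PreTab w U Ts A E ↔ PreSys w U Ts (cRow U A) (ℓRow U E) := by
  have hc : ∀ σ p b, ∀ q ∈ U.sublists, combL w p (nxRow w U A E σ p) b q ↔
      comb w p (fun b P => P ∈ nx (cRow U A) (ℓRow U E) σ p b) b q := fun σ p b q hq => by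
    rw [nxRow_eq, comb_iff_combL hU.pos (pats_lt hU hq)]
  constructor
  · intro h
    refine ⟨fun σ hσ => (h σ hσ).1, fun σ hσ => (h σ hσ).2.1, fun σ hσ => (h σ hσ).2.2.1,
      fun σ hσ p hp q hq hq' => ((h σ hσ).2.2.2.2 p hp).1 q hq ((hc _ _ _ q hq).2 hq'),
      fun σ hσ p hp q hq b hb hb0 hq' => (((h σ hσ).2.2.2.2 p hp).2 b (List.mem_range.2 hb) hb0).1
        q hq ((hc _ _ _ q hq).2 hq'), fun σ hσ => (h σ hσ).2.2.2.1,
      fun σ hσ p hp b hb hb0 => (((h σ hσ).2.2.2.2 p hp).2 b (List.mem_range.2 hb) hb0).2⟩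
  · intro h σ hσ
    refine ⟨h.nil σ hσ, h.sub σ hσ, h.mod σ hσ, h.c_cl σ hσ, fun p hp => ⟨fun q hq hq' =>
      h.c_comb σ hσ p hp q hq ((hc _ _ _ q hq).1 hq'), fun b hb hb0 => ⟨fun q hq hq' =>
      h.ℓ_comb σ hσ p hp q hq b (List.mem_range.1 hb) hb0 ((hc _ _ _ q hq).1 hq'),
      h.ℓ_cl σ hσ p hp b (List.mem_range.1 hb) hb0⟩⟩⟩

theorem mem_cF (hU : Uni w U) {σ : Ty} {q : Pt} : q ∈ cF w U Ts σ ↔ q ∈ U.sublists ∧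
    ∀ A ∈ ((tys U).product U.sublists).sublists,
    ∀ E ∈ ((tys U).product (U.sublists.product ((List.range w).product U.sublists))).sublists,
      PreSys w U Ts (cRow U A) (ℓRow U E) → q ∈ cRow U A σ := by
  simp only [cF, mem_LF, preTab_iff hU]
  rfl

theorem mem_ℓF (hU : Uni w U) {σ : Ty} {p : Pt} {b : ℕ} {q : Pt} : q ∈ ℓF w U Ts σ p b ↔
    q ∈ U.sublists ∧ ∀ A ∈ ((tys U).product U.sublists).sublists,
    ∀ E ∈ ((tys U).product (U.sublists.product ((List.range w).product U.sublists))).sublists,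
      PreSys w U Ts (cRow U A) (ℓRow U E) → q ∈ ℓRow U E σ p b := by
  simp only [ℓF, mem_LF, preTab_iff hU]
  rfl

/-- The semantic consequences in a model form a system. -/
theorem preSys_semantic (hT : ∀ t ∈ Ts, t.1 ∈ U.sublists ∧ t.2 ∈ U.sublists)
    {X : Type} {M : Str RelSym X} (hM : Mod Ts M) {c : Ty → Ty} {ℓ : Ty → Pt → ℕ → Ty}
    (hc : ∀ σ ∈ tys U, ∀ q, q ∈ c σ ↔ q ∈ U.sublists ∧ ∀ e, (∀ p ∈ σ, Tr M p e) → Tr M q e)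
    (hℓ : ∀ σ ∈ tys U, ∀ p ∈ U.sublists, ∀ b < w, ∀ q, q ∈ ℓ σ p b ↔ q ∈ U.sublists ∧ ∀ f : ℕ → X,
      (∀ q ∈ σ, Tr M q (f 0)) → (∀ a ∈ p, mapA f a ∈ M) → Tr M q (f b)) :
    PreSys w U Ts c ℓ := by
  have key : ∀ σ ∈ tys U, ∀ p ∈ c σ, ∀ b, ∀ q, comb w p (fun b P => P ∈ nx c ℓ σ p b) b q →
      ∀ f : ℕ → X, (∀ q ∈ σ, Tr M q (f 0)) → (∀ a ∈ p, mapA f a ∈ M) → Tr M q (f b) := by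
    intro σ hσ p hp b q hq f hf hfp
    refine comb_sound hfp (fun b hb P hP => ?_) hq
    by_cases h0 : b = 0
    · subst h0
      exact ((hc σ hσ P).1 hP).2 _ hf
    · rw [nx, if_neg h0] at hP
      exact ((hℓ σ hσ p ((hc σ hσ p).1 hp).1 b hb P).1 hP).2 f hf hfp
  refine ⟨fun σ hσ => ?_, fun σ hσ q hq => ?_, fun σ hσ t ht h => ?_, fun σ hσ p hp q hq h => ?_,
    fun σ hσ p hp q hq b hb _ h => ?_, fun σ hσ τ hτ h q hq => ?_,
    fun σ hσ p hp b hb _ τ hτ h q hq => ?_⟩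
  · exact (hc σ hσ _).2 ⟨by simp, fun e _ => ⟨fun _ => e, rfl, by simp⟩⟩
  · exact (hc σ hσ _).2 ⟨mem_tys hσ hq, fun e he => he q hq⟩
  · exact (hc σ hσ _).2 ⟨(hT t ht).2, fun e he => hM t ht e (((hc σ hσ _).1 h).2 e he)⟩
  · refine (hc σ hσ _).2 ⟨hq, fun e he => ?_⟩
    obtain ⟨f, rfl, hf⟩ := ((hc σ hσ _).1 hp).2 e he
    exact key σ hσ p hp 0 q h f he hf
  · exact (hℓ σ hσ p ((hc σ hσ p).1 hp).1 b hb q).2 ⟨hq, key σ hσ p hp b q h⟩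
  · obtain ⟨h1, h2⟩ := (hc τ hτ _).1 hq
    exact (hc σ hσ _).2 ⟨h1, fun e he => h2 e fun p hp => ((hc σ hσ p).1 (h p hp)).2 e he⟩
  · obtain ⟨h1, h2⟩ := (hc τ hτ _).1 hq
    have hp' := ((hc σ hσ p).1 hp).1
    exact (hℓ σ hσ p hp' b hb q).2 ⟨h1, fun f hf hfp => h2 _ fun q hq =>
      ((hℓ σ hσ p hp' b hb q).1 (h q hq)).2 f hf hfp⟩

theorem exists_tables {X : Type} (M : Str RelSym X) :
    ∃ A ∈ ((tys U).product U.sublists).sublists,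
    ∃ E ∈ ((tys U).product (U.sublists.product ((List.range w).product U.sublists))).sublists,
    (∀ σ ∈ tys U, ∀ q, q ∈ cRow U A σ ↔
      q ∈ U.sublists ∧ ∀ e, (∀ p ∈ σ, Tr M p e) → Tr M q e) ∧
    (∀ σ ∈ tys U, ∀ p ∈ U.sublists, ∀ b < w, ∀ q, q ∈ ℓRow U E σ p b ↔ q ∈ U.sublists ∧ ∀ f : ℕ → X,
      (∀ q ∈ σ, Tr M q (f 0)) → (∀ a ∈ p, mapA f a ∈ M) → Tr M q (f b)) := by
  refine ⟨LF _ fun k => ∀ e, (∀ p ∈ k.1, Tr M p e) → Tr M k.2 e,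
    List.mem_sublists.2 (LF_sublist _ _), LF _ fun k => ∀ f : ℕ → X,
      (∀ q ∈ k.1, Tr M q (f 0)) → (∀ a ∈ k.2.1, mapA f a ∈ M) → Tr M k.2.2.2 (f k.2.2.1),
    List.mem_sublists.2 (LF_sublist _ _), fun σ hσ q => ?_, fun σ hσ p hp b hb q => ?_⟩
  · rw [cRow, mem_LF, mem_LF, List.pair_mem_product]
    exact ⟨fun h => ⟨h.1, h.2.2⟩, fun h => ⟨h.1, ⟨hσ, h.1⟩, h.2⟩⟩
  · rw [ℓRow, mem_LF, mem_LF, List.pair_mem_product, List.pair_mem_product, List.pair_mem_product]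
    exact ⟨fun h => ⟨h.1, h.2.2⟩, fun h => ⟨h.1, ⟨hσ, hp, List.mem_range.2 hb, h.1⟩, h.2⟩⟩

theorem sys_least (hU : Uni w U) (hT : ∀ t ∈ Ts, t.1 ∈ U.sublists ∧ t.2 ∈ U.sublists) :
    Sys w U Ts (cF w U Ts) (ℓF w U Ts) := by
  have hc : ∀ {σ q}, q ∈ cF w U Ts σ → q ∈ U.sublists := fun h => ((mem_cF hU).1 h).1
  have hnx : ∀ {A E}, A ∈ ((tys U).product U.sublists).sublists →
      E ∈ ((tys U).product (U.sublists.product ((List.range w).product U.sublists))).sublists →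
      PreSys w U Ts (cRow U A) (ℓRow U E) → ∀ {σ p b q}, q ∈ nx (cF w U Ts) (ℓF w U Ts) σ p b →
      q ∈ nx (cRow U A) (ℓRow U E) σ p b := by
    intro A E hA hE hP σ p b q hq
    unfold nx at hq ⊢
    split_ifs at hq ⊢ with h0
    · exact ((mem_cF hU).1 hq).2 A hA E hE hP
    · exact ((mem_ℓF hU).1 hq).2 A hA E hE hP
  refine ⟨fun σ => List.mem_sublists.2 (LF_sublist _ _), fun σ p b =>
    List.mem_sublists.2 (LF_sublist _ _), fun σ hσ => ?_, fun σ hσ q hq => ?_, fun σ hσ t ht h => ?_,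
    fun σ hσ p hp q hq h => ?_, fun σ hσ p hp q hq b hb hb0 h => ?_, fun σ hσ τ hτ h q hq => ?_,
    fun σ hσ p hp b hb hb0 τ hτ h q hq => ?_, ?_, ?_⟩
  · exact (mem_cF hU).2 ⟨by simp, fun A hA E hE hP => hP.nil σ hσ⟩
  · exact (mem_cF hU).2 ⟨mem_tys hσ hq, fun A hA E hE hP => hP.sub σ hσ q hq⟩
  · exact (mem_cF hU).2 ⟨(hT t ht).2, fun A hA E hE hP => hP.mod σ hσ t ht
      (((mem_cF hU).1 h).2 A hA E hE hP)⟩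
  · exact (mem_cF hU).2 ⟨hq, fun A hA E hE hP => hP.c_comb σ hσ p
      (((mem_cF hU).1 hp).2 A hA E hE hP) q hq
      (comb_mono (fun _ h => h) (fun b _ q h => hnx hA hE hP h) h)⟩
  · exact (mem_ℓF hU).2 ⟨hq, fun A hA E hE hP => hP.ℓ_comb σ hσ p
      (((mem_cF hU).1 hp).2 A hA E hE hP) q hq b hb hb0
      (comb_mono (fun _ h => h) (fun b _ q h => hnx hA hE hP h) h)⟩
  · exact (mem_cF hU).2 ⟨hc hq, fun A hA E hE hP => hP.c_cl σ hσ τ hτ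
      (fun q hq => ((mem_cF hU).1 (h q hq)).2 A hA E hE hP) q (((mem_cF hU).1 hq).2 A hA E hE hP)⟩
  · exact (mem_ℓF hU).2 ⟨hc hq, fun A hA E hE hP => hP.ℓ_cl σ hσ p
      (((mem_cF hU).1 hp).2 A hA E hE hP) b hb hb0 τ hτ
      (fun q hq => ((mem_ℓF hU).1 (h q hq)).2 A hA E hE hP) q (((mem_cF hU).1 hq).2 A hA E hE hP)⟩
  · intro X M hM σ hσ e he q hq
    obtain ⟨A, hA, E, hE, h1, h2⟩ := exists_tables (w := w) (U := U) M
    exact ((h1 σ hσ q).1 (((mem_cF hU).1 hq).2 A hA E hE (preSys_semantic hT hM h1 h2))).2 e he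
  · intro X M hM σ hσ p hp f hf hfp b hb hb0 q hq
    obtain ⟨A, hA, E, hE, h1, h2⟩ := exists_tables (w := w) (U := U) M
    exact ((h2 σ hσ p (hc hp) b hb q).1
      (((mem_ℓF hU).1 hq).2 A hA E hE (preSys_semantic hT hM h1 h2))).2 f hf hfp

end

/-! ### Patterns of dependencies -/

/-- Rename `x` to the root. -/
def toRoot (x i : ℕ) : ℕ := if i = x then 0 else i + 1

/-- The atoms as a pattern over `U` with root `x`. -/
noncomputable def rootPat (U : Pt) (x : ℕ) (l : List Atom) : Pt :=
  LF U fun a => a ∈ l.map fun b => mapA (toRoot x) (Atom.at b)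

noncomputable def tgdPat (U : Pt) (t : TGD) : Pt × Pt :=
  (rootPat U (t.frontier.getD 0 0) t.body, rootPat U (t.frontier.getD 0 0) t.head)

/-- All atoms over the symbols `R` with variables below `w`. -/
def univ (w : ℕ) (R : List RelSym) : Pt :=
  R.flatMap fun r => if r.arity = 0 then [] else
    ((List.range r.arity).map fun _ => List.range w).sections.map fun l => (r, l)

def TGD.atoms (t : TGD) : List Atom := t.body ++ t.head

/-- The relation symbols of the dependencies. -/
def relsOf (T : List TGD) : List RelSym := T.flatMap fun t => (TGD.atoms t).map Atom.rel

/-- A bound for the root patterns of the dependencies. -/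
def widthOf (T : List TGD) : ℕ :=
  (T.flatMap fun t => (TGD.atoms t).flatMap Atom.args).foldr (fun i n => i + n) 2

theorem mem_univ {w : ℕ} {R : List RelSym} {a : At RelSym} : a ∈ univ w R ↔
    a.1 ∈ R ∧ a.2.length = a.1.arity ∧ 1 ≤ a.1.arity ∧ ∀ i ∈ a.2, i < w := by
  obtain ⟨r, l⟩ := a
  have key : l ∈ ((List.range r.arity).map fun _ => List.range w).sections ↔
      l.length = r.arity ∧ ∀ i ∈ l, i < w := by
    rw [List.mem_sections, List.forall₂_iff_get]
    simp only [List.length_map, List.length_range, List.get_eq_getElem, List.getElem_map,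
      List.mem_range]
    refine and_congr_right fun h => ⟨fun h' i hi => ?_, fun h' i hi _ => h' _ (List.getElem_mem _)⟩
    obtain ⟨n, hn, rfl⟩ := List.getElem_of_mem hi
    exact h' n hn (by omega)
  simp only [univ, List.mem_flatMap]
  constructor
  · rintro ⟨s, hs, h⟩
    split_ifs at h with h0
    · cases h
    · obtain ⟨l', hl, h⟩ := List.mem_map.1 h
      cases h
      have := key.1 hl
      exact ⟨hs, this.1, by omega, this.2⟩
  · rintro ⟨h1, h2, h3, h4⟩
    refine ⟨r, h1, ?_⟩
    rw [if_neg (by show ¬ r.arity = 0; have : 1 ≤ r.arity := h3; omega)]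
    exact List.mem_map.2 ⟨l, key.2 ⟨h2, h4⟩, rfl⟩

theorem uni_univ {w : ℕ} (hw : 0 < w) (R : List RelSym) : Uni w (univ w R) where
  pos := hw
  lt a ha := (mem_univ.1 ha).2.2.2
  ne a ha h := by
    obtain ⟨-, h1, h2, -⟩ := mem_univ.1 ha
    rw [h] at h1
    simp at h1
    omega
  ren a ha g hg := by
    obtain ⟨h0, h1, h2, -⟩ := mem_univ.1 ha
    refine mem_univ.2 ⟨h0, by simpa [mapA] using h1, h2, fun i hi => ?_⟩
    obtain ⟨j, hj, rfl⟩ := mem_mapA.1 hi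
    exact hg j hj

theorem le_widthOf {T : List TGD} {t : TGD} (ht : t ∈ T) {a : Atom} (ha : a ∈ TGD.atoms t) {i : ℕ}
    (hi : i ∈ a.args) : i + 2 ≤ widthOf T := by
  have key : ∀ l : List ℕ, i ∈ l → i + 2 ≤ l.foldr (fun i n => i + n) 2 := by
    have h2 : ∀ l : List ℕ, 2 ≤ l.foldr (fun i n => i + n) 2 := by
      intro l
      induction l with
      | nil => simp
      | cons a l ih => simp only [List.foldr_cons]; omega
    intro l hl
    induction l with
    | nil => cases hl
    | cons a l ih =>
      simp only [List.foldr_cons]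
      rcases List.mem_cons.1 hl with rfl | hl
      · have := h2 l
        omega
      · have := ih hl
        omega
  exact key _ (List.mem_flatMap.2 ⟨t, ht, List.mem_flatMap.2 ⟨a, ha, hi⟩⟩)

theorem widthOf_pos (T : List TGD) : 0 < widthOf T := by
  unfold widthOf
  induction (T.flatMap fun t => (TGD.atoms t).flatMap Atom.args) with
  | nil => simp
  | cons a l ih => simp only [List.foldr_cons]; omega

/-- The patterns of the dependencies. -/
noncomputable def pairs (U : Pt) (T : List TGD) : List (Pt × Pt) := T.map fun t => tgdPat U t

theorem mem_rootPat {U : Pt} {x : ℕ} {l : List Atom}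
    (h : ∀ b ∈ l, mapA (toRoot x) (Atom.at b) ∈ U) {a : At RelSym} :
    a ∈ rootPat U x l ↔ ∃ b ∈ l, mapA (toRoot x) (Atom.at b) = a := by
  rw [rootPat, mem_LF, List.mem_map]
  exact ⟨fun h => h.2, fun ⟨b, hb, hba⟩ => ⟨hba ▸ h b hb, b, hb, hba⟩⟩

theorem tr_rootPat {U : Pt} {x : ℕ} {l : List Atom} {X : Type} {M : Str RelSym X}
    (h : ∀ b ∈ l, mapA (toRoot x) (Atom.at b) ∈ U) {e : X} :
    Tr M (rootPat U x l) e ↔ ∃ g : ℕ → X, g x = e ∧ ∀ b ∈ l, mapA g (Atom.at b) ∈ M := by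
  constructor
  · rintro ⟨f, h0, hf⟩
    refine ⟨fun i => f (toRoot x i), by simpa [toRoot] using h0, fun b hb => ?_⟩
    rw [← mapA_mapA]
    exact hf _ ((mem_rootPat h).2 ⟨b, hb, rfl⟩)
  · rintro ⟨g, h0, hg⟩
    refine ⟨fun j => if j = 0 then e else g (j - 1), by simp, fun a ha => ?_⟩
    obtain ⟨b, hb, rfl⟩ := (mem_rootPat h).1 ha
    rw [mapA_mapA]
    convert hg b hb using 2
    ext i
    by_cases hi : i = x <;> simp [toRoot, hi, h0]

theorem rootPat_mem {U : Pt} {x : ℕ} {l : List Atom} : rootPat U x l ∈ U.sublists :=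
  List.mem_sublists.2 (LF_sublist _ _)

theorem expr_pairs {w : ℕ} {R : List RelSym} {T : List TGD} (hT : ∀ t ∈ T, t.wf ∧ t.FrontierOne)
    (hR : ∀ r ∈ relsOf T, r ∈ R) (hw : widthOf T ≤ w) :
    Expr (univ w R) T (pairs (univ w R) T) := by
  have hU : ∀ t ∈ T, ∀ x, ∀ b ∈ TGD.atoms t, mapA (toRoot x) (Atom.at b) ∈ univ w R := by
    intro t ht x b hb
    have hb' : b.wf := by
      rcases List.mem_append.1 hb with h | h
      · exact (hT t ht).1.1 b h
      · exact (hT t ht).1.2.1 b h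
    refine mem_univ.2 ⟨hR _ (List.mem_flatMap.2 ⟨t, ht, List.mem_map.2 ⟨b, hb, rfl⟩⟩),
      by simpa [mapA, Atom.at] using hb'.1, hb'.2, fun i hi => ?_⟩
    obtain ⟨j, hj, rfl⟩ := mem_mapA.1 hi
    have := le_widthOf ht hb hj
    unfold toRoot
    split_ifs <;> omega
  have hx : ∀ t ∈ T, ∃ x, t.frontier = [x] := fun t ht => List.length_eq_one_iff.1 (hT t ht).2
  have hb : ∀ t ∈ T, ∀ x, ∀ b ∈ t.body, mapA (toRoot x) (Atom.at b) ∈ univ w R :=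
    fun t ht x b hb => hU t ht x b (List.mem_append_left _ hb)
  have hh : ∀ t ∈ T, ∀ x, ∀ b ∈ t.head, mapA (toRoot x) (Atom.at b) ∈ univ w R :=
    fun t ht x b hb => hU t ht x b (List.mem_append_right _ hb)
  refine ⟨fun t ht => (hT t ht).1, fun p hp => ?_, fun X M => ?_⟩
  · obtain ⟨t, ht, rfl⟩ := List.mem_map.1 hp
    obtain ⟨x, hx⟩ := hx t ht
    obtain ⟨a, ha, hxa⟩ := (hT t ht).1.2.2.2.1 x (by simp [hx])
    refine ⟨rootPat_mem, rootPat_mem, mapA (toRoot x) (Atom.at a), ?_, ?_⟩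
    · simp only [tgdPat, hx, List.getD_cons_zero]
      exact (mem_rootPat (hb t ht x)).2 ⟨a, ha, rfl⟩
    · exact mem_mapA.2 ⟨x, hxa, if_pos rfl⟩
  · simp only [Mod, pairs, List.forall_mem_map]
    refine forall₂_congr fun t ht => ?_
    obtain ⟨x, hx⟩ := hx t ht
    simp only [tgdPat, hx, List.getD_cons_zero, tr_rootPat (hb t ht x), tr_rootPat (hh t ht x), Sat,
      List.mem_singleton, forall_eq]
    constructor
    · intro h g hg
      obtain ⟨g', h0, h1⟩ := h _ ⟨g, rfl, hg⟩
      exact ⟨g', h1, h0⟩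
    · rintro h e ⟨g, rfl, hg⟩
      obtain ⟨g', h0, h1⟩ := h g hg
      exact ⟨g', h1, h0⟩

section

variable {α : Type} [Primcodable α]

@[fun_prop]
theorem PR.relSym_arity {r : α → RelSym} (h : PR r) : PR fun a => (r a).arity :=
  (Primrec.snd.comp (Primrec.of_equiv (e := relSymEquiv))).comp h

@[fun_prop]
theorem PR.atom_rel {r : α → Atom} (h : PR r) : PR fun a => (r a).rel :=
  (Primrec.fst.comp (Primrec.of_equiv (e := atomEquiv))).comp h

@[fun_prop]
theorem PR.atom_args {r : α → Atom} (h : PR r) : PR fun a => (r a).args :=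
  (Primrec.snd.comp (Primrec.of_equiv (e := atomEquiv))).comp h

@[fun_prop]
theorem PR.tgd_body {t : α → TGD} (h : PR t) : PR fun a => (t a).body :=
  (Primrec.fst.comp (Primrec.of_equiv (e := tgdEquiv))).comp h

@[fun_prop]
theorem PR.tgd_head {t : α → TGD} (h : PR t) : PR fun a => (t a).head :=
  ((Primrec.fst.comp Primrec.snd).comp (Primrec.of_equiv (e := tgdEquiv))).comp h

@[fun_prop]
theorem PR.tgd_frontier {t : α → TGD} (h : PR t) : PR fun a => (t a).frontier :=
  ((Primrec.snd.comp Primrec.snd).comp (Primrec.of_equiv (e := tgdEquiv))).comp h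

@[fun_prop]
theorem PR.univ {w : α → ℕ} {R : α → List RelSym} (hw : PR w) (hR : PR R) :
    PR fun x => univ (w x) (R x) := by
  unfold FrontierOne.univ
  fun_prop

@[fun_prop]
theorem PR.relsOf {T : α → List TGD} (hT : PR T) : PR fun x => relsOf (T x) := by
  unfold FrontierOne.relsOf FrontierOne.TGD.atoms
  fun_prop

@[fun_prop]
theorem PR.widthOf {T : α → List TGD} (hT : PR T) : PR fun x => widthOf (T x) := by
  unfold FrontierOne.widthOf FrontierOne.TGD.atoms
  fun_prop

@[fun_prop]
theorem PR.pairs {U : α → Pt} {T : α → List TGD} (hU : PR U) (hT : PR T) :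
    PR fun x => pairs (U x) (T x) := by
  unfold FrontierOne.pairs tgdPat rootPat toRoot Atom.at
  fun_prop

/-- Well-formed frontier-one dependencies, with bounded quantifiers. -/
def wfL (t : TGD) : Prop :=
  (LAll (TGD.atoms t) fun a => a.args.length = a.rel.arity ∧ 0 < a.rel.arity) ∧
  t.frontier.length = 1 ∧
  (LAll t.frontier fun x => LEx t.body fun a => x ∈ a.args) ∧
  LAll t.body fun a => LAll a.args fun x => LAll t.head fun b => x ∈ b.args → x ∈ t.frontier

theorem wfL_iff {t : TGD} : wfL t ↔ t.wf ∧ t.FrontierOne := by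
  constructor
  · rintro ⟨h1, h2, h3, h4⟩
    refine ⟨⟨fun a ha => h1 a (List.mem_append_left _ ha), fun a ha =>
      h1 a (List.mem_append_right _ ha), ?_, h3, ?_⟩, h2⟩
    · obtain ⟨x, hx⟩ := List.length_eq_one_iff.1 h2
      simp [hx]
    · rintro x ⟨a, ha, hx⟩ ⟨b, hb, hx'⟩
      exact h4 a ha x hx b hb hx'
  · rintro ⟨⟨h1, h2, -, h3, h4⟩, h5⟩
    refine ⟨fun a ha => ?_, h5, h3, fun a ha x hx b hb hx' => h4 x ⟨a, ha, hx⟩ ⟨b, hb, hx'⟩⟩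
    rcases List.mem_append.1 ha with h | h
    · exact h1 a h
    · exact h2 a h

theorem PP.wfL : PP fun x : List TGD => ∀ t ∈ x, t.wf ∧ t.FrontierOne := by
  simp only [← wfL_iff]
  show PP fun x : List TGD => LAll x fun t => FrontierOne.wfL t
  unfold FrontierOne.wfL FrontierOne.TGD.atoms
  fun_prop

end

/-! ### Annotations with bounded quantifiers -/

/-- Width, universe, query symbols, database symbols, and pattern pairs of the dependencies. -/
abbrev Prm := ℕ × Pt × List RelSym × List RelSym × List (Pt × Pt) × List (Pt × Pt)

def pw (k : Prm) : ℕ := k.1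
def pU (k : Prm) : Pt := k.2.1
def pQ (k : Prm) : List RelSym := k.2.2.1
def pS (k : Prm) : List RelSym := k.2.2.2.1
noncomputable def c1 (k : Prm) : Ty → Ty := cF k.1 k.2.1 k.2.2.2.2.1
noncomputable def c2 (k : Prm) : Ty → Ty := cF k.1 k.2.1 k.2.2.2.2.2
noncomputable def ℓ1 (k : Prm) : Ty → Pt → ℕ → Ty := ℓF k.1 k.2.1 k.2.2.2.2.1
noncomputable def ℓ2 (k : Prm) : Ty → Pt → ℕ → Ty := ℓF k.1 k.2.1 k.2.2.2.2.2

/-- The labelled component of `y` in `p` for the least type system. -/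
noncomputable def comp2 (k : Prm) (τ : Ty) (p : Pt) (y : ℕ) : LPt :=
  LL (pw k) (pU k) (pQ k) (ℓ2 k) τ p y

noncomputable def lInfos (k : Prm) : List Info := infos (pw k) (pU k) (pQ k)

theorem cn_iff {Q : List RelSym} {p : Pt} {y i : ℕ} : Cn Q p y i ↔
    LAll (y :: p.flatMap fun a => a.2).sublists fun V => y ∈ V →
      (LAll p fun a => a.1 ∈ Q → (LEx a.2 fun j => j ∈ V) → LAll a.2 fun j => j ∈ V) → i ∈ V := by
  constructor
  · intro h V _ hy hV
    exact h {j | j ∈ V} hy hV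
  · intro h V hy hV
    have hm : ∀ a ∈ p, ∀ j ∈ a.2, j ∈ LF (y :: p.flatMap fun a => a.2) (fun j => j ∈ V) ↔ j ∈ V :=
      fun a ha j hj => by
        rw [mem_LF]
        exact and_iff_right (List.mem_cons_of_mem _ (List.mem_flatMap.2 ⟨a, ha, hj⟩))
    refine (mem_LF.1 (h (LF _ fun j => j ∈ V) (List.mem_sublists.2 (LF_sublist _ _))
      (mem_LF.2 ⟨List.mem_cons_self, hy⟩) ?_)).2
    rintro a ha hQ ⟨j, hj, hj'⟩ j' hj''
    exact (hm a ha j' hj'').2 (hV a ha hQ ⟨j, hj, (hm a ha j hj).1 hj'⟩ j' hj'')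

theorem conn_iff {ρ : Type} {p : Pat ρ} : Conn p ↔
    LAll (0 :: p.flatMap fun a => a.2).sublists fun V => 0 ∈ V →
      (LAll p fun a => (LEx a.2 fun j => j ∈ V) → LAll a.2 fun j => j ∈ V) →
      LAll p fun a => LAll a.2 fun j => j ∈ V := by
  constructor
  · intro h V _ hy hV
    exact h {j | j ∈ V} hy hV
  · intro h V hy hV
    have hm : ∀ a ∈ p, ∀ j ∈ a.2, j ∈ LF (0 :: p.flatMap fun a => a.2) (fun j => j ∈ V) ↔ j ∈ V :=
      fun a ha j hj => by
        rw [mem_LF]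
        exact and_iff_right (List.mem_cons_of_mem _ (List.mem_flatMap.2 ⟨a, ha, hj⟩))
    have := h (LF _ fun j => j ∈ V) (List.mem_sublists.2 (LF_sublist _ _))
      (mem_LF.2 ⟨List.mem_cons_self, hy⟩) (by
        rintro a ha ⟨j, hj, hj'⟩ j' hj''
        exact (hm a ha j' hj'').2 (hV a ha ⟨j, hj, (hm a ha j hj).1 hj'⟩ j' hj''))
    exact fun a ha i hi => (hm a ha i hi).1 (this a ha i hi)

section Prim

variable {α : Type} [Primcodable α] {k : α → Prm} {τ : α → Ty} {p : α → Pt} {y : α → ℕ}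

@[fun_prop]
theorem PR.pw (hk : PR k) : PR fun x => pw (k x) := by unfold FrontierOne.pw; fun_prop

@[fun_prop]
theorem PR.pU (hk : PR k) : PR fun x => pU (k x) := by unfold FrontierOne.pU; fun_prop

@[fun_prop]
theorem PR.pQ (hk : PR k) : PR fun x => pQ (k x) := by unfold FrontierOne.pQ; fun_prop

@[fun_prop]
theorem PR.pS (hk : PR k) : PR fun x => pS (k x) := by unfold FrontierOne.pS; fun_prop

@[fun_prop]
theorem PR.c1 (hk : PR k) (hτ : PR τ) : PR fun x => c1 (k x) (τ x) := by
  unfold FrontierOne.c1; fun_prop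

@[fun_prop]
theorem PR.c2 (hk : PR k) (hτ : PR τ) : PR fun x => c2 (k x) (τ x) := by
  unfold FrontierOne.c2; fun_prop

@[fun_prop]
theorem PR.ℓ1 (hk : PR k) (hτ : PR τ) (hp : PR p) (hy : PR y) :
    PR fun x => ℓ1 (k x) (τ x) (p x) (y x) := by
  unfold FrontierOne.ℓ1; fun_prop

@[fun_prop]
theorem PR.ℓ2 (hk : PR k) (hτ : PR τ) (hp : PR p) (hy : PR y) :
    PR fun x => ℓ2 (k x) (τ x) (p x) (y x) := by
  unfold FrontierOne.ℓ2; fun_prop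

@[fun_prop]
theorem PR.LA {w : α → ℕ} {Q : α → List RelSym} (hw : PR w) (hp : PR p) (hQ : PR Q) :
    PR fun x => LA (w x) (p x) (Q x) := by
  have : ∀ w U Q, FrontierOne.LA w U Q = (LF U fun a => a.1 ∈ Q).map (fun a => (Sum.inl a.1, a.2)) ++
      (FrontierOne.tys U).flatMap fun τ => (List.range w).map fun i => (Sum.inr τ, [i]) := by
    intro w U Q
    simp only [FrontierOne.LA, LF]
    congr 3
    funext a
    congr
  simp only [this]
  fun_prop

@[fun_prop]
theorem PP.cn {Q : α → List RelSym} {i : α → ℕ} (hQ : PR Q) (hp : PR p) (hy : PR y) (hi : PR i) :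
    PP fun x => Cn (Q x) (p x) (y x) (i x) := by
  simp only [cn_iff]
  fun_prop

@[fun_prop]
theorem PP.conn {ρ : Type} [Primcodable ρ] {p : α → Pat ρ} (hp : PR p) :
    PP fun x => Conn (p x) := by
  simp only [conn_iff]
  fun_prop

@[fun_prop]
theorem PR.LC {w : α → ℕ} {Q : α → List RelSym} (hw : PR w) (hp : PR p) (hQ : PR Q) :
    PR fun x => LC (w x) (p x) (Q x) := by
  change PR fun x => LF (FrontierOne.LA (w x) (p x) (Q x)).sublists fun q => Conn q
  fun_prop

@[fun_prop]
theorem PR.lInfos (hk : PR k) : PR fun x => lInfos (k x) := by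
  unfold FrontierOne.lInfos infos; fun_prop

@[fun_prop]
theorem PR.lbl (hτ : PR τ) : PR fun x => lbl (τ x) := by
  unfold FrontierOne.lbl; fun_prop

@[fun_prop]
theorem PR.bagL {Q : α → List RelSym} {B : α → Pt} {Θ : α → List LPt} (hp : PR p) (hQ : PR Q)
    (hB : PR B) (hΘ : PR Θ) : PR fun x => bagL (p x) (Q x) (B x) (Θ x) := by
  have : ∀ U Q B Θ, FrontierOne.bagL U Q B Θ =
      (LF B fun a => a.1 ∈ Q).map (fun a => (Sum.inl a.1, a.2)) ++
      (LF (FrontierOne.tys U) fun τ => [FrontierOne.lbl τ] ∈ Θ).map FrontierOne.lbl := by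
    intro U Q B Θ
    simp only [FrontierOne.bagL, LF]
    congr 3
    funext a
    congr
  simp only [this]
  fun_prop

/-- Swapping `0` and `y`. -/
def swap0 (y i : ℕ) : ℕ := if i = 0 then y else if i = y then 0 else i

theorem swap0_eq (y : ℕ) : ⇑(Equiv.swap 0 y) = swap0 y :=
  funext fun i => Equiv.swap_apply_def 0 y i

@[fun_prop]
theorem PR.comp2 (hk : PR k) (hτ : PR τ) (hp : PR p) (hy : PR y) :
    PR fun x => comp2 (k x) (τ x) (p x) (y x) := by
  change PR fun x => LF (FrontierOne.LA (FrontierOne.pw (k x)) (FrontierOne.pU (k x))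
    (FrontierOne.pQ (k x))) fun a' => (LEx (p x) fun a => a.1 ∈ FrontierOne.pQ (k x) ∧
      (LAll a.2 fun i => Cn (FrontierOne.pQ (k x)) (p x) (y x) i) ∧
      a' = (Sum.inl a.1, a.2.map (Equiv.swap 0 (y x)))) ∨
      ∃ i < FrontierOne.pw (k x), Cn (FrontierOne.pQ (k x)) (p x) (y x) i ∧
        a' = (Sum.inr (labt (FrontierOne.ℓ2 (k x)) (τ x) (p x) i), [Equiv.swap 0 (y x) i])
  simp only [swap0_eq, ← List.mem_range (n := FrontierOne.pw _)]
  change PR fun x => LF (FrontierOne.LA (FrontierOne.pw (k x)) (FrontierOne.pU (k x))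
    (FrontierOne.pQ (k x))) fun a' => (LEx (p x) fun a => a.1 ∈ FrontierOne.pQ (k x) ∧
      (LAll a.2 fun i => Cn (FrontierOne.pQ (k x)) (p x) (y x) i) ∧
      a' = (Sum.inl a.1, a.2.map fun i => swap0 (y x) i)) ∨
      LEx (List.range (FrontierOne.pw (k x))) fun i => Cn (FrontierOne.pQ (k x)) (p x) (y x) i ∧
        a' = (Sum.inr (if i = 0 then τ x else FrontierOne.ℓ2 (k x) (τ x) (p x) i), [swap0 (y x) i])
  unfold swap0
  fun_prop

end Prim

/-- The choices of annotations for the elements of a bag. -/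
noncomputable def secs (k : Prm) : List (List Info) :=
  ((List.range (pw k)).map fun _ => lInfos k).sections

/-- The annotation of element `b`. -/
def nth (L : List Info) (b : ℕ) : Info := L.getD b ([], [])

def StepD (k : Prm) (B : Pt) (I : Info) (L : List Info) : Prop :=
  (nth L 0).1 = I.1 ∧
  (LAll I.2 fun q => combL (pw k) (bagL (pU k) (pQ k) B I.1)
    ((List.range (pw k)).map fun b => (nth L b).2) 0 q) ∧
  ∀ b < pw k, ¬ b = 0 → LAll (nth L b).1 fun q => combL (pw k) (bagL (pU k) (pQ k) B I.1)
    ((List.range (pw k)).map fun b => if b = 0 then I.1 else (nth L b).2) b q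

def LocD (k : Prm) (leaf : Prop) (I : Info) : Prop :=
  I ∈ lInfos k ∧ (LAll (tys (pU k)) fun τ => [lbl τ] ∈ I.1 → LAll τ fun p => comp2 k τ p 0 ∈ I.1) ∧
  (leaf → LAll I.2 fun q => LAll q fun a => LEx (tys (pU k)) fun τ => a = lbl τ ∧ [a] ∈ I.1)

def ReachD (k : Prm) (α τ : Ty) : Prop :=
  LAll (tys (pU k)).sublists fun R => α ∈ R → (LAll R fun τ => LAll τ fun p => ∀ b < pw k,
    (if b = 0 then τ else ℓ2 k τ p b) ∈ R) → τ ∈ R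

def FreeD (k : Prm) (α : Ty) (P : LPt) : Prop :=
  LEx (tys (pU k)) fun τ => ReachD k α τ ∧ LEx τ fun p => LEx (List.range (pw k)) fun y =>
    P = comp2 k τ p y

section Prim

variable {α : Type} [Primcodable α] {k : α → Prm} {τ τ' : α → Ty} {p : α → Pt} {y : α → ℕ}
  {I : α → Info} {L : α → List Info} {leaf : α → Prop} {P : α → LPt}

@[fun_prop]
theorem PR.secs (hk : PR k) : PR fun x => secs (k x) := by
  unfold FrontierOne.secs; fun_prop

@[fun_prop]
theorem PR.nth (hL : PR L) (hy : PR y) : PR fun x => nth (L x) (y x) := by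
  unfold FrontierOne.nth; fun_prop

@[fun_prop]
theorem PP.stepD (hk : PR k) (hp : PR p) (hI : PR I) (hL : PR L) :
    PP fun x => StepD (k x) (p x) (I x) (L x) := by
  unfold StepD; fun_prop

@[fun_prop]
theorem PP.locD (hk : PR k) (hl : PP leaf) (hI : PR I) :
    PP fun x => LocD (k x) (leaf x) (I x) := by
  unfold LocD; fun_prop

@[fun_prop]
theorem PP.reachD (hk : PR k) (hτ : PR τ) (hτ' : PR τ') :
    PP fun x => ReachD (k x) (τ x) (τ' x) := by
  unfold ReachD; fun_prop

@[fun_prop]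
theorem PP.freeD (hk : PR k) (hτ : PR τ) (hP : PR P) :
    PP fun x => FreeD (k x) (τ x) (P x) := by
  unfold FreeD; fun_prop

end Prim

section

variable {k : Prm}

theorem loc_iff {t : Nd} {I : Info} :
    Loc (pw k) (pU k) (pQ k) (ℓ2 k) t I ↔ LocD k t.IsLeaf I :=
  ⟨fun h => ⟨h.mem, h.ok, h.leaf⟩, fun h => ⟨h.1, h.2.1, h.2.2⟩⟩

theorem lInfos_lt (hU : Uni (pw k) (pU k)) {I : Info} (hI : I ∈ lInfos k) {q : LPt}
    (hq : q ∈ I.1 ∨ q ∈ I.2) : ∀ a ∈ q, ∀ i ∈ a.2, i < pw k := by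
  obtain ⟨h1, h2⟩ := mem_infos.1 hI
  have : q ∈ LC (pw k) (pU k) (pQ k) :=
    hq.elim (fun h => (List.mem_sublists.1 h1).subset h) fun h => (List.mem_sublists.1 h2).subset h
  exact fun a ha i hi => (uni_LA hU).lt a ((List.mem_sublists.1 (mem_LC.1 this).1).subset ha) i hi

theorem step_iff (hU : Uni (pw k) (pU k)) {B : Pt} {I : Info} {J : ℕ → Info} {L : List Info}
    (hI : I ∈ lInfos k) (hJ : ∀ b < pw k, J b ∈ lInfos k) (hL : ∀ b < pw k, nth L b = J b) :
    Step (pw k) (pU k) (pQ k) B I J ↔ StepD k B I L := by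
  have h1 : ((List.range (pw k)).map fun b => (nth L b).2) =
      (List.range (pw k)).map fun b => (J b).2 :=
    List.map_congr_left fun b hb => by rw [hL b (List.mem_range.1 hb)]
  have h2 : ((List.range (pw k)).map fun b => if b = 0 then I.1 else (nth L b).2) =
      (List.range (pw k)).map fun b => if b = 0 then I.1 else (J b).2 :=
    List.map_congr_left fun b hb => by rw [hL b (List.mem_range.1 hb)]
  rw [StepD, h1, h2, hL 0 hU.pos]
  constructor
  · intro h
    refine ⟨h.zero, fun q hq => ?_, fun b hb hb0 q hq => ?_⟩
    · exact (comb_iff_combL hU.pos (lInfos_lt hU hI (Or.inr hq))).1 (h.pos q hq)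
    · rw [hL b hb] at hq
      exact (comb_iff_combL hU.pos (lInfos_lt hU (hJ b hb) (Or.inl hq))).1 (h.top b hb hb0 q hq)
  · rintro ⟨h3, h4, h5⟩
    refine ⟨h3, fun q hq => ?_, fun b hb hb0 q hq => ?_⟩
    · exact (comb_iff_combL hU.pos (lInfos_lt hU hI (Or.inr hq))).2 (h4 q hq)
    · exact (comb_iff_combL hU.pos (lInfos_lt hU (hJ b hb) (Or.inl hq))).2
        (h5 b hb hb0 q (by rwa [hL b hb]))

theorem mem_secs {L : List Info} (hL : L ∈ secs k) : ∀ b < pw k, nth L b ∈ lInfos k := by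
  intro b hb
  rw [secs, List.mem_sections, List.forall₂_iff_get] at hL
  obtain ⟨h1, h2⟩ := hL
  simp only [List.length_map, List.length_range] at h1
  have := h2 b (by omega) (by simpa using hb)
  rw [nth, List.getD_eq_getElem _ _ (by omega)]
  simpa using this

theorem exists_step_iff (hU : Uni (pw k) (pU k)) {B : Pt} {I : Info} (hI : I ∈ lInfos k)
    {Φ : (ℕ → Info) → Prop} (hΦ : ∀ J, Φ J → ∀ b < pw k, J b ∈ lInfos k)
    (hΦ' : ∀ J J', (∀ b < pw k, J b = J' b) → Φ J → Φ J') :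
    (∃ J, Step (pw k) (pU k) (pQ k) B I J ∧ Φ J) ↔
      ∃ L ∈ secs k, StepD k B I L ∧ Φ (nth L) := by
  constructor
  · rintro ⟨J, h1, h2⟩
    have hn : ∀ b < pw k, nth ((List.range (pw k)).map J) b = J b := fun b hb => getD_map_range hb
    refine ⟨(List.range (pw k)).map J, ?_, (step_iff hU hI (hΦ J h2) hn).1 h1,
      hΦ' _ _ (fun b hb => (hn b hb).symm) h2⟩
    rw [secs, List.mem_sections, List.forall₂_iff_get]
    exact ⟨by simp, fun i hi _ => by simpa using hΦ J h2 i (by simpa using hi)⟩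
  · rintro ⟨L, hL, h1, h2⟩
    exact ⟨nth L, (step_iff hU hI (mem_secs hL) fun _ _ => rfl).2 h1, h2⟩

theorem ℓ2_mem (σ : Ty) (p : Pt) (b : ℕ) : ℓ2 k σ p b ∈ tys (pU k) :=
  List.mem_sublists.2 (LF_sublist _ _)

theorem ℓ1_mem (σ : Ty) (p : Pt) (b : ℕ) : ℓ1 k σ p b ∈ tys (pU k) :=
  List.mem_sublists.2 (LF_sublist _ _)

theorem reach_iff {α τ : Ty} (hα : α ∈ tys (pU k)) :
    Reach (pw k) (ℓ2 k) α τ ↔ ReachD k α τ := by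
  constructor
  · intro h R _ hα hR
    induction h with
    | base => exact hα
    | step _ hp hb ih => exact hR _ ih _ hp _ hb
  · intro h
    refine (mem_LF.1 (h (LF (tys (pU k)) fun τ => Reach (pw k) (ℓ2 k) α τ)
      (List.mem_sublists.2 (LF_sublist _ _)) (mem_LF.2 ⟨hα, .base⟩) fun τ hτ p hp b hb => ?_)).2
    exact mem_LF.2 ⟨labt_mem ℓ2_mem (mem_LF.1 hτ).1 p b, .step (mem_LF.1 hτ).2 hp hb⟩

theorem free_iff {α : Ty} (hα : α ∈ tys (pU k)) {P : LPt} :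
    Free (pw k) (pU k) (pQ k) (ℓ2 k) α P ↔ FreeD k α P := by
  constructor
  · rintro ⟨τ, h, p, hp, y, hy, heq⟩
    exact ⟨τ, h.mem_tys ℓ2_mem hα, (reach_iff hα).1 h, p, hp, y, List.mem_range.2 hy, heq⟩
  · rintro ⟨τ, -, h, p, hp, y, hy, heq⟩
    exact ⟨τ, (reach_iff hα).2 h, p, hp, y, List.mem_range.1 hy, heq⟩

end

/-! ### Annotations of states -/

/-- Codes of states. -/
abbrev St := Ty × List Pt

def nd (s : St) : Nd := .st s.1 s.2

theorem nd_injective : Function.Injective nd := by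
  rintro ⟨σ, ps⟩ ⟨σ', ps'⟩ h
  cases h
  rfl

def lStates (k : Prm) : List St := (tys (pU k)).product (tys (pU k))

noncomputable def chdD (k : Prm) (s : St) (b : ℕ) : St :=
  if s.2 = [] then s else if b = 0 then (s.1, s.2.tail) else
    (ℓ1 k s.1 (s.2.getD 0 []) b, ℓ1 k s.1 (s.2.getD 0 []) b)

def bagD (s : St) : Pt := s.2.getD 0 []

noncomputable def pairL (k : Prm) : List (St × Info) := (lStates k).product (lInfos k)

def AnnD (k : Prm) (s : St) (I : Info) : Prop :=
  LEx (pairL k).sublists fun R => (s, I) ∈ R ∧ LAll R fun y =>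
    LocD k (y.1.2 = []) y.2 ∧ LEx (secs k) fun L => StepD k (bagD y.1) y.2 L ∧
      ∀ b < pw k, (chdD k y.1 b, nth L b) ∈ R

def AnnXD (k : Prm) (X : LPt) (s : St) (I : Info) : Prop :=
  LAll (pairL k).sublists fun R => (LAll (pairL k) fun y =>
    ((AnnD k y.1 y.2 ∧ X ∈ y.2.1) ∨ (¬ y.1.2 = [] ∧ LocD k (y.1.2 = []) y.2 ∧
      LEx (secs k) fun L => StepD k (bagD y.1) y.2 L ∧ (∀ b < pw k, AnnD k (chdD k y.1 b) (nth L b)) ∧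
        LEx (List.range (pw k)) fun b => (chdD k y.1 b, nth L b) ∈ R)) → y ∈ R) → (s, I) ∈ R

def EdgeD (k : Prm) (v y : St × Info) : Prop :=
  ¬ y.1.2 = [] ∧ LocD k (y.1.2 = []) y.2 ∧ LEx (secs k) fun L => StepD k (bagD y.1) y.2 L ∧
    (∀ b < pw k, AnnD k (chdD k y.1 b) (nth L b)) ∧
      LEx (List.range (pw k)) fun b => v = (chdD k y.1 b, nth L b)

def LimD (k : Prm) (𝒢 : List St) (X : LPt) : Prop :=
  LEx (pairL k).sublists fun Y => (LAll Y fun y => y.1 ∈ 𝒢 ∧ AnnD k y.1 y.2) ∧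
    (LEx Y fun y => X ∈ y.2.1) ∧ LAll Y fun y => LEx Y fun y' => EdgeD k y y'

section Prim

variable {α : Type} [Primcodable α] {k : α → Prm} {s : α → St} {b : α → ℕ}
  {I : α → Info} {X : α → LPt} {v y : α → St × Info} {𝒢 : α → List St}

@[fun_prop]
theorem PR.lStates (hk : PR k) : PR fun x => lStates (k x) := by
  unfold FrontierOne.lStates; fun_prop

@[fun_prop]
theorem PR.pairL (hk : PR k) : PR fun x => pairL (k x) := by
  unfold FrontierOne.pairL; fun_prop

@[fun_prop]
theorem PR.chdD (hk : PR k) (hs : PR s) (hb : PR b) : PR fun x => chdD (k x) (s x) (b x) := by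
  unfold FrontierOne.chdD; fun_prop

@[fun_prop]
theorem PR.bagD (hs : PR s) : PR fun x => bagD (s x) := by
  unfold FrontierOne.bagD; fun_prop

@[fun_prop]
theorem PP.annD (hk : PR k) (hs : PR s) (hI : PR I) : PP fun x => AnnD (k x) (s x) (I x) := by
  unfold AnnD; fun_prop

@[fun_prop]
theorem PP.annXD (hk : PR k) (hX : PR X) (hs : PR s) (hI : PR I) :
    PP fun x => AnnXD (k x) (X x) (s x) (I x) := by
  unfold AnnXD; fun_prop

@[fun_prop]
theorem PP.edgeD (hk : PR k) (hv : PR v) (hy : PR y) : PP fun x => EdgeD (k x) (v x) (y x) := by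
  unfold EdgeD; fun_prop

@[fun_prop]
theorem PP.limD (hk : PR k) (hg : PR 𝒢) (hX : PR X) : PP fun x => LimD (k x) (𝒢 x) (X x) := by
  unfold LimD; fun_prop

end Prim

section

variable {k : Prm}

theorem nd_chdD (s : St) (b : ℕ) : nd (chdD k s b) = (nd s).chd (ℓ1 k) b := by
  obtain ⟨σ, _ | ⟨p, ps⟩⟩ := s
  · rfl
  · by_cases hb : b = 0
    · subst hb
      rfl
    · simp [chdD, nd, Nd.chd, hb]

theorem nd_bag (s : St) : (nd s).bag = bagD s := by
  obtain ⟨σ, _ | ⟨p, ps⟩⟩ := s <;> rfl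

theorem mem_lStates {s : St} : s ∈ lStates k ↔ s.1 ∈ tys (pU k) ∧ s.2 ∈ tys (pU k) := by
  obtain ⟨a, b⟩ := s
  exact List.mem_product

theorem mem_pairL {y : St × Info} : y ∈ pairL k ↔ y.1 ∈ lStates k ∧ y.2 ∈ lInfos k := by
  obtain ⟨a, b⟩ := y
  exact List.mem_product

theorem chdD_mem {s : St} (hs : s ∈ lStates k) (b : ℕ) : chdD k s b ∈ lStates k := by
  obtain ⟨h1, h2⟩ := mem_lStates.1 hs
  unfold chdD
  split_ifs
  · exact hs
  · exact mem_lStates.2 ⟨h1, List.mem_sublists.2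
      ((List.tail_sublist _).trans (List.mem_sublists.1 h2))⟩
  · exact mem_lStates.2 ⟨ℓ1_mem _ _ _, ℓ1_mem _ _ _⟩

theorem nd_mem_states {s : St} : nd s ∈ states (pU k) ↔ s ∈ lStates k := by
  rw [mem_lStates]
  constructor
  · rintro ⟨σ, hσ, ps, hps, h⟩
    cases h
    exact ⟨hσ, hps⟩
  · exact fun h => ⟨_, h.1, _, h.2, rfl⟩

theorem exists_nd {t : Nd} (h : t ∈ states (pU k)) : ∃ s, nd s = t := by
  obtain ⟨σ, hσ, ps, hps, rfl⟩ := h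
  exact ⟨(σ, ps), rfl⟩

theorem nd_loc_iff {s : St} {I : Info} :
    Loc (pw k) (pU k) (pQ k) (ℓ2 k) (nd s) I ↔ LocD k (s.2 = []) I := loc_iff

theorem Ann.mem_lInfos {t : Nd} {I : Info} (h : Ann (pw k) (pU k) (pQ k) (ℓ1 k) (ℓ2 k) t I) :
    I ∈ lInfos k := h.unfold.1.mem

variable (hU : Uni (pw k) (pU k))
include hU

theorem ann_iff {s : St} {I : Info} (hs : s ∈ lStates k) :
    Ann (pw k) (pU k) (pQ k) (ℓ1 k) (ℓ2 k) (nd s) I ↔ AnnD k s I := by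
  constructor
  · intro h
    refine ⟨LF (pairL k) fun y => Ann (pw k) (pU k) (pQ k) (ℓ1 k) (ℓ2 k) (nd y.1) y.2,
      List.mem_sublists.2 (LF_sublist _ _), mem_LF.2 ⟨mem_pairL.2 ⟨hs, h.mem_lInfos⟩, h⟩, ?_⟩
    intro y hy
    obtain ⟨hy, hA⟩ := mem_LF.1 hy
    obtain ⟨h1, h2⟩ := hA.unfold
    rw [exists_step_iff hU (mem_pairL.1 hy).2 (fun J hJ b hb => (hJ b hb).mem_lInfos)
      (fun J J' h hJ b hb => h b hb ▸ hJ b hb)] at h2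
    obtain ⟨L, hL, h2, h3⟩ := h2
    refine ⟨nd_loc_iff.1 h1, L, hL, nd_bag y.1 ▸ h2, fun b hb => ?_⟩
    refine mem_LF.2 ⟨mem_pairL.2 ⟨chdD_mem (mem_pairL.1 hy).1 b, (h3 b hb).mem_lInfos⟩, ?_⟩
    rw [nd_chdD]
    exact h3 b hb
  · rintro ⟨R, -, hsI, hR⟩
    refine ⟨fun t I => ∃ s, nd s = t ∧ (s, I) ∈ R, ?_, s, rfl, hsI⟩
    rintro _ I ⟨s, rfl, hs⟩
    obtain ⟨h1, L, hL, h2, h3⟩ := hR _ hs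
    refine ⟨nd_loc_iff.2 h1, nth L, (step_iff hU h1.1 (mem_secs hL) fun _ _ => rfl).2
      ((nd_bag s).symm ▸ h2), fun b hb => ⟨_, nd_chdD s b, h3 b hb⟩⟩

theorem step_nd_iff {s : St} (hs : s ∈ lStates k) {I : Info} (hI : I ∈ lInfos k)
    {Ψ : ℕ → Info → Prop} :
    (∃ J, Step (pw k) (pU k) (pQ k) (nd s).bag I J ∧
      (∀ b < pw k, Ann (pw k) (pU k) (pQ k) (ℓ1 k) (ℓ2 k) ((nd s).chd (ℓ1 k) b) (J b)) ∧
      ∃ b < pw k, Ψ b (J b)) ↔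
    LEx (secs k) fun L => StepD k (bagD s) I L ∧ (∀ b < pw k, AnnD k (chdD k s b) (nth L b)) ∧
      LEx (List.range (pw k)) fun b => Ψ b (nth L b) := by
  rw [exists_step_iff hU hI (Φ := fun J => (∀ b < pw k, Ann (pw k) (pU k) (pQ k) (ℓ1 k) (ℓ2 k)
    ((nd s).chd (ℓ1 k) b) (J b)) ∧ ∃ b < pw k, Ψ b (J b))
    (fun J hJ b hb => (hJ.1 b hb).mem_lInfos) (fun J J' h hJ => ⟨fun b hb => h b hb ▸ hJ.1 b hb, by
      obtain ⟨b, hb, h'⟩ := hJ.2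
      exact ⟨b, hb, h b hb ▸ h'⟩⟩)]
  simp only [← nd_chdD, nd_bag, ann_iff hU (chdD_mem hs _), LEx, List.mem_range]

theorem annX_iff {X : LPt} {s : St} {I : Info} (hs : s ∈ lStates k) (hI : I ∈ lInfos k) :
    (∃ n, AnnX (pw k) (pU k) (pQ k) (ℓ1 k) (ℓ2 k) X n (nd s) I) ↔ AnnXD k X s I := by
  constructor
  · rintro ⟨n, h⟩ R _ hR
    induction n generalizing s I with
    | zero =>
      cases h with
      | here h hX => exact hR _ (mem_pairL.2 ⟨hs, hI⟩) (Or.inl ⟨(ann_iff hU hs).1 h, hX⟩)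
    | succ n ih =>
      cases h with
      | @step _ _ _ J b h1 h2 h3 h4 hb h5 =>
        refine hR _ (mem_pairL.2 ⟨hs, hI⟩) (Or.inr ⟨h1, nd_loc_iff.1 h2, ?_⟩)
        refine (step_nd_iff hU hs hI (Ψ := fun b I => (chdD k s b, I) ∈ R)).1
          ⟨J, h3, h4, b, hb, ?_⟩
        exact ih (chdD_mem hs b) (h4 b hb).mem_lInfos (nd_chdD (k := k) s b ▸ h5)
  · intro h
    refine (mem_LF.1 (h (LF (pairL k) fun y => ∃ n, AnnX (pw k) (pU k) (pQ k) (ℓ1 k) (ℓ2 k) X n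
      (nd y.1) y.2) (List.mem_sublists.2 (LF_sublist _ _)) fun y hy h => mem_LF.2 ⟨hy, ?_⟩)).2
    obtain ⟨hs, hI⟩ := mem_pairL.1 hy
    rcases h with ⟨h, hX⟩ | ⟨h1, h2, h3⟩
    · exact ⟨0, .here ((ann_iff hU hs).2 h) hX⟩
    · obtain ⟨J, h3, h4, b, hb, h5⟩ := (step_nd_iff hU hs hI (Ψ := fun b I => (chdD k y.1 b, I) ∈
        LF (pairL k) fun y => ∃ n, AnnX (pw k) (pU k) (pQ k) (ℓ1 k) (ℓ2 k) X n (nd y.1) y.2)).2 h3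
      obtain ⟨n, h5⟩ := (mem_LF.1 h5).2
      exact ⟨n + 1, .step h1 (nd_loc_iff.2 h2) h3 h4 hb (nd_chdD (k := k) y.1 b ▸ h5)⟩

theorem edge_iff {v y : St × Info} (hs : y.1 ∈ lStates k) (hI : y.2 ∈ lInfos k) :
    Edge (pw k) (pU k) (pQ k) (ℓ1 k) (ℓ2 k) (nd v.1, v.2) (nd y.1, y.2) ↔ EdgeD k v y := by
  have := step_nd_iff hU hs hI (Ψ := fun b I => v = (chdD k y.1 b, I))
  refine and_congr Iff.rfl (and_congr nd_loc_iff (Iff.trans ?_ this))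
  have key : ∀ b I, (nd v.1, v.2) = ((nd y.1).chd (ℓ1 k) b, I) ↔ v = (chdD k y.1 b, I) := by
    intro b I
    obtain ⟨s, K⟩ := v
    rw [← nd_chdD]
    exact ⟨fun h => Prod.ext (nd_injective (congrArg Prod.fst h)) (congrArg (fun x => x.2) h),
      fun h => Prod.ext (congrArg (fun x => nd x.1) h) (congrArg (fun x => x.2) h)⟩
  simp only [key]

theorem lim_iff {𝒢 : List St} (h𝒢 : ∀ s ∈ 𝒢, s ∈ lStates k) {X : LPt} :
    Lim (pw k) (pU k) (pQ k) (ℓ1 k) (ℓ2 k) (nd '' {s | s ∈ 𝒢}) X ↔ LimD k 𝒢 X := by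
  constructor
  · rintro ⟨Y, h1, ⟨y, hy, hX⟩, h3⟩
    have hd : ∀ y ∈ Y, ∃ s ∈ 𝒢, y = (nd s, y.2) ∧ (s, y.2) ∈
        LF (pairL k) fun y => y.1 ∈ 𝒢 ∧ (nd y.1, y.2) ∈ Y := fun y hy => by
      obtain ⟨⟨s, hs, h⟩, hA⟩ := h1 y hy
      have : y = (nd s, y.2) := Prod.ext h.symm rfl
      exact ⟨s, hs, this, mem_LF.2 ⟨mem_pairL.2 ⟨h𝒢 s hs, hA.mem_lInfos⟩, hs, this ▸ hy⟩⟩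
    refine ⟨_, List.mem_sublists.2 (LF_sublist (pairL k) fun y => y.1 ∈ 𝒢 ∧ (nd y.1, y.2) ∈ Y),
      fun y hy => ?_, ?_, fun y hy => ?_⟩
    · obtain ⟨-, hy, hy'⟩ := mem_LF.1 hy
      exact ⟨hy, (ann_iff hU (h𝒢 _ hy)).1 (h1 _ hy').2⟩
    · obtain ⟨s, hs, h, h'⟩ := hd y hy
      exact ⟨_, h', hX⟩
    · obtain ⟨-, hy, hy'⟩ := mem_LF.1 hy
      obtain ⟨z, hz, he⟩ := h3 _ hy'
      obtain ⟨s, hs, h, h'⟩ := hd z hz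
      refine ⟨_, h', (edge_iff hU (h𝒢 _ hs) (h1 _ hz).2.mem_lInfos).1 ?_⟩
      rwa [h] at he
  · rintro ⟨Y, h0, h1, ⟨y, hy, hX⟩, h3⟩
    have hY : ∀ y ∈ Y, y.1 ∈ lStates k ∧ y.2 ∈ lInfos k := fun y hy =>
      mem_pairL.1 ((List.mem_sublists.1 h0).subset hy)
    refine ⟨(fun y => (nd y.1, y.2)) '' {y | y ∈ Y}, ?_, ⟨_, ⟨y, hy, rfl⟩, hX⟩, ?_⟩
    · rintro _ ⟨y, hy, rfl⟩
      exact ⟨⟨_, (h1 y hy).1, rfl⟩, (ann_iff hU (hY y hy).1).2 (h1 y hy).2⟩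
    · rintro _ ⟨y, hy, rfl⟩
      obtain ⟨z, hz, he⟩ := h3 y hy
      exact ⟨_, ⟨z, hz, rfl⟩, (edge_iff hU (hY z hz).1 (hY z hz).2).2 he⟩

end

/-! ### Trees with bounded quantifiers -/

/-- Type, derived type and annotations of a tree. -/
abbrev Dt := Ty × Ty × List Info × List Info

noncomputable def lDt (k : Prm) : List Dt :=
  (tys (pU k)).product ((tys (pU k)).product ((lInfos k).sublists.product (lInfos k).sublists))

def nthD (D : List Dt) (b : ℕ) : Dt := D.getD b ([], [], [], [])

/-- The data of a tree without database part. -/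
noncomputable def gSt (k : Prm) (X : LPt) (σ : Ty) : Dt :=
  (σ, c2 k [], LF (lInfos k) fun I => AnnD k (σ, σ) I, LF (lInfos k) fun I => AnnXD k X (σ, σ) I)

/-- The data of a tree, from the data of its children. -/
noncomputable def gDn (k : Prm) (X : LPt) (B : Pt) (D : List Dt) : Dt :=
  ((nthD D 0).1,
    c2 k (LF (pU k).sublists fun q =>
      combL (pw k) B ((List.range (pw k)).map fun b => (nthD D b).2.1) 0 q),
    LF (lInfos k) fun I => LocD k False I ∧ LEx (secs k) fun L => StepD k B I L ∧
      ∀ b < pw k, nth L b ∈ (nthD D b).2.2.1,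
    LF (lInfos k) fun I => LocD k False I ∧ LEx (secs k) fun L => StepD k B I L ∧
      (∀ b < pw k, nth L b ∈ (nthD D b).2.2.1) ∧
        (X ∈ I.1 ∨ LEx (List.range (pw k)) fun b => nth L b ∈ (nthD D b).2.2.2))

def RealD (k : Prm) (𝒢 : List St) (X : LPt) (d : Dt) : Prop :=
  LAll (lDt k).sublists fun R =>
    (LAll (tys (pU k)) fun σ => (LAll (c1 k σ) fun q => q ∈ σ) → (σ, σ) ∈ 𝒢 → gSt k X σ ∈ R) →
    (LAll (pU k).sublists fun B => (LAll B fun a => a.1 ∈ pS k) →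
      LAll ((List.range (pw k)).map fun _ => R).sections fun D =>
        (∀ b < pw k, LAll (pU k).sublists fun q =>
          combL (pw k) B ((List.range (pw k)).map fun b => (nthD D b).1) b q →
            q ∈ (nthD D b).1) → gDn k X B D ∈ R) → d ∈ R

def TopD (I : Info) : Prop := LAll I.1 fun q => q ∈ I.2

def BadD (hm : Prop) (k : Prm) : Prop :=
  (LEx (lDt k) fun d => RealD k (lStates k) [] d ∧
    ¬ LEx (lInfos k) fun I => TopD I ∧ I ∈ d.2.2.1 ∧ [lbl d.2.1] ∈ I.1) ∨
  LEx (LC (pw k) (pU k) (pQ k)) fun X => LEx (lStates k).sublists fun 𝒢 =>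
    (LAll 𝒢 fun s => ∀ b < pw k, chdD k s b ∈ 𝒢) ∧ (hm ∨ ¬ LimD k 𝒢 X) ∧
    LEx (lDt k) fun d => RealD k 𝒢 X d ∧ FreeD k d.2.1 X ∧
      ¬ LEx (lInfos k) fun I => TopD I ∧ I ∈ d.2.2.2

section Prim

variable {α : Type} [Primcodable α] {k : α → Prm} {σ : α → Ty} {B : α → Pt} {b : α → ℕ}
  {I : α → Info} {X : α → LPt} {𝒢 : α → List St} {d : α → Dt} {D : α → List Dt}

@[fun_prop]
theorem PR.lDt (hk : PR k) : PR fun x => lDt (k x) := by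
  unfold FrontierOne.lDt; fun_prop

@[fun_prop]
theorem PR.nthD (hD : PR D) (hb : PR b) : PR fun x => nthD (D x) (b x) := by
  unfold FrontierOne.nthD; fun_prop

@[fun_prop]
theorem PR.gSt (hk : PR k) (hX : PR X) (hσ : PR σ) : PR fun x => gSt (k x) (X x) (σ x) := by
  unfold FrontierOne.gSt; fun_prop

@[fun_prop]
theorem PR.gDn (hk : PR k) (hX : PR X) (hB : PR B) (hD : PR D) :
    PR fun x => gDn (k x) (X x) (B x) (D x) := by
  unfold FrontierOne.gDn; fun_prop

@[fun_prop]
theorem PP.realD (hk : PR k) (hg : PR 𝒢) (hX : PR X) (hd : PR d) :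
    PP fun x => RealD (k x) (𝒢 x) (X x) (d x) := by
  unfold RealD; fun_prop

@[fun_prop]
theorem PP.topD (hI : PR I) : PP fun x => TopD (I x) := by
  unfold TopD; fun_prop

theorem PP.badD (hm : Prop) (hk : PR k) : PP fun x => BadD hm (k x) := by
  unfold BadD; fun_prop

end Prim

section

variable {k : Prm}

/-- The data of a tree. -/
noncomputable def dataOf (k : Prm) (X : LPt) (t : Nd) : Dt :=
  (t.lam, alpha (pw k) (pU k) (c2 k) t,
    LF (lInfos k) fun I => Ann (pw k) (pU k) (pQ k) (ℓ1 k) (ℓ2 k) t I,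
    LF (lInfos k) fun I => ∃ n, AnnX (pw k) (pU k) (pQ k) (ℓ1 k) (ℓ2 k) X n t I)

theorem LF_congr {β : Type} {l : List β} {P Q : β → Prop} (h : ∀ b ∈ l, P b ↔ Q b) :
    LF l P = LF l Q :=
  List.filter_congr fun b hb => by simp [h b hb]

theorem ann_dn_iff {B : Pt} {ch : ℕ → Nd} {I : Info} :
    Ann (pw k) (pU k) (pQ k) (ℓ1 k) (ℓ2 k) (.dn B ch) I ↔ LocD k False I ∧
      ∃ J, Step (pw k) (pU k) (pQ k) B I J ∧
        ∀ b < pw k, Ann (pw k) (pU k) (pQ k) (ℓ1 k) (ℓ2 k) (ch b) (J b) := by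
  constructor
  · intro h
    exact ⟨loc_iff.1 h.unfold.1, h.unfold.2⟩
  · rintro ⟨h1, J, h2, h3⟩
    exact Ann.fold (t := .dn B ch) (loc_iff.2 h1) h2 h3

theorem annX_dn_iff {X : LPt} {B : Pt} {ch : ℕ → Nd} {I : Info} :
    (∃ n, AnnX (pw k) (pU k) (pQ k) (ℓ1 k) (ℓ2 k) X n (.dn B ch) I) ↔ LocD k False I ∧
      ∃ J, Step (pw k) (pU k) (pQ k) B I J ∧
        (∀ b < pw k, Ann (pw k) (pU k) (pQ k) (ℓ1 k) (ℓ2 k) (ch b) (J b)) ∧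
        (X ∈ I.1 ∨ ∃ b < pw k, ∃ n, AnnX (pw k) (pU k) (pQ k) (ℓ1 k) (ℓ2 k) X n (ch b) (J b)) := by
  constructor
  · rintro ⟨n, h⟩
    cases h with
    | here h hX =>
      obtain ⟨h1, J, h2, h3⟩ := ann_dn_iff.1 h
      exact ⟨h1, J, h2, h3, Or.inl hX⟩
    | step _ h2 h3 h4 hb h5 => exact ⟨loc_iff.1 h2, _, h3, h4, Or.inr ⟨_, hb, _, h5⟩⟩
  · rintro ⟨h1, J, h2, h3, hX | ⟨b, hb, n, h4⟩⟩
    · exact ⟨0, .here (ann_dn_iff.2 ⟨h1, J, h2, h3⟩) hX⟩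
    · exact ⟨n + 1, AnnX.step (t := .dn B ch) (fun h => h) (loc_iff.2 h1) h2 h3 hb h4⟩

theorem c2_mem (σ : Ty) : c2 k σ ∈ tys (pU k) := List.mem_sublists.2 (LF_sublist _ _)

theorem alpha_c2_mem (t : Nd) : alpha (pw k) (pU k) (c2 k) t ∈ tys (pU k) := by
  cases t <;> exact c2_mem _

theorem Nd.Good.lam_mem {t : Nd} (h : t.Good (pw k) (pU k) (c1 k)) : t.lam ∈ tys (pU k) := by
  induction t with
  | st σ ps => exact h.1
  | dn B ch ih => exact ih 0 (h.2.1 0)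

theorem dataOf_mem {X : LPt} {t : Nd} (h : t.Good (pw k) (pU k) (c1 k)) :
    dataOf k X t ∈ lDt k :=
  List.pair_mem_product.2 ⟨h.lam_mem, List.pair_mem_product.2 ⟨alpha_c2_mem t,
    List.pair_mem_product.2 ⟨List.mem_sublists.2 (LF_sublist _ _),
      List.mem_sublists.2 (LF_sublist _ _)⟩⟩⟩

variable (hU : Uni (pw k) (pU k))
include hU

theorem dataOf_st {X : LPt} {σ : Ty} (hσ : σ ∈ tys (pU k)) :
    dataOf k X (.st σ σ) = gSt k X σ := by
  have hs : (σ, σ) ∈ lStates k := mem_lStates.2 ⟨hσ, hσ⟩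
  simp only [dataOf, gSt, Prod.mk.injEq]
  refine ⟨rfl, rfl, LF_congr fun I hI => ann_iff hU hs, LF_congr fun I hI => annX_iff hU hs hI⟩

theorem dataOf_dn {X : LPt} {B : Pt} {ch : ℕ → Nd} :
    dataOf k X (.dn B ch) = gDn k X B ((List.range (pw k)).map fun b => dataOf k X (ch b)) := by
  set D := (List.range (pw k)).map fun b => dataOf k X (ch b) with hD
  have hn : ∀ b < pw k, nthD D b = dataOf k X (ch b) := fun b hb => getD_map_range hb
  have h3 : ∀ b < pw k, ∀ I, I ∈ (nthD D b).2.2.1 ↔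
      Ann (pw k) (pU k) (pQ k) (ℓ1 k) (ℓ2 k) (ch b) I := fun b hb I => by
    rw [hn b hb]
    exact mem_LF.trans (and_iff_right_of_imp fun h => h.mem_lInfos)
  have h4 : ∀ b < pw k, ∀ I, I ∈ (nthD D b).2.2.2 ↔
      ∃ n, AnnX (pw k) (pU k) (pQ k) (ℓ1 k) (ℓ2 k) X n (ch b) I := fun b hb I => by
    rw [hn b hb]
    exact mem_LF.trans (and_iff_right_of_imp fun ⟨n, h⟩ => h.ann.mem_lInfos)
  simp only [dataOf, gDn, Prod.mk.injEq]
  refine ⟨?_, ?_, LF_congr fun I hI => ?_, LF_congr fun I hI => ?_⟩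
  · rw [hn 0 hU.pos]
    rfl
  · refine congrArg (c2 k) (LF_congr fun q hq => ?_)
    rw [comb_iff_combL hU.pos (pats_lt hU hq)]
    rw [show ((List.range (pw k)).map fun b => (nthD D b).2.1) =
      (List.range (pw k)).map fun b => alpha (pw k) (pU k) (c2 k) (ch b) from
      List.map_congr_left fun b hb => by rw [hn b (List.mem_range.1 hb)]; rfl]
  · rw [ann_dn_iff]
    refine and_congr_right fun hl => ?_
    rw [exists_step_iff hU hl.1 (fun J hJ b hb => (hJ b hb).mem_lInfos)
      (fun J J' h hJ b hb => h b hb ▸ hJ b hb)]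
    refine exists_congr fun L => and_congr_right fun hL => and_congr_right fun _ =>
      forall₂_congr fun b hb => (h3 b hb _).symm
  · rw [annX_dn_iff]
    refine and_congr_right fun hl => ?_
    rw [exists_step_iff hU hl.1 (fun J hJ b hb => (hJ.1 b hb).mem_lInfos)
      (fun J J' h hJ => ⟨fun b hb => h b hb ▸ hJ.1 b hb, hJ.2.imp_right
        fun ⟨b, hb, h'⟩ => ⟨b, hb, h b hb ▸ h'⟩⟩)]
    refine exists_congr fun L => and_congr_right fun hL => and_congr_right fun _ =>
      and_congr (forall₂_congr fun b hb => (h3 b hb _).symm) (or_congr_right ?_)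
    refine exists_congr fun b => ?_
    rw [List.mem_range]
    exact and_congr_right fun hb => (h4 b hb _).symm

theorem real_dataOf {𝒢 : List St} {X : LPt} {t : Nd} (ht : Adm (pw k) (pU k) (pS k) (c1 k) t)
    (hin : t.In (pw k) (nd '' {s | s ∈ 𝒢})) : RealD k 𝒢 X (dataOf k X t) := by
  intro R _ h1 h2
  obtain ⟨hg, hf, hd⟩ := ht
  induction t with
  | st σ ps =>
    have hps : ps = σ := hf
    subst hps
    rw [dataOf_st hU hg.1]
    refine h1 _ hg.1 hg.2.1 ?_
    obtain ⟨s, hs, h⟩ := hin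
    obtain rfl := nd_injective (a₁ := s) (a₂ := (ps, ps)) h
    exact hs
  | dn B ch ih =>
    rw [dataOf_dn hU]
    have hn : ∀ b < pw k, nthD ((List.range (pw k)).map fun b => dataOf k X (ch b)) b =
      dataOf k X (ch b) := fun b hb => getD_map_range hb
    refine h2 B hg.1 hd.1 _ ?_ fun b hb q hq hq' => ?_
    · rw [List.mem_sections, List.forall₂_iff_get]
      refine ⟨by simp, fun i hi _ => ?_⟩
      simpa using ih i (hin i (by simpa using hi)) (hg.2.1 i) (hf i) (hd.2 i)
    · rw [hn b hb]
      refine hg.2.2 b hb q hq ((comb_iff_combL hU.pos (pats_lt hU hq)).2 ?_)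
      rwa [show ((List.range (pw k)).map fun b => (nthD ((List.range (pw k)).map fun b =>
        dataOf k X (ch b)) b).1) = (List.range (pw k)).map fun b => (ch b).lam from
        List.map_congr_left fun b hb => by rw [hn b (List.mem_range.1 hb)]; rfl] at hq'

theorem exists_of_real {𝒢 : List St} {X : LPt} {d : Dt} (h : RealD k 𝒢 X d) :
    ∃ t, Adm (pw k) (pU k) (pS k) (c1 k) t ∧ t.In (pw k) (nd '' {s | s ∈ 𝒢}) ∧
      dataOf k X t = d := by
  refine (mem_LF.1 (h (LF (lDt k) fun d => ∃ t, Adm (pw k) (pU k) (pS k) (c1 k) t ∧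
    t.In (pw k) (nd '' {s | s ∈ 𝒢}) ∧ dataOf k X t = d) (List.mem_sublists.2 (LF_sublist _ _))
    (fun σ hσ hc hs => ?_) fun B hB hBS D hD hcomb => ?_)).2
  · have hg : (Nd.st σ σ).Good (pw k) (pU k) (c1 k) := ⟨hσ, hc, fun p hp => hp⟩
    rw [← dataOf_st hU hσ]
    exact mem_LF.2 ⟨dataOf_mem hg, _, ⟨hg, rfl, trivial⟩, ⟨_, hs, rfl⟩, rfl⟩
  · rw [List.mem_sections, List.forall₂_iff_get] at hD
    obtain ⟨hlen, hD⟩ := hD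
    simp only [List.length_map, List.length_range] at hlen
    have hD' : ∀ b, ∃ t, Adm (pw k) (pU k) (pS k) (c1 k) t ∧
        t.In (pw k) (nd '' {s | s ∈ 𝒢}) ∧ (b < pw k → dataOf k X t = nthD D b) := by
      have : ∀ b < pw k, ∃ t, Adm (pw k) (pU k) (pS k) (c1 k) t ∧
          t.In (pw k) (nd '' {s | s ∈ 𝒢}) ∧ dataOf k X t = nthD D b := fun b hb => by
        have := hD b (by omega) (by simpa using hb)
        rw [nthD, List.getD_eq_getElem _ _ (by omega)]
        simp only [List.get_eq_getElem, List.getElem_map] at this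
        exact (mem_LF.1 this).2
      intro b
      by_cases hb : b < pw k
      · obtain ⟨t, h1, h2, h3⟩ := this b hb
        exact ⟨t, h1, h2, fun _ => h3⟩
      · obtain ⟨t, h1, h2, h3⟩ := this 0 hU.pos
        exact ⟨t, h1, h2, fun h => absurd h hb⟩
    choose ch h1 h2 h3 using hD'
    have hlist : (List.range (pw k)).map (fun b => dataOf k X (ch b)) = D := by
      refine List.ext_getElem (by simp [hlen]) fun i hi hi' => ?_
      rw [List.getElem_map, List.getElem_range, h3 i (by omega), nthD,
        List.getD_eq_getElem _ _ hi']
    have hlam : ((List.range (pw k)).map fun b => (nthD D b).1) =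
        (List.range (pw k)).map fun b => (ch b).lam :=
      List.map_congr_left fun b hb => by rw [← h3 b (List.mem_range.1 hb)]; rfl
    have hg : (Nd.dn B ch).Good (pw k) (pU k) (c1 k) := by
      refine ⟨hB, fun b => (h1 b).good, fun b hb q hq hq' => ?_⟩
      have := hcomb b hb q hq (by
        rw [hlam]
        exact (comb_iff_combL hU.pos (pats_lt hU hq)).1 hq')
      rwa [← h3 b hb] at this
    have heq : dataOf k X (.dn B ch) = gDn k X B D := by rw [dataOf_dn hU, hlist]
    rw [← heq]
    exact mem_LF.2 ⟨dataOf_mem hg, _, ⟨hg, fun b => (h1 b).full, hBS, fun b => (h1 b).db⟩,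
      fun b _ => h2 b, rfl⟩

theorem exists_tree_iff {𝒢 : List St} {X : LPt} {Φ : Dt → Prop} :
    (∃ t, Adm (pw k) (pU k) (pS k) (c1 k) t ∧ t.In (pw k) (nd '' {s | s ∈ 𝒢}) ∧
      Φ (dataOf k X t)) ↔ ∃ d ∈ lDt k, RealD k 𝒢 X d ∧ Φ d := by
  constructor
  · rintro ⟨t, h1, h2, h3⟩
    exact ⟨_, dataOf_mem h1.good, real_dataOf hU h1 h2, h3⟩
  · rintro ⟨d, -, h1, h2⟩
    obtain ⟨t, h3, h4, rfl⟩ := exists_of_real hU h1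
    exact ⟨t, h3, h4, h2⟩

omit hU in
theorem Adm.in_lStates {t : Nd} (h : Adm (pw k) (pU k) (pS k) (c1 k) t) :
    t.In (pw k) (nd '' {s | s ∈ lStates k}) := by
  obtain ⟨hg, hf, hd⟩ := h
  induction t with
  | st σ ps => exact ⟨(σ, ps), mem_lStates.2 ⟨hg.1, (show ps = σ from hf) ▸ hg.1⟩, rfl⟩
  | dn B ch ih => exact fun b _ => ih b (hg.2.1 b) (hf b) (hd.2 b)

theorem bad_iff (hm : Prop) :
    Bad hm (pw k) (pU k) (pS k) (pQ k) (c1 k) (ℓ1 k) (c2 k) (ℓ2 k) ↔ BadD hm k := by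
  refine or_congr ?_ (exists_congr fun X => and_congr_right fun hX => ?_)
  · have := exists_tree_iff hU (𝒢 := lStates k) (X := []) (Φ := fun d =>
      ¬ LEx (lInfos k) fun I => TopD I ∧ I ∈ d.2.2.1 ∧ [lbl d.2.1] ∈ I.1)
    refine Iff.trans (exists_congr fun t => and_congr_right fun ht => ?_) this
    rw [and_iff_right ht.in_lStates]
    refine not_congr (exists_congr fun I => ?_)
    constructor
    · rintro ⟨h1, h2, h3⟩
      exact ⟨h2.mem_lInfos, h1, mem_LF.2 ⟨h2.mem_lInfos, h2⟩, h3⟩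
    · rintro ⟨-, h1, h2, h3⟩
      exact ⟨h1, (mem_LF.1 h2).2, h3⟩
  · have key : ∀ 𝒢 : List St, ((∃ t, Adm (pw k) (pU k) (pS k) (c1 k) t ∧
        t.In (pw k) (nd '' {s | s ∈ 𝒢}) ∧
        Free (pw k) (pU k) (pQ k) (ℓ2 k) (alpha (pw k) (pU k) (c2 k) t) X ∧ ¬ ∃ I, TopG I ∧
          ∃ n, AnnX (pw k) (pU k) (pQ k) (ℓ1 k) (ℓ2 k) X n t I)) ↔
        LEx (lDt k) fun d => RealD k 𝒢 X d ∧ FreeD k d.2.1 X ∧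
          ¬ LEx (lInfos k) fun I => TopD I ∧ I ∈ d.2.2.2 := by
      intro 𝒢
      have := exists_tree_iff hU (𝒢 := 𝒢) (X := X) (Φ := fun d => FreeD k d.2.1 X ∧
          ¬ LEx (lInfos k) fun I => TopD I ∧ I ∈ d.2.2.2)
      refine Iff.trans (exists_congr fun t => and_congr_right fun ht => and_congr_right fun _ =>
        and_congr (free_iff (alpha_c2_mem t)) (not_congr (exists_congr fun I => ?_))) this
      constructor
      · rintro ⟨h1, n, h2⟩
        exact ⟨h2.ann.mem_lInfos, h1, mem_LF.2 ⟨h2.ann.mem_lInfos, n, h2⟩⟩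
      · rintro ⟨-, h1, h2⟩
        exact ⟨h1, (mem_LF.1 h2).2⟩
    constructor
    · rintro ⟨𝒢, h𝒢, h1, h2, h3⟩
      have heq : nd '' {s | s ∈ LF (lStates k) fun s => nd s ∈ 𝒢} = 𝒢 := by
        ext t
        constructor
        · rintro ⟨s, hs, rfl⟩
          exact (mem_LF.1 hs).2
        · intro ht
          obtain ⟨s, rfl⟩ := exists_nd (h𝒢 ht)
          exact ⟨s, mem_LF.2 ⟨nd_mem_states.1 (h𝒢 ht), ht⟩, rfl⟩
      refine ⟨LF (lStates k) fun s => nd s ∈ 𝒢, List.mem_sublists.2 (LF_sublist _ _),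
        fun s hs b hb => ?_, h2.imp_right fun h2 => ?_, (key _).1 (heq.symm ▸ h3)⟩
      · obtain ⟨hs, hs'⟩ := mem_LF.1 hs
        exact mem_LF.2 ⟨chdD_mem hs b, nd_chdD (k := k) s b ▸ h1 _ hs' b hb⟩
      · rwa [← lim_iff hU (fun s hs => (mem_LF.1 hs).1), heq]
    · rintro ⟨𝒢, h𝒢, h1, h2, h3⟩
      have hsub : ∀ s ∈ 𝒢, s ∈ lStates k := fun s hs => (List.mem_sublists.1 h𝒢).subset hs
      refine ⟨nd '' {s | s ∈ 𝒢}, ?_, ?_, h2.imp_right fun h2 => ?_, (key _).2 h3⟩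
      · rintro _ ⟨s, hs, rfl⟩
        exact nd_mem_states.2 (hsub s hs)
      · rintro _ ⟨s, hs, rfl⟩ b hb
        exact ⟨_, h1 s hs b hb, nd_chdD s b⟩
      · rwa [lim_iff hU hsub]

end

section Decidability

/-- The inputs of the decision problems. -/
abbrev Inp := List TGD × List TGD × List RelSym × List RelSym

/-- The parameters of the search for a witness of non-conservativity. -/
noncomputable def prm (x : Inp) : Prm :=
  (widthOf x.1 + widthOf x.2.1,
    univ (widthOf x.1 + widthOf x.2.1) (x.2.2.1 ++ x.2.2.2 ++ relsOf x.1 ++ relsOf x.2.1),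
    x.2.2.2, x.2.2.1,
    pairs (univ (widthOf x.1 + widthOf x.2.1)
      (x.2.2.1 ++ x.2.2.2 ++ relsOf x.1 ++ relsOf x.2.1)) x.1,
    pairs (univ (widthOf x.1 + widthOf x.2.1)
      (x.2.2.1 ++ x.2.2.2 ++ relsOf x.1 ++ relsOf x.2.1)) x.2.1)

theorem PR.prm : PR prm := by
  unfold FrontierOne.prm
  fun_prop

theorem uni_prm (x : Inp) : Uni (pw (prm x)) (pU (prm x)) :=
  uni_univ (Nat.add_pos_left (widthOf_pos _) _) _

variable {x : Inp}

theorem expr_prm_left (h : ∀ t ∈ x.1, t.wf ∧ t.FrontierOne) :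
    Expr (pU (prm x)) x.1 (prm x).2.2.2.2.1 :=
  expr_pairs h (fun r hr => by simp [hr]) (Nat.le_add_right _ _)

theorem expr_prm_right (h : ∀ t ∈ x.2.1, t.wf ∧ t.FrontierOne) :
    Expr (pU (prm x)) x.2.1 (prm x).2.2.2.2.2 :=
  expr_pairs h (fun r hr => by simp [hr]) (Nat.le_add_left _ _)

theorem Expr.sys {w : ℕ} {U : Pt} {T : List TGD} {Ts : List (Pt × Pt)} (hU : Uni w U)
    (h : Expr U T Ts) : Sys w U Ts (cF w U Ts) (ℓF w U Ts) :=
  sys_least hU fun t ht => ⟨(h.pats t ht).1, (h.pats t ht).2.1⟩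

theorem wf_prm : ∀ a ∈ pU (prm x), a.2.length = a.1.arity ∧ 1 ≤ a.1.arity := fun _ ha =>
  have h := mem_univ.1 ha
  ⟨h.2.1, h.2.2.1⟩

theorem homConservative_iff (h₁ : ∀ t ∈ x.1, t.wf ∧ t.FrontierOne)
    (h₂ : ∀ t ∈ x.2.1, t.wf ∧ t.FrontierOne) :
    HomConservative x.1 x.2.1 {r | r ∈ x.2.2.1} {r | r ∈ x.2.2.2} ↔ ¬ BadD True (prm x) := by
  have hU := uni_prm x
  have hE₁ := expr_prm_left h₁
  have hE₂ := expr_prm_right h₂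
  rw [← bad_iff hU]
  exact ⟨not_bad_of_hom (hE₁.sys hU) (hE₂.sys hU) hU hE₁ hE₂ wf_prm,
    hom_of_not_bad (hE₁.sys hU) (hE₂.sys hU) hU hE₁ hE₂⟩

theorem cqConservative_iff_not_badD (h₁ : ∀ t ∈ x.1, t.wf ∧ t.FrontierOne)
    (h₂ : ∀ t ∈ x.2.1, t.wf ∧ t.FrontierOne) :
    CQConservative x.1 x.2.1 {r | r ∈ x.2.2.1} {r | r ∈ x.2.2.2} ↔ ¬ BadD False (prm x) := by
  have hU := uni_prm x
  have hE₁ := expr_prm_left h₁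
  have hE₂ := expr_prm_right h₂
  rw [← bad_iff hU]
  exact ⟨not_bad_of_cq (hE₁.sys hU) (hE₂.sys hU) hU hE₁ hE₂ wf_prm,
    cq_of_not_bad (hE₁.sys hU) (hE₂.sys hU) hU hE₁ hE₂⟩

theorem PP.computable {α : Type} [Primcodable α] {p : α → Prop} (h : PP p) : ComputablePred p :=
  have ⟨_, h⟩ := h
  ⟨_, h.to_comp⟩

theorem computable_conservative (hm : Prop) {C : Inp → Prop}
    (hC : ∀ x : Inp, (∀ t ∈ x.1, t.wf ∧ t.FrontierOne) → (∀ t ∈ x.2.1, t.wf ∧ t.FrontierOne) →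
      (C x ↔ ¬ BadD hm (prm x))) :
    ComputablePred fun x : Inp =>
      (∀ t ∈ x.1, t.wf ∧ t.FrontierOne) ∧ (∀ t ∈ x.2.1, t.wf ∧ t.FrontierOne) ∧ C x := by
  have h : PP fun x : Inp => (∀ t ∈ x.1, t.wf ∧ t.FrontierOne) ∧
      (∀ t ∈ x.2.1, t.wf ∧ t.FrontierOne) ∧ ¬ BadD hm (prm x) :=
    (PP.wfL.comp (f := fun x : Inp => x.1) (by fun_prop)).and
      ((PP.wfL.comp (f := fun x : Inp => x.2.1) (by fun_prop)).and (PP.badD hm PR.prm).not)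
  convert h.computable using 2 with x
  exact and_congr_right fun h₁ => and_congr_right fun h₂ => hC x h₁ h₂

end Decidability

end FrontierOne

/-- Theorem 8: CQ-conservativity and hom-conservativity for
frontier-one TGDs are decidable. -/
theorem frontier_one_conservativity_decidable :
    ComputablePred (fun x : List TGD × List TGD × List RelSym × List RelSym =>
        (∀ t ∈ x.1, t.wf ∧ t.FrontierOne) ∧ (∀ t ∈ x.2.1, t.wf ∧ t.FrontierOne) ∧
        CQConservative x.1 x.2.1 { r | r ∈ x.2.2.1 } { r | r ∈ x.2.2.2 }) ∧
    ComputablePred (fun x : List TGD × List TGD × List RelSym × List RelSym =>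
        (∀ t ∈ x.1, t.wf ∧ t.FrontierOne) ∧ (∀ t ∈ x.2.1, t.wf ∧ t.FrontierOne) ∧
        HomConservative x.1 x.2.1 { r | r ∈ x.2.2.1 } { r | r ∈ x.2.2.2 }) :=
  ⟨FrontierOne.computable_conservative False
      fun _ => FrontierOne.cqConservative_iff_not_badD,
    FrontierOne.computable_conservative True fun _ => FrontierOne.homConservative_iff⟩
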